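/- arXiv:1701.02397 — 2 statements merged into one kernel-verified Lean document; each statement's English description precedes it below -/
import Mathlib

section
/- Let p ∈ (0,1) with p ≠ 1/2, q = 1 − p, h = −p log p − q log q, and λ = p q (log(p/q))²/h³. Let (S_n, K_n)_{n≥0} be a random trie pair family with parameter p, let Σ̂_n be the covariance matrix of (S_n, K_n) and set Σ̃_n = diag(Var(S_n), λ n log n). Then Σ̂_n^{−1/2} Σ̃_n^{1/2} converges, as n → ∞, to the 2×2 identity matrix, where M^{1/2} denotes the unique positive-definite square root of a positive-definite matrix M and M^{−1/2} its inverse. -/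
open MeasureTheory ProbabilityTheory Filter Topology

noncomputable def binomialMeasure (n : ℕ) (p : ℝ) : Measure ℕ :=
  ∑ k ∈ Finset.range (n + 1),
    (ENNReal.ofReal ((n.choose k : ℝ) * p ^ k * (1 - p) ^ (n - k))) • Measure.dirac k

/-- The combination map `(B, (S',K')_j, (S'',K'')_j) ↦ (S'_B + S''_{n-B} + 1, K'_B + K''_{n-B} + n)`. -/
def trieStep (n : ℕ) (ω : ℕ × ((ℕ → ℕ × ℕ) × (ℕ → ℕ × ℕ))) : ℕ × ℕ :=
  ((ω.2.1 ω.1).1 + (ω.2.2 (n - ω.1)).1 + 1,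
   (ω.2.1 ω.1).2 + (ω.2.2 (n - ω.1)).2 + n)

/-- A random trie pair family with parameter `p`, given by the joint laws
`μ n` of `(S_n, K_n)` on `ℕ × ℕ`. -/
structure IsTriePairFamily (p : ℝ) (μ : ℕ → Measure (ℕ × ℕ)) : Prop where
  prob : ∀ n, IsProbabilityMeasure (μ n)
  moments : ∀ n r : ℕ, Integrable (fun x : ℕ × ℕ => ((x.1 : ℝ) + (x.2 : ℝ)) ^ r) (μ n)
  init0 : μ 0 = Measure.dirac (0, 0)
  init1 : μ 1 = Measure.dirac (0, 0)
  recur : ∀ n, 2 ≤ n → ∃ P : Measure (ℕ × ((ℕ → ℕ × ℕ) × (ℕ → ℕ × ℕ))),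
    IsProbabilityMeasure P ∧
    P.map Prod.fst = binomialMeasure n p ∧
    (∀ j, P.map (fun ω => ω.2.1 j) = μ j) ∧
    (∀ j, P.map (fun ω => ω.2.2 j) = μ j) ∧
    P = (P.map Prod.fst).prod
          ((P.map (fun ω => ω.2.1)).prod (P.map (fun ω => ω.2.2))) ∧
    μ n = P.map (trieStep n)

noncomputable def eS (μ : ℕ → Measure (ℕ × ℕ)) (n : ℕ) : ℝ := ∫ x, (x.1 : ℝ) ∂ μ n

noncomputable def eK (μ : ℕ → Measure (ℕ × ℕ)) (n : ℕ) : ℝ := ∫ x, (x.2 : ℝ) ∂ μ n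

noncomputable def varS (μ : ℕ → Measure (ℕ × ℕ)) (n : ℕ) : ℝ :=
  ∫ x, ((x.1 : ℝ) - eS μ n) ^ 2 ∂ μ n

noncomputable def varK (μ : ℕ → Measure (ℕ × ℕ)) (n : ℕ) : ℝ :=
  ∫ x, ((x.2 : ℝ) - eK μ n) ^ 2 ∂ μ n

noncomputable def covSK (μ : ℕ → Measure (ℕ × ℕ)) (n : ℕ) : ℝ :=
  ∫ x, ((x.1 : ℝ) - eS μ n) * ((x.2 : ℝ) - eK μ n) ∂ μ n

/-! ### Binomial averages -/

/-- The binomial probability weights. -/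
noncomputable def binWeight (x : ℝ) (n k : ℕ) : ℝ := (n.choose k : ℝ) * x ^ k * (1 - x) ^ (n - k)

/-- The expectation of `f` under the binomial law with parameters `n` and `x`. -/
noncomputable def thin (x : ℝ) (f : ℕ → ℝ) (n : ℕ) : ℝ :=
  ∑ k ∈ Finset.range (n + 1), binWeight x n k * f k

/-- The forward difference of a sequence. -/
def fdiff (f : ℕ → ℝ) (n : ℕ) : ℝ := f (n + 1) - f n

lemma binWeight_nonneg {x : ℝ} (h0 : 0 ≤ x) (h1 : x ≤ 1) (n k : ℕ) : 0 ≤ binWeight x n k := by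
  have : 0 ≤ 1 - x := by linarith
  unfold binWeight; positivity

@[simp] lemma thin_zero (x : ℝ) (f : ℕ → ℝ) : thin x f 0 = f 0 := by
  simp [thin, binWeight]

lemma thin_succ (x : ℝ) (f : ℕ → ℝ) (n : ℕ) :
    thin x f (n + 1) = x * thin x (fun k => f (k + 1)) n + (1 - x) * thin x f n := by
  unfold thin
  rw [Finset.sum_range_succ' _ (n + 1), Finset.mul_sum, Finset.mul_sum]
  have h2 : ∑ k ∈ Finset.range (n + 1), (1 - x) * (binWeight x n k * f k)
      = ∑ k ∈ Finset.range (n + 1), (n.choose (k + 1) : ℝ) * x ^ (k + 1) * (1 - x) ^ (n - k)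
          * f (k + 1) + (1 - x) ^ (n + 1) * f 0 := by
    rw [Finset.sum_range_succ', Finset.sum_range_succ _ n]
    simp only [Nat.choose_succ_self, Nat.cast_zero, zero_mul, add_zero]
    congr 1
    · refine Finset.sum_congr rfl fun k hk => ?_
      have hk : k < n := Finset.mem_range.1 hk
      have : n - k = (n - (k + 1)) + 1 := by omega
      rw [this, pow_succ, binWeight]; ring
    · simp [binWeight, pow_succ]; ring
  rw [h2, ← add_assoc, ← Finset.sum_add_distrib]
  congr 1
  · refine Finset.sum_congr rfl fun k _ => ?_
    simp only [binWeight, Nat.choose_succ_succ, Nat.add_sub_add_right]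
    push_cast; ring
  · simp [binWeight]

lemma thin_congr {x : ℝ} {f g : ℕ → ℝ} {n : ℕ} (h : ∀ k ≤ n, f k = g k) :
    thin x f n = thin x g n :=
  Finset.sum_congr rfl fun k hk => by
    rw [h k (Nat.lt_succ_iff.1 (Finset.mem_range.1 hk))]

lemma thin_add (x : ℝ) (f g : ℕ → ℝ) (n : ℕ) :
    thin x (fun k => f k + g k) n = thin x f n + thin x g n := by
  simp [thin, mul_add, Finset.sum_add_distrib]

lemma thin_sub (x : ℝ) (f g : ℕ → ℝ) (n : ℕ) :
    thin x (fun k => f k - g k) n = thin x f n - thin x g n := by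
  simp [thin, mul_sub, Finset.sum_sub_distrib]

lemma thin_const_mul (x c : ℝ) (f : ℕ → ℝ) (n : ℕ) :
    thin x (fun k => c * f k) n = c * thin x f n := by
  simp only [thin, Finset.mul_sum]
  exact Finset.sum_congr rfl fun k _ => by ring

@[simp] lemma thin_const (x c : ℝ) (n : ℕ) : thin x (fun _ => c) n = c := by
  induction n with
  | zero => simp
  | succ n ih => rw [thin_succ, ih]; ring

lemma thin_mono {x : ℝ} (h0 : 0 ≤ x) (h1 : x ≤ 1) {f g : ℕ → ℝ} {n : ℕ}
    (h : ∀ k ≤ n, f k ≤ g k) : thin x f n ≤ thin x g n :=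
  Finset.sum_le_sum fun k hk => mul_le_mul_of_nonneg_left
    (h k (Nat.lt_succ_iff.1 (Finset.mem_range.1 hk))) (binWeight_nonneg h0 h1 n k)

lemma thin_nonneg {x : ℝ} (h0 : 0 ≤ x) (h1 : x ≤ 1) {f : ℕ → ℝ} {n : ℕ}
    (h : ∀ k ≤ n, 0 ≤ f k) : 0 ≤ thin x f n := by
  simpa using thin_mono h0 h1 (f := fun _ => 0) h

lemma abs_thin_le {x : ℝ} (h0 : 0 ≤ x) (h1 : x ≤ 1) {f g : ℕ → ℝ} {n : ℕ}
    (h : ∀ k ≤ n, |f k| ≤ g k) : |thin x f n| ≤ thin x g n := by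
  rw [abs_le]
  constructor
  · have := thin_mono h0 h1 (f := fun k => (-1) * g k) (g := f) (n := n)
      fun k hk => by linarith [(abs_le.1 (h k hk)).1]
    rw [thin_const_mul] at this; linarith
  · exact thin_mono h0 h1 fun k hk => (abs_le.1 (h k hk)).2

lemma fdiff_thin (x : ℝ) (f : ℕ → ℝ) (n : ℕ) :
    fdiff (thin x f) n = x * thin x (fdiff f) n := by
  have : thin x (fdiff f) n = thin x (fun k => f (k + 1)) n - thin x f n := thin_sub _ _ _ _
  rw [this, fdiff, thin_succ]; ring

lemma thin_thin (x y : ℝ) (f : ℕ → ℝ) (n : ℕ) : thin x (thin y f) n = thin (x * y) f n := by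
  induction n generalizing f with
  | zero => simp
  | succ n ih =>
    rw [thin_succ, thin_succ]
    simp only [thin_succ y]
    rw [thin_add, thin_const_mul, thin_const_mul]
    rw [show thin x (thin y fun k => f (k + 1)) n = _ from ih _, ih f]
    ring

lemma thin_comm (x y : ℝ) (f : ℕ → ℝ) (n : ℕ) : thin x (thin y f) n = thin y (thin x f) n := by
  rw [thin_thin, thin_thin, mul_comm]

@[simp] lemma thin_one (f : ℕ → ℝ) (n : ℕ) : thin 1 f n = f n := by
  induction n generalizing f with
  | zero => simp
  | succ n ih => rw [thin_succ, ih]; simp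

lemma thin_natCast_mul (x : ℝ) (f : ℕ → ℝ) (n : ℕ) :
    thin x (fun k => (k : ℝ) * f k) (n + 1) = (n + 1) * x * thin x (fun k => f (k + 1)) n := by
  induction n generalizing f with
  | zero => simp [thin_succ]
  | succ n ih =>
    rw [thin_succ, ih]
    have : thin x (fun k => ((k + 1 : ℕ) : ℝ) * f (k + 1)) (n + 1)
        = thin x (fun k => (k : ℝ) * f (k + 1)) (n + 1) + thin x (fun k => f (k + 1)) (n + 1) := by
      rw [← thin_add]; exact thin_congr fun k _ => by push_cast; ring
    rw [this, ih (fun k => f (k + 1)), thin_succ x (fun k => f (k + 1))]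
    push_cast; ring

/-- Size-biasing for binomial averages. -/
lemma thin_div_succ (x : ℝ) (f : ℕ → ℝ) (n : ℕ) :
    x * thin x (fun k => f (k + 1) / (k + 1 : ℝ)) n
      = (thin x f (n + 1) - (1 - x) ^ (n + 1) * f 0) / (n + 1 : ℝ) := by
  have h1 := thin_natCast_mul x (fun k => f k / k) n
  have h2 : thin x (fun k => (k : ℝ) * (f k / k)) (n + 1)
      = thin x f (n + 1) - (1 - x) ^ (n + 1) * f 0 := by
    rw [thin, thin, Finset.sum_range_succ', Finset.sum_range_succ' _ (n + 1)]
    have : ∀ k ∈ Finset.range (n + 1),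
        binWeight x (n + 1) (k + 1) * (((k + 1 : ℕ) : ℝ) * (f (k + 1) / ((k + 1 : ℕ) : ℝ)))
        = binWeight x (n + 1) (k + 1) * f (k + 1) := fun k _ => by
      rw [mul_div_cancel₀]; positivity
    rw [Finset.sum_congr rfl this]
    simp [binWeight]
  rw [h2] at h1
  rw [h1]
  have : ((n : ℝ) + 1) ≠ 0 := by positivity
  field_simp
  push_cast
  rfl

lemma thin_inv_succ (x : ℝ) (n : ℕ) :
    x * thin x (fun k => 1 / (k + 1 : ℝ)) n = (1 - (1 - x) ^ (n + 1)) / (n + 1 : ℝ) := by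
  have := thin_div_succ x (fun _ => 1) n
  simpa using this

lemma thin_inv_succ_le {x : ℝ} (h0 : 0 < x) (h1 : x ≤ 1) (n : ℕ) :
    thin x (fun k => 1 / (k + 1 : ℝ)) n ≤ 1 / x * (1 / (n + 1 : ℝ)) := by
  have h := thin_inv_succ x n
  have h2 : (1 - (1 - x) ^ (n + 1)) / (n + 1 : ℝ) ≤ 1 / (n + 1 : ℝ) := by
    have : 0 ≤ (1 - x) ^ (n + 1) := pow_nonneg (by linarith) _
    gcongr; linarith
  rw [← h] at h2
  calc _ = 1 / x * (x * thin x (fun k => 1 / (k + 1 : ℝ)) n) := by field_simp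
    _ ≤ _ := by gcongr

lemma thin_inv_succ_mul_le {x : ℝ} (h0 : 0 < x) (h1 : x ≤ 1) (n : ℕ) :
    thin x (fun k => 1 / ((k + 1 : ℝ) * (k + 2))) n
      ≤ 1 / x ^ 2 * (1 / ((n + 1 : ℝ) * (n + 2))) := by
  have h := thin_div_succ x (fun k => 1 / (k + 1 : ℝ)) n
  have h2 := thin_inv_succ_le h0 h1 (n + 1)
  have h3 : 0 ≤ (1 - x) ^ (n + 1) := pow_nonneg (by linarith) _
  have h4 : thin x (fun k => 1 / ((k + 1 : ℝ) * (k + 2))) n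
      = thin x (fun k => 1 / (((k + 1 : ℕ) : ℝ) + 1) / (k + 1 : ℝ)) n :=
    thin_congr fun k _ => by push_cast; field_simp; ring
  rw [h4]
  calc _ = 1 / x * (x * thin x (fun k => 1 / (((k + 1 : ℕ) : ℝ) + 1) / (k + 1 : ℝ)) n) := by
        field_simp
    _ ≤ 1 / x * ((1 / x * (1 / ((n + 1 : ℕ) + 1 : ℝ))) / (n + 1 : ℝ)) := by
        rw [h]; gcongr; simp only [Nat.cast_zero, zero_add, div_one, mul_one]; linarith
    _ = _ := by push_cast; field_simp; ring

lemma sq_thin_le {x : ℝ} (h0 : 0 ≤ x) (h1 : x ≤ 1) (f : ℕ → ℝ) (n : ℕ) :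
    thin x f n ^ 2 ≤ thin x (fun k => f k ^ 2) n := by
  have h := thin_nonneg h0 h1 (f := fun k => (f k - thin x f n) ^ 2) (n := n)
    fun k _ => sq_nonneg _
  have : thin x (fun k => (f k - thin x f n) ^ 2) n
      = thin x (fun k => f k ^ 2) n - 2 * thin x f n * thin x f n + thin x f n ^ 2 := by
    have e : thin x (fun k => (f k - thin x f n) ^ 2) n
        = thin x (fun k => f k ^ 2 - 2 * thin x f n * f k + thin x f n ^ 2) n :=
      thin_congr fun k _ => by ring
    rw [e, thin_add, thin_sub, thin_const_mul, thin_const]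
  nlinarith

/-- The variance of `f` under a binomial law. -/
noncomputable def binVar (x : ℝ) (f : ℕ → ℝ) (n : ℕ) : ℝ :=
  thin x (fun k => f k ^ 2) n - thin x f n ^ 2

/-- The Poincaré inequality for binomial laws. -/
lemma binVar_succ_le {x : ℝ} (h0 : 0 ≤ x) (h1 : x ≤ 1) (f : ℕ → ℝ) (n : ℕ) :
    binVar x f (n + 1) ≤ (n + 1) * (x * (1 - x)) * thin x (fun k => fdiff f k ^ 2) n := by
  have hx : 0 ≤ x * (1 - x) := mul_nonneg h0 (by linarith)
  have step : ∀ m (f : ℕ → ℝ), binVar x f (m + 1) = x * (1 - x) * thin x (fun k => fdiff f k ^ 2) m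
      + binVar x (fun k => f k + x * fdiff f k) m := by
    intro m f
    have e1 : thin x (fun k => f k + x * fdiff f k) m = thin x f (m + 1) := by
      rw [thin_add, thin_const_mul, ← fdiff_thin, fdiff]; ring
    have e2 : x * (1 - x) * thin x (fun k => fdiff f k ^ 2) m
        + thin x (fun k => (f k + x * fdiff f k) ^ 2) m = thin x (fun k => f k ^ 2) (m + 1) := by
      rw [thin_succ, ← thin_const_mul, ← thin_const_mul, ← thin_const_mul, ← thin_add, ← thin_add]
      exact thin_congr fun k _ => by simp only [fdiff]; ring
    rw [binVar, binVar, e1, ← e2]; ring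
  induction n generalizing f with
  | zero => rw [step]; simp [binVar]
  | succ n ih =>
    rw [step]
    have h2 := ih (fun k => f k + x * fdiff f k)
    have h3 : thin x (fun k => fdiff (fun k => f k + x * fdiff f k) k ^ 2) n
        ≤ thin x (fun k => fdiff f k ^ 2) (n + 1) := by
      rw [thin_succ, ← thin_const_mul, ← thin_const_mul, ← thin_add]
      refine thin_mono h0 h1 fun k _ => ?_
      simp only [fdiff]
      nlinarith [mul_nonneg hx (sq_nonneg (f (k + 1 + 1) - f (k + 1) - (f (k + 1) - f k)))]
    have h4 := mul_le_mul_of_nonneg_left h3 (mul_nonneg (by positivity : (0 : ℝ) ≤ n + 1) hx)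
    push_cast
    linarith

lemma thin_reflect {x y : ℝ} (h : x + y = 1) (f : ℕ → ℝ) (n : ℕ) :
    thin x (fun k => f (n - k)) n = thin y f n := by
  unfold thin
  rw [← Finset.sum_range_reflect]
  refine Finset.sum_congr rfl fun k hk => ?_
  have hk : k ≤ n := Nat.lt_succ_iff.1 (Finset.mem_range.1 hk)
  have e : n - (n - k) = k := by omega
  simp only [Nat.add_sub_cancel, binWeight, e, Nat.choose_symm hk]
  rw [show y = 1 - x by linarith]; ring

lemma tendsto_thin_zero {x : ℝ} (h0 : 0 < x) (h1 : x ≤ 1) {f : ℕ → ℝ}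
    (hf : Tendsto f atTop (𝓝 0)) : Tendsto (thin x f) atTop (𝓝 0) := by
  obtain ⟨K, hK⟩ := hf.abs.bddAbove_range
  have hK' : ∀ n, |f n| ≤ K := fun n => hK ⟨n, rfl⟩
  have hK0 : 0 ≤ K := (abs_nonneg _).trans (hK' 0)
  rw [Metric.tendsto_atTop]
  intro ε hε
  obtain ⟨R, hR⟩ := (Metric.tendsto_atTop.1 hf) (ε / 2) (by positivity)
  obtain ⟨N, hN⟩ := exists_nat_gt (2 * (K * (R + 1) * (1 / x)) / ε)
  refine ⟨N, fun n hn => ?_⟩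
  rw [Real.dist_eq, sub_zero]
  have hb : ∀ k ≤ n, |f k| ≤ ε / 2 + K * (R + 1) * (1 / (k + 1 : ℝ)) := by
    intro k _
    rcases le_or_gt R k with hk | hk
    · have := hR k hk
      rw [Real.dist_eq, sub_zero] at this
      have : 0 ≤ K * (R + 1) * (1 / (k + 1 : ℝ)) := by positivity
      linarith
    · have hk' : (k : ℝ) + 1 ≤ R + 1 := by exact_mod_cast (by omega : k + 1 ≤ R + 1)
      have : K ≤ K * (R + 1) * (1 / (k + 1 : ℝ)) := by
        rw [mul_one_div, le_div_iff₀ (by positivity)]; gcongr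
      linarith [hK' k]
  have h := abs_thin_le h0.le h1 hb
  rw [thin_add, thin_const, thin_const_mul] at h
  have h2 := thin_inv_succ_le h0 h1 n
  have h3 : K * (R + 1) * thin x (fun k => 1 / (k + 1 : ℝ)) n
      ≤ K * (R + 1) * (1 / x * (1 / (n + 1 : ℝ))) := by gcongr
  have h4 : K * (R + 1) * (1 / x * (1 / (n + 1 : ℝ))) < ε / 2 := by
    have hn' : (N : ℝ) ≤ n := by exact_mod_cast hn
    rw [div_lt_iff₀ hε] at hN
    rw [← mul_assoc, mul_one_div, div_lt_iff₀ (by positivity)]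
    nlinarith
  linarith

/-! ### The averaging operator and its Green operator -/

/-- One step of the tagged-string chain. -/
noncomputable def avg (p q : ℝ) (f : ℕ → ℝ) (n : ℕ) : ℝ := p * thin p f n + q * thin q f n

/-- The discrepancy between the two children of a node. -/
noncomputable def disc (p q : ℝ) (f : ℕ → ℝ) (n : ℕ) : ℝ := thin p f n - thin q f n

/-- The potential of `g` for the tagged-string chain, killed at `0`. -/
noncomputable def green (p q : ℝ) (g : ℕ → ℝ) : ℕ → ℝ
  | n => if n = 0 then 0 else
    (g n + ∑ k : Fin n, (p * binWeight p n k + q * binWeight q n k) * green p q g k)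
      / (1 - p ^ (n + 1) - q ^ (n + 1))
  decreasing_by exact k.2

section Green

variable {p q : ℝ} (hp : 0 < p) (hq : 0 < q) (hpq : p + q = 1)

lemma avg_eq_sum (f : ℕ → ℝ) (n : ℕ) :
    avg p q f n = ∑ k ∈ Finset.range n, (p * binWeight p n k + q * binWeight q n k) * f k
      + (p ^ (n + 1) + q ^ (n + 1)) * f n := by
  unfold avg thin
  rw [Finset.mul_sum, Finset.mul_sum, ← Finset.sum_add_distrib, Finset.sum_range_succ]
  congr 1
  · exact Finset.sum_congr rfl fun k _ => by ring
  · simp [binWeight]; ring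

include hp hq hpq

lemma binWeight_mix_nonneg (n k : ℕ) : 0 ≤ p * binWeight p n k + q * binWeight q n k := by
  have h1 := binWeight_nonneg hp.le (by linarith) n k
  have h2 := binWeight_nonneg hq.le (by linarith) n k
  positivity

lemma two_mul_le_one_sub_pow {n : ℕ} (hn : 1 ≤ n) :
    2 * (p * q) ≤ 1 - p ^ (n + 1) - q ^ (n + 1) := by
  have h1 : p ^ (n + 1) ≤ p ^ 2 := pow_le_pow_of_le_one hp.le (by linarith) (by omega)
  have h2 : q ^ (n + 1) ≤ q ^ 2 := pow_le_pow_of_le_one hq.le (by linarith) (by omega)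
  have : p ^ 2 + q ^ 2 + 2 * (p * q) = 1 := by
    rw [show q = 1 - p by linarith]; ring
  linarith

lemma one_sub_pow_pos {n : ℕ} (hn : 1 ≤ n) : 0 < 1 - p ^ (n + 1) - q ^ (n + 1) :=
  lt_of_lt_of_le (by positivity) (two_mul_le_one_sub_pow hp hq hpq hn)

lemma nonneg_of_avg_le_of_ge {F : ℕ → ℝ} {R : ℕ} (hR : 1 ≤ R) (h0 : ∀ n < R, 0 ≤ F n)
    (h : ∀ n, R ≤ n → avg p q F n ≤ F n) (n : ℕ) : 0 ≤ F n := by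
  induction n using Nat.strong_induction_on with
  | _ n ih =>
    rcases lt_or_ge n R with hn | hn
    · exact h0 n hn
    · have h1 := h n hn
      rw [avg_eq_sum] at h1
      have h2 : 0 ≤ ∑ k ∈ Finset.range n, (p * binWeight p n k + q * binWeight q n k) * F k :=
        Finset.sum_nonneg fun k hk =>
          mul_nonneg (binWeight_mix_nonneg hp hq hpq n k) (ih k (Finset.mem_range.1 hk))
      have h3 := one_sub_pow_pos hp hq hpq (hR.trans hn)
      by_contra! hneg
      nlinarith

lemma nonneg_of_avg_le {F : ℕ → ℝ} (h0 : 0 ≤ F 0) (h : ∀ n, 1 ≤ n → avg p q F n ≤ F n) (n : ℕ) :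
    0 ≤ F n :=
  nonneg_of_avg_le_of_ge hp hq hpq le_rfl (fun n hn => by
    obtain rfl : n = 0 := by omega
    exact h0) h n

omit hp hq hpq in
@[simp] lemma green_zero (g : ℕ → ℝ) : green p q g 0 = 0 := by rw [green]; simp

lemma green_eq (g : ℕ → ℝ) {n : ℕ} (hn : 1 ≤ n) :
    green p q g n = avg p q (green p q g) n + g n := by
  have h3 := one_sub_pow_pos hp hq hpq hn
  have h := green.eq_1 p q g n
  rw [if_neg (by omega), eq_div_iff h3.ne',
    Fin.sum_univ_eq_sum_range (fun k => (p * binWeight p n k + q * binWeight q n k) * green p q g k)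
      n] at h
  rw [avg_eq_sum]
  linarith

omit hp hq hpq in
lemma avg_add (f g : ℕ → ℝ) (n : ℕ) :
    avg p q (fun k => f k + g k) n = avg p q f n + avg p q g n := by
  simp only [avg, thin_add]; ring

omit hp hq hpq in
lemma avg_sub (f g : ℕ → ℝ) (n : ℕ) :
    avg p q (fun k => f k - g k) n = avg p q f n - avg p q g n := by
  simp only [avg, thin_sub]; ring

omit hp hq hpq in
lemma avg_const_mul (c : ℝ) (f : ℕ → ℝ) (n : ℕ) :
    avg p q (fun k => c * f k) n = c * avg p q f n := by
  simp only [avg, thin_const_mul]; ring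

omit hp hq in
lemma avg_const (c : ℝ) (n : ℕ) : avg p q (fun _ => c) n = c := by
  simp only [avg, thin_const]; rw [← add_mul, hpq, one_mul]

omit hp hq in
lemma avg_zero (f : ℕ → ℝ) : avg p q f 0 = f 0 := by
  simp only [avg, thin_zero]; rw [← add_mul, hpq, one_mul]

lemma avg_mono {f g : ℕ → ℝ} {n : ℕ} (h : ∀ k ≤ n, f k ≤ g k) : avg p q f n ≤ avg p q g n := by
  have h1 := thin_mono hp.le (by linarith) h
  have h2 := thin_mono hq.le (by linarith) h
  unfold avg; gcongr

lemma green_le_of_super {g F : ℕ → ℝ} (h0 : 0 ≤ F 0)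
    (h : ∀ n, 1 ≤ n → g n ≤ F n - avg p q F n) (n : ℕ) : green p q g n ≤ F n := by
  have := nonneg_of_avg_le hp hq hpq (F := fun n => F n - green p q g n) (by simpa) (fun n hn => by
    rw [avg_sub]; linarith [h n hn, green_eq hp hq hpq g hn]) n
  linarith

lemma le_green_of_sub {g F : ℕ → ℝ} (h0 : F 0 ≤ 0)
    (h : ∀ n, 1 ≤ n → F n - avg p q F n ≤ g n) (n : ℕ) : F n ≤ green p q g n := by
  have := nonneg_of_avg_le hp hq hpq (F := fun n => green p q g n - F n) (by simpa) (fun n hn => by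
    rw [avg_sub]; linarith [h n hn, green_eq hp hq hpq g hn]) n
  linarith

lemma eq_green {g F : ℕ → ℝ} (h0 : F 0 = 0) (h : ∀ n, 1 ≤ n → F n = avg p q F n + g n) (n : ℕ) :
    F n = green p q g n :=
  le_antisymm (le_green_of_sub hp hq hpq h0.le (fun n hn => by linarith [h n hn]) n)
    (green_le_of_super hp hq hpq h0.ge (fun n hn => by linarith [h n hn]) n)

lemma green_mono {f g : ℕ → ℝ} (h : ∀ n, 1 ≤ n → f n ≤ g n) (n : ℕ) :
    green p q f n ≤ green p q g n :=
  green_le_of_super hp hq hpq (by simp)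
    (fun n hn => by linarith [h n hn, green_eq hp hq hpq g hn]) n

lemma green_congr {f g : ℕ → ℝ} (h : ∀ n, 1 ≤ n → f n = g n) (n : ℕ) :
    green p q f n = green p q g n :=
  le_antisymm (green_mono hp hq hpq (fun n hn => (h n hn).le) n)
    (green_mono hp hq hpq (fun n hn => (h n hn).ge) n)

lemma green_add (f g : ℕ → ℝ) (n : ℕ) :
    green p q (fun k => f k + g k) n = green p q f n + green p q g n :=
  (eq_green hp hq hpq (F := fun n => green p q f n + green p q g n) (by simp) (fun n hn => by
    rw [avg_add]; linarith [green_eq hp hq hpq f hn, green_eq hp hq hpq g hn]) n).symm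

lemma green_const_mul (c : ℝ) (f : ℕ → ℝ) (n : ℕ) :
    green p q (fun k => c * f k) n = c * green p q f n :=
  (eq_green hp hq hpq (F := fun n => c * green p q f n) (by simp) (fun n hn => by
    rw [avg_const_mul, green_eq hp hq hpq f hn]; ring) n).symm

lemma green_nonneg {f : ℕ → ℝ} (h : ∀ n, 1 ≤ n → 0 ≤ f n) (n : ℕ) : 0 ≤ green p q f n :=
  le_green_of_sub hp hq hpq (F := fun _ => 0) le_rfl
    (fun n hn => by rw [avg_const hpq]; simpa using h n hn) n

lemma abs_green_le {f g : ℕ → ℝ} (h : ∀ n, 1 ≤ n → |f n| ≤ g n) (n : ℕ) :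
    |green p q f n| ≤ green p q g n := by
  rw [abs_le]
  constructor
  · have := green_mono hp hq hpq (f := fun k => (-1) * f k) (g := g)
      (fun n hn => by linarith [(abs_le.1 (h n hn)).1]) n
    rw [green_const_mul hp hq hpq] at this; linarith
  · exact green_mono hp hq hpq (fun n hn => (abs_le.1 (h n hn)).2) n

/-- The Cauchy-Schwarz inequality for the Green operator. -/
lemma sq_green_mul_le (f g : ℕ → ℝ) (n : ℕ) :
    green p q (fun k => f k * g k) n ^ 2
      ≤ green p q (fun k => f k ^ 2) n * green p q (fun k => g k ^ 2) n := by
  have h : ∀ t : ℝ, 0 ≤ green p q (fun k => g k ^ 2) n * (t * t)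
      + (2 * green p q (fun k => f k * g k) n) * t + green p q (fun k => f k ^ 2) n := by
    intro t
    have h1 := green_nonneg hp hq hpq (f := fun k => (f k + t * g k) ^ 2)
      (fun k _ => sq_nonneg _) n
    have h2 : green p q (fun k => (f k + t * g k) ^ 2) n
        = green p q (fun k => f k ^ 2 + ((2 * t) * (f k * g k) + t ^ 2 * g k ^ 2)) n :=
      green_congr hp hq hpq (fun k _ => by ring) n
    rw [h2, green_add hp hq hpq, green_add hp hq hpq, green_const_mul hp hq hpq,
      green_const_mul hp hq hpq] at h1
    linarith
  have := discrim_le_zero h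
  rw [discrim] at this
  nlinarith

omit hp hq hpq in
lemma thin_avg (x : ℝ) (f : ℕ → ℝ) (n : ℕ) : thin x (avg p q f) n = avg p q (thin x f) n := by
  have : thin x (avg p q f) n = thin x (fun k => p * thin p f k + q * thin q f k) n := rfl
  rw [this, thin_add, thin_const_mul, thin_const_mul, avg, thin_comm x p, thin_comm x q]

lemma green_thin (x : ℝ) {g : ℕ → ℝ} (hg : g 0 = 0) (n : ℕ) :
    green p q (thin x g) n = thin x (green p q g) n := by
  refine (eq_green hp hq hpq (by simp) (fun n hn => ?_) n).symm
  rw [← thin_avg, ← thin_add]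
  refine thin_congr fun k _ => ?_
  rcases Nat.eq_zero_or_pos k with rfl | hk
  · simp [hg, avg_zero hpq]
  · exact green_eq hp hq hpq g hk

lemma green_inv_succ_le (n : ℕ) :
    green p q (fun k => 1 / (k + 1 : ℝ)) n ≤ 1 / (2 * (p * q)) := by
  have hs : ∀ n : ℕ, 1 ≤ n → 1 / (n + 1 : ℝ) ≤ 1 / (2 * (p * q)) * (1 - 1 / (n + 1 : ℝ))
      - avg p q (fun n => 1 / (2 * (p * q)) * (1 - 1 / (n + 1 : ℝ))) n := by
    intro n hn
    rw [avg_const_mul, avg_sub, avg_const hpq]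
    have h1 := two_mul_le_one_sub_pow hp hq hpq hn
    have h2 : avg p q (fun n => 1 / (n + 1 : ℝ)) n
        = (2 - p ^ (n + 1) - q ^ (n + 1)) / (n + 1 : ℝ) := by
      rw [avg, thin_inv_succ, thin_inv_succ, show 1 - p = q by linarith, show 1 - q = p by linarith]
      ring
    rw [h2, ← mul_sub, one_div_mul_eq_div, le_div_iff₀ (by positivity)]
    have : 1 - 1 / (n + 1 : ℝ) - (1 - (2 - p ^ (n + 1) - q ^ (n + 1)) / (n + 1 : ℝ))
      = (1 - p ^ (n + 1) - q ^ (n + 1)) * (1 / (n + 1 : ℝ)) := by ring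
    rw [this, mul_comm]
    gcongr
  refine (green_le_of_super hp hq hpq (by simp) hs n).trans ?_
  have : 0 ≤ 1 / (n + 1 : ℝ) := by positivity
  have h3 : 0 ≤ 1 / (2 * (p * q)) := by positivity
  nlinarith

lemma abs_green_le_of_le_inv_succ {f : ℕ → ℝ} {C : ℝ} (hC : 0 ≤ C)
    (h : ∀ n, 1 ≤ n → |f n| ≤ C * (1 / (n + 1 : ℝ))) (n : ℕ) :
    |green p q f n| ≤ C * (1 / (2 * (p * q))) := by
  refine (abs_green_le hp hq hpq h n).trans ?_
  rw [green_const_mul hp hq hpq]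
  exact mul_le_mul_of_nonneg_left (green_inv_succ_le hp hq hpq n) hC

/-- The energy inequality. -/
lemma green_sq_disc_le {X e : ℕ → ℝ} {K : ℝ} (hX : ∀ n, |X n| ≤ K)
    (h : ∀ n, 1 ≤ n → X n = avg p q X n + e n) (n : ℕ) :
    p * q * green p q (fun k => disc p q X k ^ 2) n
      ≤ K ^ 2 + 2 * K * green p q (fun k => |e k|) n := by
  have hK : 0 ≤ K := (abs_nonneg _).trans (hX 0)
  rw [← green_const_mul hp hq hpq]
  have hsup : ∀ n, 1 ≤ n → p * q * disc p q X n ^ 2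
      ≤ ((K ^ 2 - X n ^ 2) + 2 * K * green p q (fun k => |e k|) n)
        - avg p q (fun n => (K ^ 2 - X n ^ 2) + 2 * K * green p q (fun k => |e k|) n) n := by
    intro n hn
    rw [avg_add, avg_sub, avg_const hpq, avg_const_mul]
    have h1 := green_eq hp hq hpq (fun k => |e k|) hn
    have h2 := sq_thin_le hp.le (by linarith : p ≤ 1) X n
    have h3 := sq_thin_le hq.le (by linarith : q ≤ 1) X n
    have h4 : p * q * disc p q X n ^ 2 ≤ avg p q (fun k => X k ^ 2) n - avg p q X n ^ 2 := by
      have e1 : p * thin p X n ^ 2 + q * thin q X n ^ 2 - (p * thin p X n + q * thin q X n) ^ 2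
          = p * q * (thin p X n - thin q X n) ^ 2 := by
        rw [show q = 1 - p by linarith]; ring
      unfold avg disc
      rw [← e1]
      gcongr
    have h5 : avg p q X n = X n - e n := by linarith [h n hn]
    rw [h5] at h4
    have h6 : X n * e n ≤ K * |e n| := by
      calc X n * e n ≤ |X n * e n| := le_abs_self _
        _ = |X n| * |e n| := abs_mul _ _
        _ ≤ _ := by gcongr; exact hX n
    nlinarith [sq_nonneg (e n)]
  refine (green_le_of_super hp hq hpq ?_ hsup n).trans ?_
  · have := sq_le_sq.2 ((hX 0).trans (le_abs_self K))
    simp only [green_zero, mul_zero, add_zero, sub_nonneg]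
    exact this
  · linarith [sq_nonneg (X n)]

end Green

/-! ### Harmonic numbers and regularity of solutions -/

/-- The harmonic numbers, as reals. -/
noncomputable def harm (n : ℕ) : ℝ := (harmonic n : ℝ)

@[simp] lemma harm_zero : harm 0 = 0 := by simp [harm]

lemma harm_succ (n : ℕ) : harm (n + 1) = harm n + 1 / (n + 1 : ℝ) := by
  simp [harm, harmonic_succ]

lemma fdiff_harm (n : ℕ) : fdiff harm n = 1 / (n + 1 : ℝ) := by
  rw [fdiff, harm_succ]; ring

lemma harm_sub_thin (z : ℝ) (n : ℕ) :
    harm n - thin z harm n = ∑ k ∈ Finset.range n, (1 - z) ^ (k + 1) / (k + 1 : ℝ) := by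
  induction n with
  | zero => simp
  | succ n ih =>
    have h := fdiff_thin z harm n
    have h2 : thin z (fdiff harm) n = thin z (fun k => 1 / (k + 1 : ℝ)) n :=
      thin_congr fun k _ => fdiff_harm k
    rw [h2, thin_inv_succ, fdiff] at h
    rw [Finset.sum_range_succ, ← ih, harm_succ, eq_add_of_sub_eq h]
    ring

lemma harm_sub_thin_le {z : ℝ} (h0 : 0 < z) (h1 : z ≤ 1) (n : ℕ) :
    harm n - thin z harm n ≤ -Real.log z := by
  rw [harm_sub_thin]
  have h := Real.hasSum_pow_div_log_of_abs_lt_one (x := 1 - z) (by rw [abs_lt]; constructor <;> linarith)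
  rw [sub_sub_cancel] at h
  refine sum_le_hasSum _ (fun k _ => ?_) h
  have : 0 ≤ 1 - z := by linarith
  positivity

lemma pow_succ_le_inv_succ {x : ℝ} (h0 : 0 ≤ x) (h1 : x < 1) (n : ℕ) :
    x ^ n ≤ 1 / (1 - x) * (1 / (n + 1 : ℝ)) := by
  have h2 : 0 < 1 - x := by linarith
  have h : (n + 1 : ℝ) * x ^ n ≤ ∑ k ∈ Finset.range (n + 1), x ^ k := by
    have : ∑ k ∈ Finset.range (n + 1), x ^ n ≤ ∑ k ∈ Finset.range (n + 1), x ^ k :=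
      Finset.sum_le_sum fun k hk =>
        pow_le_pow_of_le_one h0 h1.le (Nat.lt_succ_iff.1 (Finset.mem_range.1 hk))
    simpa using this
  have h3 : (∑ k ∈ Finset.range (n + 1), x ^ k) * (1 - x) = 1 - x ^ (n + 1) := by
    have := geom_sum_mul x (n + 1)
    linarith
  have h4 : 0 ≤ x ^ (n + 1) := by positivity
  have h5 : ∑ k ∈ Finset.range (n + 1), x ^ k ≤ 1 / (1 - x) := by
    rw [le_div_iff₀ h2]; linarith
  rw [mul_one_div, le_div_iff₀ (by positivity)]
  linarith

lemma neg_log_sub_le_harm {z : ℝ} (h0 : 0 < z) (h1 : z ≤ 1) (n : ℕ) :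
    -Real.log z - 1 / z ^ 2 * (1 / (n + 1 : ℝ)) ≤ harm n - thin z harm n := by
  rw [harm_sub_thin]
  have h := Real.abs_log_sub_add_sum_range_le (x := 1 - z)
    (by rw [abs_lt]; constructor <;> linarith) n
  rw [abs_of_nonneg (by linarith : 0 ≤ 1 - z), sub_sub_cancel] at h
  have h2 := pow_succ_le_inv_succ (x := 1 - z) (by linarith) (by linarith) n
  rw [sub_sub_cancel] at h2
  have h3 : (1 - z) ^ (n + 1) ≤ (1 - z) ^ n :=
    pow_le_pow_of_le_one (by linarith) (by linarith) (by omega)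
  have h4 : (1 - z) ^ (n + 1) / z ≤ 1 / z ^ 2 * (1 / (n + 1 : ℝ)) := by
    rw [div_le_iff₀ h0]
    calc _ ≤ 1 / z * (1 / (n + 1 : ℝ)) := h3.trans h2
      _ = _ := by field_simp
  have := (abs_le.1 h).1
  linarith

section Regularity

variable {p q : ℝ} (hp : 0 < p) (hq : 0 < q) (hpq : p + q = 1)

include hp hq hpq

lemma abs_fdiff_le {D e : ℕ → ℝ} (h : ∀ n, D n = avg p q D n + e n)
    (he : ∀ n, 2 ≤ n → e (n + 1) = e n) :
    ∃ C, 0 ≤ C ∧ ∀ n, |fdiff D n| ≤ C * (1 / (n + 1 : ℝ)) := by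
  set K := |fdiff e 0| + |fdiff e 1| with hK
  have hK0 : 0 ≤ K := by positivity
  have hE : ∀ n, fdiff D n = p ^ 2 * thin p (fdiff D) n + q ^ 2 * thin q (fdiff D) n
      + fdiff e n := by
    intro n
    have h1 := fdiff_thin p D n
    have h2 := fdiff_thin q D n
    have h3 : fdiff D n = p * fdiff (thin p D) n + q * fdiff (thin q D) n + fdiff e n := by
      simp only [fdiff]; rw [h (n + 1), h n]; simp only [avg]; ring
    rw [h3, h1, h2]; ring
  have main : ∀ F : ℕ → ℝ, (∀ n, p ^ 2 * thin p F n + q ^ 2 * thin q F n ≤ F n) → ∀ n, 0 ≤ F n := by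
    intro F hF n
    induction n using Nat.strong_induction_on with
    | _ n ih =>
      have h1 := hF n
      simp only [thin, Finset.sum_range_succ] at h1
      have s1 : 0 ≤ ∑ k ∈ Finset.range n, binWeight p n k * F k :=
        Finset.sum_nonneg fun k hk =>
          mul_nonneg (binWeight_nonneg hp.le (by linarith) n k) (ih k (Finset.mem_range.1 hk))
      have s2 : 0 ≤ ∑ k ∈ Finset.range n, binWeight q n k * F k :=
        Finset.sum_nonneg fun k hk =>
          mul_nonneg (binWeight_nonneg hq.le (by linarith) n k) (ih k (Finset.mem_range.1 hk))
      have e1 : ∀ x : ℝ, binWeight x n n = x ^ n := fun x => by simp [binWeight]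
      rw [e1, e1] at h1
      have h3 := one_sub_pow_pos hp hq hpq (n := n + 1) (by omega)
      have s1' := mul_nonneg (sq_nonneg p) s1
      have s2' := mul_nonneg (sq_nonneg q) s2
      by_contra! hneg
      have : 0 ≤ (1 - p ^ (n + 1 + 1) - q ^ (n + 1 + 1)) * F n := by
        rw [pow_succ p, pow_succ p, pow_succ q, pow_succ q]
        nlinarith
      nlinarith
  set C := K * (2 / (p * q)) with hC
  have hC0 : 0 ≤ C := by positivity
  have hsup : ∀ n, p ^ 2 * thin p (fun k => C * (1 / (k + 1 : ℝ))) n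
      + q ^ 2 * thin q (fun k => C * (1 / (k + 1 : ℝ))) n + |fdiff e n|
      ≤ C * (1 / (n + 1 : ℝ)) := by
    intro n
    rw [thin_const_mul, thin_const_mul]
    have h1 := thin_inv_succ p n
    have h2 := thin_inv_succ q n
    rw [show 1 - p = q by linarith] at h1
    rw [show 1 - q = p by linarith] at h2
    have h3 : p ^ 2 * (C * thin p (fun k => 1 / (k + 1 : ℝ)) n)
        + q ^ 2 * (C * thin q (fun k => 1 / (k + 1 : ℝ)) n)
        = C * (p * ((1 - q ^ (n + 1)) / (n + 1 : ℝ)) + q * ((1 - p ^ (n + 1)) / (n + 1 : ℝ))) := by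
      rw [← h1, ← h2]; ring
    have h4 : C * (p * ((1 - q ^ (n + 1)) / (n + 1 : ℝ)) + q * ((1 - p ^ (n + 1)) / (n + 1 : ℝ)))
        = C * (1 / (n + 1 : ℝ)) - C * ((p * q ^ (n + 1) + q * p ^ (n + 1)) / (n + 1 : ℝ)) := by
      rw [show C * (1 / (n + 1 : ℝ)) = C * ((p + q) / (n + 1 : ℝ)) by rw [hpq]]; ring
    rw [h3, h4]
    have h5 : |fdiff e n| ≤ C * ((p * q ^ (n + 1) + q * p ^ (n + 1)) / (n + 1 : ℝ)) := by
      match n with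
      | 0 =>
        have : C * ((p * q ^ (0 + 1) + q * p ^ (0 + 1)) / ((0 : ℕ) + 1 : ℝ)) = 4 * K := by
          rw [hC]; field_simp; push_cast; ring
        rw [this]
        linarith [abs_nonneg (fdiff e 0), abs_nonneg (fdiff e 1)]
      | 1 =>
        have : C * ((p * q ^ (1 + 1) + q * p ^ (1 + 1)) / ((1 : ℕ) + 1 : ℝ)) = K * (p + q) := by
          rw [hC]; field_simp; push_cast; ring
        rw [this, hpq]
        linarith [abs_nonneg (fdiff e 0), abs_nonneg (fdiff e 1)]
      | n + 2 =>
        rw [fdiff, he (n + 2) (by omega), sub_self, abs_zero]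
        positivity
    linarith
  refine ⟨C, hC0, fun n => abs_le.2 ⟨?_, ?_⟩⟩
  · have := main (fun n => C * (1 / (n + 1 : ℝ)) + fdiff D n) (fun n => by
      rw [thin_add, thin_add]
      linarith [hsup n, hE n, neg_abs_le (fdiff e n)]) n
    linarith
  · have := main (fun n => C * (1 / (n + 1 : ℝ)) - fdiff D n) (fun n => by
      rw [thin_sub, thin_sub]
      linarith [hsup n, hE n, le_abs_self (fdiff e n)]) n
    linarith

end Regularity

lemma abs_sub_le_harm {D : ℕ → ℝ} {C : ℝ} (hD : ∀ n, |fdiff D n| ≤ C * (1 / (n + 1 : ℝ)))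
    {k n : ℕ} (hk : k ≤ n) : |D k - D n| ≤ C * (harm n - harm k) := by
  induction n, hk using Nat.le_induction with
  | base => simp
  | succ n _ ih =>
    have h1 := hD n
    rw [fdiff] at h1
    rw [harm_succ]
    calc |D k - D (n + 1)| ≤ |D k - D n| + |D n - D (n + 1)| := abs_sub_le _ _ _
      _ ≤ C * (harm n - harm k) + C * (1 / (n + 1 : ℝ)) := by rw [abs_sub_comm (D n)]; gcongr
      _ = _ := by ring

lemma abs_thin_sub_le {D : ℕ → ℝ} {C : ℝ} (hC : 0 ≤ C)
    (hD : ∀ n, |fdiff D n| ≤ C * (1 / (n + 1 : ℝ)))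
    {z : ℝ} (h0 : 0 < z) (h1 : z ≤ 1) (n : ℕ) : |thin z D n - D n| ≤ C * (-Real.log z) := by
  have h := abs_thin_le h0.le h1 (f := fun k => D k - D n) (g := fun k => C * (harm n - harm k))
    (n := n) (fun k hk => abs_sub_le_harm hD hk)
  rw [thin_sub, thin_const, thin_const_mul, thin_sub, thin_const] at h
  exact h.trans (mul_le_mul_of_nonneg_left (harm_sub_thin_le h0 h1 n) hC)

lemma binVar_le_of_fdiff {D : ℕ → ℝ} {C : ℝ}
    (hD : ∀ n, |fdiff D n| ≤ C * (1 / (n + 1 : ℝ)))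
    {x : ℝ} (h0 : 0 < x) (h1 : x ≤ 1) (n : ℕ) :
    binVar x D n ≤ 2 * C ^ 2 / x * (1 / (n + 1 : ℝ)) := by
  rcases n with _ | n
  · simp only [binVar, thin_zero, sub_self]; positivity
  have h := binVar_succ_le h0.le h1 D n
  have h2 : thin x (fun k => fdiff D k ^ 2) n
      ≤ 2 * C ^ 2 * (1 / x ^ 2 * (1 / ((n + 1 : ℝ) * (n + 2)))) := by
    refine (thin_mono h0.le h1 (g := fun k => 2 * C ^ 2 * (1 / ((k + 1 : ℝ) * (k + 2))))
      fun k _ => ?_).trans ?_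
    · have := sq_le_sq' (by linarith [neg_abs_le (fdiff D k), hD k])
        ((le_abs_self _).trans (hD k))
      refine this.trans ?_
      rw [mul_pow, div_pow, one_pow, mul_comm (2 : ℝ), mul_assoc]
      refine mul_le_mul_of_nonneg_left ?_ (sq_nonneg C)
      rw [mul_one_div, div_le_div_iff₀ (by positivity) (by positivity)]
      have : (0 : ℝ) ≤ k := by positivity
      nlinarith
    · rw [thin_const_mul]
      exact mul_le_mul_of_nonneg_left (thin_inv_succ_mul_le h0 h1 n) (by positivity)
  have hx : 0 ≤ x * (1 - x) := mul_nonneg h0.le (by linarith)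
  calc binVar x D (n + 1)
      ≤ (n + 1) * (x * (1 - x)) * (2 * C ^ 2 * (1 / x ^ 2 * (1 / ((n + 1 : ℝ) * (n + 2))))) :=
        h.trans (by gcongr)
    _ = (1 - x) * (2 * C ^ 2 / x * (1 / ((n + 1 : ℕ) + 1 : ℝ))) := by
        push_cast; field_simp; ring
    _ ≤ 1 * (2 * C ^ 2 / x * (1 / ((n + 1 : ℕ) + 1 : ℝ))) := by gcongr; linarith
    _ = _ := one_mul _

section Entropy

variable {p q : ℝ} (hp : 0 < p) (hq : 0 < q) (hpq : p + q = 1)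

include hp hq hpq

lemma harm_sub_avg_bounds :
    ∃ C, 0 ≤ C ∧ ∀ n, |(harm n - avg p q harm n) - (-(p * Real.log p) - q * Real.log q)|
      ≤ C * (1 / (n + 1 : ℝ)) := by
  refine ⟨p * (1 / p ^ 2) + q * (1 / q ^ 2), by positivity, fun n => ?_⟩
  have a1 := harm_sub_thin_le hp (by linarith) n
  have a2 := harm_sub_thin_le hq (by linarith) n
  have a3 := neg_log_sub_le_harm hp (by linarith) n
  have a4 := neg_log_sub_le_harm hq (by linarith) n
  have e : harm n - avg p q harm n = p * (harm n - thin p harm n) + q * (harm n - thin q harm n) := by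
    unfold avg; linear_combination (-harm n) * hpq
  have b1 := mul_le_mul_of_nonneg_left a1 hp.le
  have b2 := mul_le_mul_of_nonneg_left a2 hq.le
  have b3 := mul_le_mul_of_nonneg_left a3 hp.le
  have b4 := mul_le_mul_of_nonneg_left a4 hq.le
  have pos : 0 ≤ (p * (1 / p ^ 2) + q * (1 / q ^ 2)) * (1 / (n + 1 : ℝ)) := by positivity
  rw [e, abs_le]
  constructor <;> linarith

lemma disc_harm_bounds :
    ∃ C, 0 ≤ C ∧ ∀ n, |disc p q harm n - Real.log (p / q)| ≤ C * (1 / (n + 1 : ℝ)) := by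
  refine ⟨1 / p ^ 2 + 1 / q ^ 2, by positivity, fun n => ?_⟩
  have a1 := harm_sub_thin_le hp (by linarith) n
  have a2 := harm_sub_thin_le hq (by linarith) n
  have a3 := neg_log_sub_le_harm hp (by linarith) n
  have a4 := neg_log_sub_le_harm hq (by linarith) n
  have p1 : 0 ≤ 1 / p ^ 2 * (1 / (n + 1 : ℝ)) := by positivity
  have p2 : 0 ≤ 1 / q ^ 2 * (1 / (n + 1 : ℝ)) := by positivity
  rw [Real.log_div hp.ne' hq.ne', disc, abs_le]
  constructor <;> linarith

lemma entropy_pos : 0 < -(p * Real.log p) - q * Real.log q := by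
  have h1 := Real.log_neg hp (by linarith)
  have h2 := Real.log_neg hq (by linarith)
  nlinarith

/-- The potential of the constant `1` is `harm / h` up to a bounded error. -/
lemma green_one_bounds :
    ∃ C, 0 ≤ C ∧ ∀ n, |green p q (fun _ => 1) n
      - harm n / (-(p * Real.log p) - q * Real.log q)| ≤ C := by
  set h := -(p * Real.log p) - q * Real.log q with hh
  have hpos : 0 < h := entropy_pos hp hq hpq
  obtain ⟨C, hC, hb⟩ := harm_sub_avg_bounds hp hq hpq
  refine ⟨1 / h * C * (1 / (2 * (p * q))), by positivity, fun n => ?_⟩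
  have e : ∀ n, green p q (fun _ => 1) n - harm n / h
      = green p q (fun n => (-1 / h) * ((harm n - avg p q harm n) - h)) n := by
    refine eq_green hp hq hpq (by simp) fun n hn => ?_
    rw [avg_sub]
    simp only [div_eq_inv_mul]
    rw [avg_const_mul, green_eq hp hq hpq _ hn]
    field_simp
    ring
  rw [e]
  refine abs_green_le_of_le_inv_succ hp hq hpq (by positivity) (fun n _ => ?_) n
  rw [abs_mul, mul_assoc, abs_div, abs_neg, abs_one, abs_of_pos hpos]
  gcongr
  exact hb n

end Entropy

/-- The indicator of `{1}`. -/
def indOne (n : ℕ) : ℝ := if n = 1 then 1 else 0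

lemma indOne_nonneg (n : ℕ) : 0 ≤ indOne n := by unfold indOne; split_ifs <;> norm_num

lemma abs_indOne_le (n : ℕ) : |indOne n| ≤ 2 * (1 / (n + 1 : ℝ)) := by
  unfold indOne
  split_ifs with h
  · subst h; norm_num
  · rw [abs_zero]; positivity

lemma tendsto_indOne : Tendsto indOne atTop (𝓝 0) :=
  tendsto_const_nhds.congr' (by
    filter_upwards [eventually_gt_atTop 1] with n hn
    rw [indOne, if_neg (by omega)])

/-- The probability-like profile solving `D = avg D + indOne`; it is the increment of the mean trie
size. -/
noncomputable def profile (p q : ℝ) : ℕ → ℝ := green p q indOne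

section Profile

variable {p q : ℝ} (hp : 0 < p) (hq : 0 < q) (hpq : p + q = 1)

lemma disc_add (f g : ℕ → ℝ) (n : ℕ) :
    disc p q (fun k => f k + g k) n = disc p q f n + disc p q g n := by
  simp only [disc, thin_add]; ring

lemma disc_sub (f g : ℕ → ℝ) (n : ℕ) :
    disc p q (fun k => f k - g k) n = disc p q f n - disc p q g n := by
  simp only [disc, thin_sub]; ring

lemma disc_const_mul (c : ℝ) (f : ℕ → ℝ) (n : ℕ) :
    disc p q (fun k => c * f k) n = c * disc p q f n := by
  simp only [disc, thin_const_mul]; ring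

lemma disc_zero (f : ℕ → ℝ) : disc p q f 0 = 0 := by simp [disc]

lemma avg_disc (f : ℕ → ℝ) (n : ℕ) : avg p q (disc p q f) n = disc p q (avg p q f) n := by
  have h1 : ∀ x, thin x (disc p q f) n = thin x (thin p f) n - thin x (thin q f) n :=
    fun x => thin_sub x _ _ n
  rw [disc, thin_avg, thin_avg, avg, h1, h1, avg, avg, thin_comm q p]
  rw [thin_comm p q]; ring

include hp hq hpq

lemma sq_avg_le (f : ℕ → ℝ) (n : ℕ) : avg p q f n ^ 2 ≤ avg p q (fun k => f k ^ 2) n := by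
  have h1 := sq_thin_le hp.le (by linarith) f n
  have h2 := sq_thin_le hq.le (by linarith) f n
  have : avg p q f n ^ 2 = p * thin p f n ^ 2 + q * thin q f n ^ 2
      - p * q * (thin p f n - thin q f n) ^ 2 := by
    unfold avg; rw [show q = 1 - p by linarith]; ring
  rw [this]; unfold avg
  have h3 : 0 ≤ p * q * (thin p f n - thin q f n) ^ 2 := by positivity
  have h4 := mul_le_mul_of_nonneg_left h1 hp.le
  have h5 := mul_le_mul_of_nonneg_left h2 hq.le
  linarith

lemma tendsto_avg_zero {f : ℕ → ℝ} (hf : Tendsto f atTop (𝓝 0)) :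
    Tendsto (avg p q f) atTop (𝓝 0) := by
  have h := ((tendsto_thin_zero hp (by linarith) hf).const_mul p).add
    ((tendsto_thin_zero hq (by linarith) hf).const_mul q)
  rw [mul_zero, mul_zero, add_zero] at h
  exact h

lemma tendsto_disc_zero {f : ℕ → ℝ} (hf : Tendsto f atTop (𝓝 0)) :
    Tendsto (disc p q f) atTop (𝓝 0) := by
  have h := (tendsto_thin_zero hp (by linarith) hf).sub (tendsto_thin_zero hq (by linarith) hf)
  rw [sub_zero] at h
  exact h

lemma abs_profile_le (n : ℕ) : |profile p q n| ≤ 1 / (p * q) := by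
  refine (abs_green_le_of_le_inv_succ hp hq hpq zero_le_two (fun n _ => abs_indOne_le n) n).trans
    (le_of_eq ?_)
  field_simp

lemma profile_eq (n : ℕ) : profile p q n = avg p q (profile p q) n + indOne n := by
  rcases Nat.eq_zero_or_pos n with rfl | hn
  · simp [avg_zero hpq, profile, indOne]
  · exact green_eq hp hq hpq _ hn

omit hp hq hpq in
lemma profile_zero : profile p q 0 = 0 := green_zero _

lemma abs_fdiff_profile_le : ∃ C, 0 ≤ C ∧ ∀ n, |fdiff (profile p q) n| ≤ C * (1 / (n + 1 : ℝ)) :=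
  abs_fdiff_le hp hq hpq (profile_eq hp hq hpq) fun n hn => by
    rw [indOne, indOne, if_neg (by omega), if_neg (by omega)]

lemma green_abs_indOne_le (n : ℕ) : green p q (fun k => |indOne k|) n ≤ 1 / (p * q) := by
  have h := abs_profile_le hp hq hpq n
  have : (fun k => |indOne k|) = indOne := funext fun k => abs_of_nonneg (indOne_nonneg k)
  rw [this]
  exact (le_abs_self _).trans h

lemma green_sq_disc_profile_le :
    ∃ C, ∀ n, green p q (fun k => disc p q (profile p q) k ^ 2) n ≤ C := by
  refine ⟨((1 / (p * q)) ^ 2 + 2 * (1 / (p * q)) * (1 / (p * q))) / (p * q), fun n => ?_⟩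
  have h := green_sq_disc_le hp hq hpq (abs_profile_le hp hq hpq)
    (fun n _ => profile_eq hp hq hpq n) n
  have h2 := green_abs_indOne_le hp hq hpq n
  rw [le_div_iff₀ (by positivity)]
  have h3 : 2 * (1 / (p * q)) * green p q (fun k => |indOne k|) n
      ≤ 2 * (1 / (p * q)) * (1 / (p * q)) := by gcongr
  linarith

lemma tendsto_disc_profile : Tendsto (disc p q (profile p q)) atTop (𝓝 0) := by
  obtain ⟨C, hC⟩ := green_sq_disc_profile_le hp hq hpq
  set δ := disc p q (profile p q) with hδ
  set V := green p q (fun k => δ k ^ 2) with hV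
  have hK : ∀ n, |δ n| ≤ 2 * (1 / (p * q)) := by
    intro n
    have h0 : ∀ x, 0 < x → x ≤ 1 → |thin x (profile p q) n| ≤ 1 / (p * q) := by
      intro x hx hx1
      have := abs_thin_le hx.le hx1 (n := n) (fun k _ => abs_profile_le hp hq hpq k)
      simpa [thin_const] using this
    have h1 := h0 p hp (by linarith)
    have h2 := h0 q hq (by linarith)
    have := abs_sub (thin p (profile p q) n) (thin q (profile p q) n)
    simp only [hδ, disc]
    linarith
  have havg : ∀ n, avg p q δ n = δ n - disc p q indOne n := by
    intro n
    rw [hδ, avg_disc]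
    have : profile p q = fun n => avg p q (profile p q) n + indOne n :=
      funext (profile_eq hp hq hpq)
    conv_rhs => rw [this]
    rw [disc_add]; simp only [disc]; ring
  have hdiff : Tendsto (fun n => δ n ^ 2 - avg p q δ n ^ 2) atTop (𝓝 0) := by
    have h1 := tendsto_disc_zero hp hq hpq tendsto_indOne
    have h2 : Tendsto (fun n => (4 * (1 / (p * q)) + |disc p q indOne n|) * |disc p q indOne n|)
        atTop (𝓝 0) := by
      have := (h1.abs.const_add (4 * (1 / (p * q)))).mul h1.abs
      simpa using this
    refine squeeze_zero_norm (fun n => ?_) h2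
    rw [Real.norm_eq_abs, havg, show δ n ^ 2 - (δ n - disc p q indOne n) ^ 2
      = (2 * δ n - disc p q indOne n) * disc p q indOne n by ring, abs_mul]
    gcongr
    have := abs_sub (2 * δ n) (disc p q indOne n)
    rw [abs_mul, abs_two] at this
    linarith [hK n]
  have key : ∀ k : ℕ, ∃ η : ℕ → ℝ, Tendsto η atTop (𝓝 0) ∧ ∀ n, k * δ n ^ 2 ≤ V n + η n := by
    intro k
    induction k with
    | zero =>
      refine ⟨fun _ => 0, tendsto_const_nhds, fun n => ?_⟩
      have := green_nonneg hp hq hpq (f := fun k => δ k ^ 2) (fun n _ => sq_nonneg _) n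
      simpa using this
    | succ k ih =>
      obtain ⟨η, hη, h⟩ := ih
      refine ⟨fun n => avg p q η n + k * (δ n ^ 2 - avg p q δ n ^ 2), ?_, fun n => ?_⟩
      · simpa using (tendsto_avg_zero hp hq hpq hη).add (hdiff.const_mul (k : ℝ))
      · have h1 := avg_mono hp hq hpq (n := n) (fun j _ => h j)
        rw [avg_const_mul, avg_add] at h1
        have h2 := sq_avg_le hp hq hpq δ n
        have h3 := mul_le_mul_of_nonneg_left h2 (Nat.cast_nonneg (α := ℝ) k)
        have h4 : avg p q V n + δ n ^ 2 = V n := by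
          rcases Nat.eq_zero_or_pos n with rfl | hn
          · simp [avg_zero hpq, hδ, disc_zero, hV]
          · exact (green_eq hp hq hpq _ hn).symm
        push_cast
        have h5 : avg p q (green p q fun k => δ k ^ 2) n = avg p q V n := rfl
        linarith
  have hC0 : 0 ≤ C := by
    have := hC 0
    rwa [hV, green_zero] at this
  rw [Metric.tendsto_atTop]
  intro ε hε
  obtain ⟨k, hk⟩ := exists_nat_gt ((C + 1) / ε ^ 2)
  rw [div_lt_iff₀ (by positivity)] at hk
  obtain ⟨η, hη, h⟩ := key k
  obtain ⟨N, hN⟩ := eventually_atTop.1 (hη.eventually_lt_const one_pos)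
  refine ⟨N, fun n hn => ?_⟩
  rw [Real.dist_eq, sub_zero]
  by_contra! hcon
  have h1 : ε ^ 2 ≤ δ n ^ 2 := by rw [← sq_abs (δ n)]; gcongr
  have h2 := mul_le_mul_of_nonneg_left h1 (Nat.cast_nonneg (α := ℝ) k)
  linarith [h n, hN n hn, hC n]

lemma tendsto_thin_profile_sub :
    Tendsto (fun n => thin p (profile p q) n - profile p q n) atTop (𝓝 0) ∧
    Tendsto (fun n => thin q (profile p q) n - profile p q n) atTop (𝓝 0) := by
  have h1 := tendsto_disc_profile hp hq hpq
  have h2 : ∀ n, avg p q (profile p q) n = profile p q n - indOne n := fun n => by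
    linarith [profile_eq hp hq hpq n]
  constructor
  · have := (h1.const_mul q).sub tendsto_indOne
    simp only [mul_zero, sub_zero] at this
    refine this.congr fun n => ?_
    have := h2 n
    unfold avg at this; unfold disc
    linear_combination (-1 : ℝ) * this + thin p (profile p q) n * hpq
  · have := (h1.const_mul (-p)).sub tendsto_indOne
    simp only [mul_zero, sub_zero] at this
    refine this.congr fun n => ?_
    have := h2 n
    unfold avg at this; unfold disc
    linear_combination (-1 : ℝ) * this + thin q (profile p q) n * hpq

end Profile

/-- The weighted partial sums `∑ D k / k`. -/
noncomputable def logSum (D : ℕ → ℝ) (n : ℕ) : ℝ :=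
  ∑ k ∈ Finset.range n, D (k + 1) / (k + 1 : ℝ)

lemma logSum_succ (D : ℕ → ℝ) (n : ℕ) : logSum D (n + 1) = logSum D n + D (n + 1) / (n + 1 : ℝ) :=
  Finset.sum_range_succ _ _

section SlowVariation

variable {D : ℕ → ℝ} {C : ℝ} (hC : 0 ≤ C) (hD : ∀ n, |fdiff D n| ≤ C * (1 / (n + 1 : ℝ)))

include hC hD

lemma abs_logSum_sub_le {k n : ℕ} (hk : k ≤ n) :
    |logSum D n - logSum D k - D n * (harm n - harm k)| ≤ C * (harm n - harm k) ^ 2 := by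
  induction n, hk using Nat.le_induction with
  | base => simp
  | succ n hn ih =>
    have hmono : 0 ≤ harm n - harm k := by
      have : Monotone harm := monotone_nat_of_le_succ fun m => by
        rw [harm_succ]
        have : (0 : ℝ) ≤ 1 / (m + 1 : ℝ) := by positivity
        linarith
      exact sub_nonneg.2 (this hn)
    have h1 : logSum D (n + 1) - logSum D k - D (n + 1) * (harm (n + 1) - harm k)
        = (logSum D n - logSum D k - D n * (harm n - harm k)) - fdiff D n * (harm n - harm k) := by
      rw [logSum_succ, harm_succ, fdiff]; ring
    rw [h1]
    refine (abs_sub _ _).trans ?_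
    rw [abs_mul, abs_of_nonneg hmono, harm_succ]
    have h2 := mul_le_mul_of_nonneg_right (hD n) hmono
    have h3 : (0 : ℝ) ≤ 1 / (n + 1 : ℝ) := by positivity
    nlinarith [mul_nonneg hC (mul_nonneg h3 hmono), mul_nonneg hC (sq_nonneg (1 / (n + 1 : ℝ)))]

lemma logSum_sub_thin_bound {z : ℝ} (h0 : 0 < z) (h1 : z ≤ 1) {K : ℝ} (hK : ∀ n, |D n| ≤ K) :
    ∃ η : ℕ → ℝ, Tendsto η atTop (𝓝 0) ∧ ∀ n,
      |logSum D n - thin z (logSum D) n + Real.log z * D n| ≤ C * Real.log z ^ 2 + η n := by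
  have hK0 : 0 ≤ K := (abs_nonneg _).trans (hK 0)
  refine ⟨fun n => (C * (2 * 1 ^ 2 / z) + K * (1 / z ^ 2)) * (1 / (n + 1 : ℝ)), ?_, fun n => ?_⟩
  · have := (tendsto_one_div_add_atTop_nhds_zero_nat (𝕜 := ℝ)).const_mul
      (C * (2 * 1 ^ 2 / z) + K * (1 / z ^ 2))
    rwa [mul_zero] at this
  · have ha := abs_thin_le h0.le h1 (n := n) (fun k hk => abs_logSum_sub_le hC hD hk)
    have e1 : thin z (fun k => logSum D n - logSum D k - D n * (harm n - harm k)) n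
        = logSum D n - thin z (logSum D) n - D n * (harm n - thin z harm n) := by
      rw [thin_sub, thin_sub, thin_const, thin_const_mul, thin_sub, thin_const]
    have e2 : thin z (fun k => C * (harm n - harm k) ^ 2) n
        = C * (binVar z harm n + (harm n - thin z harm n) ^ 2) := by
      rw [thin_const_mul]
      congr 1
      have : (fun k => (harm n - harm k) ^ 2)
          = fun k => (harm n ^ 2 - (2 * harm n) * harm k) + harm k ^ 2 := by
        funext k; ring
      rw [this, thin_add, thin_sub, thin_const, thin_const_mul, binVar]
      ring
    rw [e1, e2] at ha
    have hv := binVar_le_of_fdiff (D := harm) (C := 1)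
      (fun n => by rw [fdiff_harm, abs_of_nonneg (by positivity), one_mul]) h0 h1 n
    have b1 := harm_sub_thin_le h0 h1 n
    have b2 := neg_log_sub_le_harm h0 h1 n
    have b0 : 0 ≤ harm n - thin z harm n := by
      rw [harm_sub_thin]
      exact Finset.sum_nonneg fun k _ => div_nonneg (pow_nonneg (by linarith) _) (by positivity)
    have b3 : (harm n - thin z harm n) ^ 2 ≤ Real.log z ^ 2 := by
      rw [← neg_sq (Real.log z)]; gcongr
    have b4 : |D n * (harm n - thin z harm n + Real.log z)| ≤ K * (1 / z ^ 2 * (1 / (n + 1 : ℝ))) := by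
      rw [abs_mul]
      have : |harm n - thin z harm n + Real.log z| ≤ 1 / z ^ 2 * (1 / (n + 1 : ℝ)) := by
        have : 0 ≤ 1 / z ^ 2 * (1 / (n + 1 : ℝ)) := by positivity
        rw [abs_le]; constructor <;> linarith
      have h3 := hK n
      gcongr
    have e3 : logSum D n - thin z (logSum D) n + Real.log z * D n
        = (logSum D n - thin z (logSum D) n - D n * (harm n - thin z harm n))
          + D n * (harm n - thin z harm n + Real.log z) := by ring
    rw [e3]
    refine (abs_add_le _ _).trans ?_
    have h5 : C * (binVar z harm n + (harm n - thin z harm n) ^ 2)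
        ≤ C * (2 * 1 ^ 2 / z * (1 / (n + 1 : ℝ)) + Real.log z ^ 2) := by gcongr
    linarith

lemma logSum_sub_thin_pow_bound {z : ℝ} (h0 : 0 < z) (h1 : z ≤ 1) {K : ℝ} (hK : ∀ n, |D n| ≤ K)
    (hz : Tendsto (fun n => thin z D n - D n) atTop (𝓝 0)) (N : ℕ) :
    ∃ η : ℕ → ℝ, Tendsto η atTop (𝓝 0) ∧ ∀ n,
      |logSum D n - thin (z ^ N) (logSum D) n + Real.log (z ^ N) * D n|
        ≤ N * (C * Real.log z ^ 2) + η n := by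
  obtain ⟨η₀, hη₀, hb₀⟩ := logSum_sub_thin_bound hC hD h0 h1 hK
  induction N with
  | zero => exact ⟨fun _ => 0, tendsto_const_nhds, fun n => by simp [thin_one]⟩
  | succ N ih =>
    obtain ⟨η, hη, hb⟩ := ih
    refine ⟨fun n => η₀ n + thin z η n + |Real.log (z ^ N)| * |thin z D n - D n|, ?_, fun n => ?_⟩
    · have := (hη₀.add (tendsto_thin_zero h0 h1 hη)).add (hz.abs.const_mul |Real.log (z ^ N)|)
      simpa using this
    · have ha := abs_thin_le h0.le h1 (n := n) (fun k _ => hb k)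
      rw [thin_add (f := fun k => logSum D k - thin (z ^ N) (logSum D) k), thin_add, thin_sub,
        thin_const_mul, thin_const] at ha
      have e : logSum D n - thin (z ^ (N + 1)) (logSum D) n + Real.log (z ^ (N + 1)) * D n
          = (logSum D n - thin z (logSum D) n + Real.log z * D n)
            + (thin z (logSum D) n - thin z (thin (z ^ N) (logSum D)) n
              + Real.log (z ^ N) * thin z D n) - Real.log (z ^ N) * (thin z D n - D n) := by
        rw [thin_thin, ← pow_succ', Real.log_pow, Real.log_pow]; push_cast; ring
      rw [e]
      refine (abs_sub _ _).trans ?_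
      rw [abs_mul]
      have := abs_add_le (logSum D n - thin z (logSum D) n + Real.log z * D n)
        (thin z (logSum D) n - thin z (thin (z ^ N) (logSum D)) n
              + Real.log (z ^ N) * thin z D n)
      push_cast
      linarith [hb₀ n]

lemma tendsto_logSum_sub_thin {K : ℝ} (hK : ∀ n, |D n| ≤ K)
    (hz : ∀ z, 0 < z → z ≤ 1 → Tendsto (fun n => thin z D n - D n) atTop (𝓝 0))
    {x : ℝ} (h0 : 0 < x) (h1 : x ≤ 1) :
    Tendsto (fun n => logSum D n - thin x (logSum D) n + Real.log x * D n) atTop (𝓝 0) := by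
  rw [Metric.tendsto_atTop]
  intro ε hε
  obtain ⟨N, hN⟩ := exists_nat_gt (2 * (C * Real.log x ^ 2) / ε)
  have hN0 : (0 : ℝ) < N := lt_of_le_of_lt (by positivity) hN
  rw [div_lt_iff₀ hε] at hN
  have hNne : N ≠ 0 := by rintro rfl; simp at hN0
  have hz0 : 0 < x ^ (1 / (N : ℝ)) := Real.rpow_pos_of_pos h0 _
  have hz1 : x ^ (1 / (N : ℝ)) ≤ 1 := Real.rpow_le_one h0.le h1 (by positivity)
  have hpow : (x ^ (1 / (N : ℝ))) ^ N = x := by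
    rw [one_div]; exact Real.rpow_inv_natCast_pow h0.le hNne
  obtain ⟨η, hη, hb⟩ := logSum_sub_thin_pow_bound hC hD hz0 hz1 hK (hz _ hz0 hz1) N
  rw [hpow, Real.log_rpow h0] at hb
  obtain ⟨n₀, hn₀⟩ := eventually_atTop.1 (hη.eventually_lt_const (half_pos hε))
  refine ⟨n₀, fun n hn => ?_⟩
  rw [Real.dist_eq, sub_zero]
  refine (hb n).trans_lt ?_
  have h2 := hn₀ n hn
  have h3 : (N : ℝ) * (C * (1 / (N : ℝ) * Real.log x) ^ 2) = C * Real.log x ^ 2 / N := by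
    field_simp
  have h4 : C * Real.log x ^ 2 / N < ε / 2 := by
    rw [div_lt_iff₀ hN0]; linarith
  rw [h3]; linarith

lemma abs_thin_exp_sub_le {a b : ℝ} (ha : 0 ≤ a) (hb : 0 ≤ b) (n : ℕ) :
    |thin (Real.exp (-a)) D n - thin (Real.exp (-b)) D n| ≤ C * |a - b| := by
  wlog hab : a ≤ b generalizing a b
  · rw [abs_sub_comm, abs_sub_comm a]
    exact this hb ha (le_of_not_ge hab)
  have e : Real.exp (-b) = Real.exp (-a) * Real.exp (-(b - a)) := by
    rw [← Real.exp_add]; ring_nf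
  rw [e, ← thin_thin, ← thin_sub]
  have h1 : ∀ t, 0 ≤ t → Real.exp (-t) ≤ 1 := fun t ht => Real.exp_le_one_iff.2 (by linarith)
  have := abs_thin_le (Real.exp_pos (-a)).le (h1 a ha) (n := n)
    (f := fun k => D k - thin (Real.exp (-(b - a))) D k) (g := fun _ => C * (b - a)) (fun k _ => by
      have := abs_thin_sub_le hC hD (Real.exp_pos (-(b - a))) (h1 _ (by linarith)) k
      rwa [abs_sub_comm, Real.log_exp, neg_neg] at this)
  rw [thin_const] at this
  rwa [abs_sub_comm a, abs_of_nonneg (by linarith : 0 ≤ b - a)]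

end SlowVariation

section Periods

variable {D : ℕ → ℝ}

lemma tendsto_thin_mul_sub {z w : ℝ} (hz0 : 0 < z) (hz1 : z ≤ 1)
    (hz : Tendsto (fun n => thin z D n - D n) atTop (𝓝 0))
    (hw : Tendsto (fun n => thin w D n - D n) atTop (𝓝 0)) :
    Tendsto (fun n => thin (z * w) D n - D n) atTop (𝓝 0) := by
  have := (tendsto_thin_zero hz0 hz1 hw).add hz
  rw [add_zero] at this
  refine this.congr fun n => ?_
  rw [thin_sub, ← thin_thin]; ring

lemma tendsto_thin_of_mul {z w : ℝ} (hw0 : 0 < w) (hw1 : w ≤ 1)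
    (hz : Tendsto (fun n => thin z D n - D n) atTop (𝓝 0))
    (hzw : Tendsto (fun n => thin (z * w) D n - D n) atTop (𝓝 0)) :
    Tendsto (fun n => thin w D n - D n) atTop (𝓝 0) := by
  have := hzw.sub (tendsto_thin_zero hw0 hw1 hz)
  rw [sub_zero] at this
  refine this.congr fun n => ?_
  rw [thin_sub, thin_thin, mul_comm w z]; ring

/-- The logarithmic periods of a sequence under binomial thinning. -/
noncomputable def periods (D : ℕ → ℝ) : AddSubgroup ℝ where
  carrier := {t | Tendsto (fun n => thin (Real.exp (-|t|)) D n - D n) atTop (𝓝 0)}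
  zero_mem' := by simp [thin_one]
  neg_mem' := by simp
  add_mem' := by
    intro s t hs ht
    have h1 : ∀ t : ℝ, Real.exp (-|t|) ≤ 1 := fun t => Real.exp_le_one_iff.2 (by simp)
    have h2 : ∀ {a b c : ℝ}, c = a + b → Real.exp (-c) = Real.exp (-a) * Real.exp (-b) := by
      rintro a b _ rfl
      rw [← Real.exp_add]; ring_nf
    simp only [Set.mem_ofPred_eq] at hs ht ⊢
    have hcases : |s + t| = |s| + |t| ∨ |s| = |t| + |s + t| ∨ |t| = |s| + |s + t| := by
      rcases abs_cases s with h | h <;> rcases abs_cases t with h' | h' <;>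
        rcases abs_cases (s + t) with h'' | h''
      all_goals first
        | (left; linarith)
        | (right; left; linarith)
        | (right; right; linarith)
    rcases hcases with h | h | h
    · rw [h2 h]
      exact tendsto_thin_mul_sub (Real.exp_pos _) (h1 _) hs ht
    · rw [h2 h] at hs
      exact tendsto_thin_of_mul (Real.exp_pos _) (h1 _) ht hs
    · rw [h2 h] at ht
      exact tendsto_thin_of_mul (Real.exp_pos _) (h1 _) hs ht

lemma neg_log_mem_periods {z : ℝ} (h0 : 0 < z) (h1 : z ≤ 1) :
    -Real.log z ∈ periods D ↔ Tendsto (fun n => thin z D n - D n) atTop (𝓝 0) := by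
  have h2 : |Real.log z| = -Real.log z := abs_of_nonpos (Real.log_nonpos h0.le h1)
  change Tendsto (fun n => thin (Real.exp (-|(-Real.log z)|)) D n - D n) atTop (𝓝 0) ↔ _
  rw [abs_neg, h2, neg_neg, Real.exp_log h0]

lemma mem_periods_of_dense {C : ℝ} (hC : 0 ≤ C) (hD : ∀ n, |fdiff D n| ≤ C * (1 / (n + 1 : ℝ)))
    (hd : Dense (periods D : Set ℝ)) (t : ℝ) : t ∈ periods D := by
  change Tendsto (fun n => thin (Real.exp (-|t|)) D n - D n) atTop (𝓝 0)
  rw [Metric.tendsto_atTop]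
  intro ε hε
  obtain ⟨s, hs, hst⟩ := Metric.mem_closure_iff.1 (hd t) (ε / (2 * (C + 1))) (by positivity)
  rw [Real.dist_eq, lt_div_iff₀ (by positivity)] at hst
  have hs' : Tendsto (fun n => thin (Real.exp (-|s|)) D n - D n) atTop (𝓝 0) := hs
  obtain ⟨n₀, hn₀⟩ := Metric.tendsto_atTop.1 hs' (ε / 2) (half_pos hε)
  refine ⟨n₀, fun n hn => ?_⟩
  have h1 := hn₀ n hn
  rw [Real.dist_eq, sub_zero] at h1 ⊢
  have h2 := abs_thin_exp_sub_le hC hD (abs_nonneg t) (abs_nonneg s) n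
  have h3 : C * |(|t| - |s|)| ≤ ε / 2 := by
    have h4 := abs_abs_sub_abs_le t s
    have h5 := mul_le_mul_of_nonneg_left h4 hC
    nlinarith [abs_nonneg (t - s)]
  have h6 := abs_add_le (thin (Real.exp (-|t|)) D n - thin (Real.exp (-|s|)) D n)
    (thin (Real.exp (-|s|)) D n - D n)
  rw [sub_add_sub_cancel] at h6
  linarith

end Periods

section Profile

variable {p q : ℝ} (hp : 0 < p) (hq : 0 < q) (hpq : p + q = 1)

include hp hq hpq

lemma logSum_profile_eq {n : ℕ} (hn : 1 ≤ n) :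
    logSum (profile p q) n = avg p q (logSum (profile p q)) n + 1 := by
  induction n, hn using Nat.le_induction with
  | base =>
    simp only [logSum, avg, thin, binWeight, Finset.sum_range_succ, Finset.sum_range_zero]
    have h1 := profile_eq hp hq hpq 1
    simp only [avg, thin, binWeight, Finset.sum_range_succ, Finset.sum_range_zero,
      profile_zero] at h1
    norm_num [indOne] at h1 ⊢
    linarith
  | succ n hn ih =>
    have h1 := fdiff_thin p (logSum (profile p q)) n
    have h2 := fdiff_thin q (logSum (profile p q)) n
    have hf : fdiff (logSum (profile p q)) = fun k => profile p q (k + 1) / (k + 1 : ℝ) := by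
      funext k; rw [fdiff, logSum_succ]; ring
    rw [hf, thin_div_succ, profile_zero, mul_zero, sub_zero] at h1 h2
    have h3 := profile_eq hp hq hpq (n + 1)
    rw [indOne, if_neg (by omega), add_zero] at h3
    rw [logSum_succ, ih]
    unfold fdiff at h1 h2
    unfold avg at h3 ⊢
    have h4 : thin p (logSum (profile p q)) (n + 1)
        = thin p (logSum (profile p q)) n + thin p (profile p q) (n + 1) / (n + 1 : ℝ) := by linarith
    have h5 : thin q (logSum (profile p q)) (n + 1)
        = thin q (logSum (profile p q)) n + thin q (profile p q) (n + 1) / (n + 1 : ℝ) := by linarith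
    rw [h4, h5, h3]; ring

lemma tendsto_profile_of_dense (hd : Dense (periods (profile p q) : Set ℝ)) :
    Tendsto (fun n => profile p q n - 1 / (-(p * Real.log p) - q * Real.log q)) atTop (𝓝 0) := by
  obtain ⟨C, hC, hD⟩ := abs_fdiff_profile_le hp hq hpq
  have hz : ∀ z, 0 < z → z ≤ 1 →
      Tendsto (fun n => thin z (profile p q) n - profile p q n) atTop (𝓝 0) :=
    fun z h0 h1 => (neg_log_mem_periods h0 h1).1 (mem_periods_of_dense hC hD hd _)
  have hK := abs_profile_le hp hq hpq
  have h1 := (tendsto_logSum_sub_thin hC hD hK hz hp (by linarith)).const_mul p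
  have h2 := (tendsto_logSum_sub_thin hC hD hK hz hq (by linarith)).const_mul q
  set h := -(p * Real.log p) - q * Real.log q with hh
  have hpos : 0 < h := entropy_pos hp hq hpq
  have h3 := (h1.add h2).const_mul (-(1 / h))
  simp only [mul_zero, add_zero] at h3
  refine h3.congr' ?_
  filter_upwards [eventually_ge_atTop 1] with n hn
  have h4 := logSum_profile_eq hp hq hpq hn
  unfold avg at h4
  have h5 : p * (logSum (profile p q) n - thin p (logSum (profile p q)) n
        + Real.log p * profile p q n)
      + q * (logSum (profile p q) n - thin q (logSum (profile p q)) n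
        + Real.log q * profile p q n) = 1 - h * profile p q n := by
    rw [hh]; linear_combination h4 + logSum (profile p q) n * hpq
  rw [h5]; field_simp; ring

lemma green_abs_sub_thin_sum_le {r c : ℝ} (h0 : 0 < r) (h1 : r ≤ 1) (hc : 0 ≤ c) {Y : ℕ → ℝ}
    (hY : ∀ n, Y n - thin r Y n = c * indOne n) (M : ℕ) (n : ℕ) :
    green p q (fun k => |Y k - thin (r ^ M) Y k|) n ≤ M * (c * (1 / (p * q))) := by
  induction M with
  | zero =>
    simp only [pow_zero, thin_one, sub_self, abs_zero, Nat.cast_zero, zero_mul]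
    refine le_of_eq ?_
    have := green_const_mul hp hq hpq 0 (fun _ => 0) n
    simpa using this
  | succ M ih =>
    have hr0 : 0 < r ^ M := pow_pos h0 M
    have hr1 : r ^ M ≤ 1 := pow_le_one₀ h0.le h1
    have hle : ∀ k, |Y k - thin (r ^ (M + 1)) Y k|
        ≤ |Y k - thin (r ^ M) Y k| + c * thin (r ^ M) indOne k := by
      intro k
      have e : Y k - thin (r ^ (M + 1)) Y k = (Y k - thin (r ^ M) Y k)
          + thin (r ^ M) (fun j => Y j - thin r Y j) k := by
        rw [thin_sub, thin_thin, ← pow_succ]; ring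
      rw [e]
      refine (abs_add_le _ _).trans ?_
      have : (fun j => Y j - thin r Y j) = fun j => c * indOne j := funext hY
      rw [this, thin_const_mul, abs_of_nonneg (mul_nonneg hc
        (thin_nonneg hr0.le hr1 fun k _ => indOne_nonneg k))]
    refine (green_mono hp hq hpq (fun k _ => hle k) n).trans ?_
    rw [green_add hp hq hpq, green_const_mul hp hq hpq,
      green_thin hp hq hpq (r ^ M) (show indOne 0 = 0 by simp [indOne])]
    have h2 := abs_thin_le hr0.le hr1 (n := n) (fun k _ => abs_profile_le hp hq hpq k)
    rw [thin_const] at h2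
    have h3 := (le_abs_self _).trans h2
    have h4 : c * thin (r ^ M) (green p q indOne) n ≤ c * (1 / (p * q)) :=
      mul_le_mul_of_nonneg_left h3 hc
    push_cast
    linarith

lemma exists_limit_profile : ∃ (Y : ℕ → ℝ) (C : ℝ), (∀ n, |Y n| ≤ C) ∧
    Tendsto (fun n => profile p q n - Y n) atTop (𝓝 0) ∧
    (∀ n, green p q (fun k => |Y k - thin p Y k|) n ≤ C) ∧
    (∀ n, green p q (fun k => |Y k - thin q Y k|) n ≤ C) := by
  set D := profile p q with hDdef
  obtain ⟨hTp, hTq⟩ := tendsto_thin_profile_sub hp hq hpq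
  have hp1 : p < 1 := by linarith
  have hq1 : q < 1 := by linarith
  rcases AddSubgroup.dense_or_cyclic (periods D) with hd | ⟨a, ha⟩
  · refine ⟨fun _ => 1 / (-(p * Real.log p) - q * Real.log q),
      |1 / (-(p * Real.log p) - q * Real.log q)|, fun n => le_rfl,
      tendsto_profile_of_dense hp hq hpq hd, ?_, ?_⟩
    · intro n
      have := green_const_mul hp hq hpq 0 (fun _ => 0) n
      simp only [thin_const, sub_self, abs_zero]
      simp only [zero_mul] at this
      rw [this]; positivity
    · intro n
      have := green_const_mul hp hq hpq 0 (fun _ => 0) n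
      simp only [thin_const, sub_self, abs_zero]
      simp only [zero_mul] at this
      rw [this]; positivity
  · have hmem : ∀ x, 0 < x → x < 1 → Tendsto (fun n => thin x D n - D n) atTop (𝓝 0) →
        ∃ M : ℕ, x = Real.exp (-|a|) ^ M := by
      intro x hx0 hx1 hx
      have h1 := (neg_log_mem_periods hx0 hx1.le).2 hx
      rw [ha, ← AddSubgroup.zmultiples_eq_closure, AddSubgroup.mem_zmultiples_iff] at h1
      obtain ⟨k, hk⟩ := h1
      refine ⟨k.natAbs, ?_⟩
      have h2 : |(k : ℝ)| * |a| = -Real.log x := by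
        rw [← abs_mul, ← zsmul_eq_mul, hk, abs_neg, abs_of_neg (Real.log_neg hx0 hx1)]
      rw [← Real.exp_nat_mul, Nat.cast_natAbs, Int.cast_abs, mul_neg, h2, neg_neg,
        Real.exp_log hx0]
    obtain ⟨M, hM⟩ := hmem p hp hp1 hTp
    obtain ⟨L, hL⟩ := hmem q hq hq1 hTq
    set r := Real.exp (-|a|) with hr
    have hr0 : 0 < r := Real.exp_pos _
    have hr1 : r ≤ 1 := Real.exp_le_one_iff.2 (by simp)
    have hM0 : 0 < M := by
      rcases Nat.eq_zero_or_pos M with rfl | h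
      · rw [pow_zero] at hM; linarith
      · exact h
    have hw : 0 < p * M + q * L := by positivity
    have hTr : Tendsto (fun n => thin r D n - D n) atTop (𝓝 0) := by
      change Tendsto (fun n => thin (Real.exp (-|a|)) D n - D n) atTop (𝓝 0)
      have : a ∈ periods D := by
        rw [ha]; exact AddSubgroup.subset_closure rfl
      exact this
    have hTrj : ∀ j : ℕ, Tendsto (fun n => thin (r ^ j) D n - D n) atTop (𝓝 0) := by
      intro j
      induction j with
      | zero => simp [thin_one]
      | succ j ih => rw [pow_succ']; exact tendsto_thin_mul_sub hr0 hr1 hTr ih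
    let A : ℕ → ℕ → ℝ := fun N n => ∑ j ∈ Finset.range N, thin (r ^ j) D n
    have hA_thin : ∀ N n, A N n - thin r (A N) n = D n - thin (r ^ N) D n := by
      intro N n
      induction N with
      | zero =>
        have : A 0 = fun _ => 0 := funext fun n => by simp [A]
        rw [this, thin_const, pow_zero, thin_one]; ring
      | succ N ih =>
        have : A (N + 1) = fun n => A N n + thin (r ^ N) D n :=
          funext fun n => Finset.sum_range_succ _ _
        rw [this, thin_add, thin_thin, ← pow_succ']; linarith
    have hA_lim : ∀ N : ℕ, Tendsto (fun n => N * D n - A N n) atTop (𝓝 0) := by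
      intro N
      have := tendsto_finsetSum (Finset.range N) (fun j _ => (hTrj j).const_mul (-1))
      simp only [mul_zero, Finset.sum_const_zero] at this
      refine this.congr fun n => ?_
      simp only [A]
      rw [← Finset.mul_sum, Finset.sum_sub_distrib]
      simp
    set Y : ℕ → ℝ := fun n => 1 / (p * M + q * L) * (p * A M n + q * A L n) with hYdef
    have hYthin : ∀ n, Y n - thin r Y n = 1 / (p * M + q * L) * indOne n := by
      intro n
      have h1 := hA_thin M n
      have h2 := hA_thin L n
      rw [← hM] at h1; rw [← hL] at h2
      have h3 := profile_eq hp hq hpq n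
      unfold avg at h3
      rw [hYdef, thin_const_mul, thin_add, thin_const_mul, thin_const_mul, ← mul_sub]
      congr 1
      linear_combination p * h1 + q * h2 + h3 + D n * hpq
    have hDY : Tendsto (fun n => D n - Y n) atTop (𝓝 0) := by
      have := (((hA_lim M).const_mul p).add ((hA_lim L).const_mul q)).const_mul
        (1 / (p * M + q * L))
      simp only [mul_zero, add_zero] at this
      refine this.congr fun n => ?_
      rw [hYdef]; field_simp; ring
    obtain ⟨K, hK⟩ := hDY.abs.bddAbove_range
    have hK' : ∀ n, |D n - Y n| ≤ K := fun n => hK ⟨n, rfl⟩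
    have hK0 : 0 ≤ K := (abs_nonneg _).trans (hK' 0)
    have hw' : 0 ≤ 1 / (p * M + q * L) := by positivity
    have hN : ∀ N : ℕ, 0 ≤ N * (1 / (p * M + q * L) * (1 / (p * q))) := fun N => by positivity
    have hpq' : 0 ≤ 1 / (p * q) := by positivity
    refine ⟨Y, 1 / (p * q) + K + M * (1 / (p * M + q * L) * (1 / (p * q)))
      + L * (1 / (p * M + q * L) * (1 / (p * q))), fun n => ?_, hDY, fun n => ?_, fun n => ?_⟩
    · have h1 := abs_sub (D n) (D n - Y n)
      rw [sub_sub_cancel] at h1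
      linarith [hK' n, abs_profile_le hp hq hpq n, hN M, hN L]
    · have := green_abs_sub_thin_sum_le hp hq hpq hr0 hr1 hw' hYthin M n
      rw [← hM] at this
      linarith [hN L]
    · have := green_abs_sub_thin_sum_le hp hq hpq hr0 hr1 hw' hYthin L n
      rw [← hL] at this
      linarith [hN M]

end Profile

section Profile

variable {p q : ℝ} (hp : 0 < p) (hq : 0 < q) (hpq : p + q = 1)

include hp hq hpq

lemma green_avg_cutoff_le (R n : ℕ) :
    green p q (fun n => if R ≤ n then avg p q (fun k => if R ≤ k then (0 : ℝ) else 1) n else 0) n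
      ≤ 1 := by
  have h := green_le_of_super hp hq hpq
    (g := fun n => if R ≤ n then avg p q (fun k => if R ≤ k then (0 : ℝ) else 1) n else 0)
    (F := fun n => if R ≤ n then (1 : ℝ) else 0) (by split_ifs <;> norm_num) (fun n _ => ?_) n
  · refine h.trans ?_
    split_ifs <;> norm_num
  · by_cases hn : R ≤ n
    · simp only [hn, if_true]
      have : (fun k => if R ≤ k then (1 : ℝ) else 0)
          = fun k => 1 - if R ≤ k then (0 : ℝ) else 1 := by
        funext k; split_ifs <;> norm_num
      rw [this, avg_sub, avg_const hpq]; linarith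
    · have h0 : ∀ x, thin x (fun k => if R ≤ k then (1 : ℝ) else 0) n = 0 := fun x => by
        refine (thin_congr fun k hk => ?_).trans (thin_const x 0 n)
        exact if_neg (by omega)
      simp [hn, avg, h0]

/-- The potential of the discrepancy of the profile is negligible against `√(green 1)`. -/
lemma abs_green_disc_profile_le {ε : ℝ} (hε : 0 < ε) : ∃ C, ∀ n,
    |green p q (disc p q (profile p q)) n| ≤ ε * √(green p q (fun _ => 1) n) + C := by
  obtain ⟨Y, C, -, hDY, hYp, hYq⟩ := exists_limit_profile hp hq hpq
  have hp1 : p ≤ 1 := by linarith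
  have hq1 : q ≤ 1 := by linarith
  have hC0 : 0 ≤ C := by simpa using hYp 0
  set D := profile p q with hD
  set X : ℕ → ℝ := fun n => D n - Y n with hX
  obtain ⟨K, hK⟩ := hDY.abs.bddAbove_range
  have hK' : ∀ n, |X n| ≤ K := fun n => hK ⟨n, rfl⟩
  have hK0 : 0 ≤ K := (abs_nonneg _).trans (hK' 0)
  set C₁ := 1 / (p * q) + 2 * C with hC₁
  have hC₁0 : 0 ≤ C₁ := by positivity
  have hpos : 0 < p * q := by positivity
  set ε' := min 1 (ε ^ 2 * (p * q) / (1 + 2 * (C₁ + K))) with hε'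
  have hε'0 : 0 < ε' := lt_min one_pos (by positivity)
  have hε'1 : ε' ≤ 1 := min_le_left _ _
  have hε'2 : ε' * (1 + 2 * (C₁ + K)) ≤ ε ^ 2 * (p * q) := by
    rw [← le_div_iff₀ (by positivity)]; exact min_le_right _ _
  obtain ⟨R₀, hR₀⟩ := Metric.tendsto_atTop.1 hDY ε' hε'0
  set R := max 1 R₀ with hRdef
  have hR : 1 ≤ R := le_max_left _ _
  have hXR : ∀ n, R ≤ n → |X n| ≤ ε' := fun n hn => by
    have := hR₀ n ((le_max_right _ _).trans hn)
    rw [Real.dist_eq, sub_zero] at this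
    exact this.le
  set T : ℕ → ℝ := fun k => if R ≤ k then (0 : ℝ) else 1 with hT
  set Z : ℕ → ℝ := fun n => if R ≤ n then X n else 0 with hZ
  set W : ℕ → ℝ := fun n => X n - Z n with hW
  have hWT : ∀ n, |W n| ≤ K * T n := fun n => by
    simp only [hW, hZ, hT]
    split_ifs
    · simp
    · simpa using hK' n
  have heX : ∀ n, |X n - avg p q X n|
      ≤ (|indOne n| + |Y n - thin p Y n|) + |Y n - thin q Y n| := by
    intro n
    have e : X n - avg p q X n = indOne n - (p * (Y n - thin p Y n) + q * (Y n - thin q Y n)) := by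
      have h1 : avg p q X n = avg p q D n - avg p q Y n := avg_sub _ _ _
      have h2 : D n = avg p q D n + indOne n := profile_eq hp hq hpq n
      have h3 : X n = D n - Y n := rfl
      have h4 : avg p q Y n = p * thin p Y n + q * thin q Y n := rfl
      rw [h1, h3, h4]; linear_combination h2 + Y n * hpq
    rw [e]
    refine (abs_sub _ _).trans ?_
    have h1 := abs_add_le (p * (Y n - thin p Y n)) (q * (Y n - thin q Y n))
    rw [abs_mul, abs_mul, abs_of_pos hp, abs_of_pos hq] at h1
    have h2 := mul_le_mul_of_nonneg_right hp1 (abs_nonneg (Y n - thin p Y n))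
    have h3 := mul_le_mul_of_nonneg_right hq1 (abs_nonneg (Y n - thin q Y n))
    linarith
  have hgX : ∀ n, green p q (fun n => |X n - avg p q X n|) n ≤ C₁ := by
    intro n
    refine (green_mono hp hq hpq (fun n _ => heX n) n).trans ?_
    rw [green_add hp hq hpq, green_add hp hq hpq]
    linarith [hYp n, hYq n, green_abs_indOne_le hp hq hpq n]
  have heZ : ∀ n, |Z n - avg p q Z n| ≤ |X n - avg p q X n|
      + K * (if R ≤ n then avg p q T n else 0) := by
    intro n
    by_cases hn : R ≤ n
    · have h1 : avg p q Z n = avg p q X n - avg p q W n := by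
        rw [← avg_sub]; simp [hW]
      have h2 : Z n = X n := if_pos hn
      have h3 : |avg p q W n| ≤ K * avg p q T n := by
        rw [← avg_const_mul, abs_le]
        constructor
        · have := avg_mono hp hq hpq (n := n) (f := fun k => (-1) * (K * T k)) (g := W)
            fun k _ => by linarith [(abs_le.1 (hWT k)).1]
          rw [avg_const_mul] at this; linarith
        · exact avg_mono hp hq hpq fun k _ => (abs_le.1 (hWT k)).2
      rw [if_pos hn, h1, h2, sub_sub_eq_add_sub, add_sub_right_comm]
      exact (abs_add_le _ _).trans (by linarith)
    · have h0 : ∀ x, thin x Z n = 0 := fun x => by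
        refine (thin_congr fun k hk => ?_).trans (thin_const x 0 n)
        exact if_neg (by omega)
      have h1 : Z n = 0 := if_neg hn
      rw [if_neg hn, h1, avg, h0, h0]
      simp
  have hgZ : ∀ n, green p q (fun n => |Z n - avg p q Z n|) n ≤ C₁ + K := by
    intro n
    refine (green_mono hp hq hpq (fun n _ => heZ n) n).trans ?_
    rw [green_add hp hq hpq, green_const_mul hp hq hpq]
    have := mul_le_mul_of_nonneg_left (green_avg_cutoff_le hp hq hpq R n) hK0
    linarith [hgX n]
  have hZε : ∀ n, |Z n| ≤ ε' := fun n => by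
    simp only [hZ]; split_ifs with h
    · exact hXR n h
    · simpa using hε'0.le
  have hZen : ∀ n, green p q (fun k => disc p q Z k ^ 2) n ≤ ε ^ 2 := by
    intro n
    have h1 := green_sq_disc_le hp hq hpq hZε (e := fun n => Z n - avg p q Z n)
      (fun n _ => by ring) n
    have h2 : 2 * ε' * green p q (fun n => |Z n - avg p q Z n|) n ≤ 2 * ε' * (C₁ + K) := by
      have := hgZ n; gcongr
    have h3 : ε' ^ 2 ≤ ε' := by nlinarith
    have h4 : p * q * green p q (fun k => disc p q Z k ^ 2) n ≤ p * q * ε ^ 2 := by linarith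
    exact le_of_mul_le_mul_left h4 hpos
  have hTle : ∀ k : ℕ, T k ≤ R * (1 / (k + 1 : ℝ)) := fun k => by
    simp only [hT]; split_ifs with h
    · positivity
    · rw [mul_one_div, le_div_iff₀ (by positivity)]
      have : k + 1 ≤ R := by omega
      have : ((k + 1 : ℕ) : ℝ) ≤ R := by exact_mod_cast this
      push_cast at this; linarith
  have hthinW : ∀ x, 0 < x → x ≤ 1 → ∀ n : ℕ, |thin x W n| ≤ K * R * (1 / x) * (1 / (n + 1 : ℝ)) := by
    intro x h0 h1 n
    have h2 := abs_thin_le h0.le h1 (n := n) (f := W) (g := fun k => K * R * (1 / (k + 1 : ℝ)))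
      fun k _ => (hWT k).trans (by
        rw [mul_assoc]; exact mul_le_mul_of_nonneg_left (hTle k) hK0)
    rw [thin_const_mul] at h2
    refine h2.trans ?_
    rw [mul_assoc (K * R)]
    exact mul_le_mul_of_nonneg_left (thin_inv_succ_le h0 h1 n) (by positivity)
  set C₂ := K * R * (1 / p) + K * R * (1 / q) with hC₂
  have hgW : ∀ n, |green p q (disc p q W) n| ≤ C₂ * (1 / (2 * (p * q))) := by
    refine abs_green_le_of_le_inv_succ hp hq hpq (by positivity) fun n _ => ?_
    have h1 := hthinW p hp hp1 n
    have h2 := hthinW q hq hq1 n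
    have h3 := abs_sub (thin p W n) (thin q W n)
    unfold disc
    linarith
  have hgY : ∀ n, |green p q (disc p q Y) n| ≤ 2 * C := by
    intro n
    have h1 := abs_green_le hp hq hpq (f := disc p q Y)
      (g := fun n => |Y n - thin p Y n| + |Y n - thin q Y n|) (fun n _ => by
        have := abs_sub (Y n - thin q Y n) (Y n - thin p Y n)
        rw [sub_sub_sub_cancel_left] at this
        unfold disc; linarith) n
    rw [green_add hp hq hpq] at h1
    linarith [hYp n, hYq n]
  refine ⟨C₂ * (1 / (2 * (p * q))) + 2 * C, fun n => ?_⟩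
  have e : green p q (disc p q D) n
      = green p q (disc p q Z) n + green p q (disc p q W) n + green p q (disc p q Y) n := by
    rw [← green_add hp hq hpq, ← green_add hp hq hpq]
    refine green_congr hp hq hpq (fun k _ => ?_) n
    rw [← disc_add, ← disc_add]
    simp [hW, hX]
  have h1 : |green p q (disc p q Z) n| ≤ ε * √(green p q (fun _ => 1) n) := by
    have h := sq_green_mul_le hp hq hpq (disc p q Z) (fun _ => 1) n
    simp only [mul_one, one_pow] at h
    have h0 : 0 ≤ green p q (fun _ => 1) n := green_nonneg hp hq hpq (fun _ _ => zero_le_one) n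
    refine abs_le_of_sq_le_sq ?_ (by positivity)
    rw [mul_pow, Real.sq_sqrt h0]
    exact h.trans (mul_le_mul_of_nonneg_right (hZen n) h0)
  rw [e]
  have h2 := abs_add_le (green p q (disc p q Z) n + green p q (disc p q W) n)
    (green p q (disc p q Y) n)
  have h3 := abs_add_le (green p q (disc p q Z) n) (green p q (disc p q W) n)
  linarith [hgW n, hgY n]

lemma profile_nonneg (n : ℕ) : 0 ≤ profile p q n :=
  green_nonneg hp hq hpq (fun n _ => indOne_nonneg n) n

lemma profile_pos {n : ℕ} (hn : 1 ≤ n) : 0 < profile p q n := by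
  have h1 : 0 < profile p q 1 := by
    have h := profile_eq hp hq hpq 1
    have h2 : 0 ≤ avg p q (profile p q) 1 := by
      have := avg_mono hp hq hpq (n := 1) (f := fun _ => 0) fun k _ => profile_nonneg hp hq hpq k
      rwa [avg_const hpq] at this
    have h3 : indOne 1 = 1 := if_pos rfl
    linarith
  rcases hn.eq_or_lt with rfl | hn
  · exact h1
  have h := profile_eq hp hq hpq n
  rw [avg_eq_sum] at h
  have hs := Finset.single_le_sum
    (f := fun k => (p * binWeight p n k + q * binWeight q n k) * profile p q k)
    (s := Finset.range n) (fun k _ => mul_nonneg (binWeight_mix_nonneg hp hq hpq n k)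
      (profile_nonneg hp hq hpq k)) (Finset.mem_range.2 hn)
  have hb : 0 < p * binWeight p n 1 + q * binWeight q n 1 := by
    have e1 : 1 - p = q := by linarith
    have e2 : 1 - q = p := by linarith
    unfold binWeight
    rw [e1, e2, Nat.choose_one_right]
    positivity
  have h5 : 0 < (p * binWeight p n 1 + q * binWeight q n 1) * profile p q 1 := mul_pos hb h1
  have h6 : 0 ≤ (p ^ (n + 1) + q ^ (n + 1)) * profile p q n :=
    mul_nonneg (by positivity) (profile_nonneg hp hq hpq n)
  linarith [indOne_nonneg n]

lemma exists_pos_le_profile : ∃ c, 0 < c ∧ ∀ n, 1 ≤ n → c ≤ profile p q n := by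
  have hlim : Tendsto (fun n : ℕ => ((n : ℝ) + 1) * (p * q ^ n + q * p ^ n)) atTop (𝓝 0) := by
    have a : ∀ r : ℝ, 0 < r → r < 1 → Tendsto (fun n : ℕ => ((n : ℝ) + 1) * r ^ n) atTop (𝓝 0) := by
      intro r h0 h1
      have := (tendsto_self_mul_const_pow_of_lt_one h0.le h1).add
        (tendsto_pow_atTop_nhds_zero_of_lt_one h0.le h1)
      rw [add_zero] at this
      exact this.congr fun n => by ring
    have := ((a q hq (by linarith)).const_mul p).add ((a p hp (by linarith)).const_mul q)
    simp only [mul_zero, add_zero] at this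
    exact this.congr fun n => by ring
  obtain ⟨R₀, hR₀⟩ := eventually_atTop.1 (hlim.eventually_lt_const (mul_pos hp hq))
  set R := max 1 R₀ with hR
  obtain ⟨c, hc0, hc⟩ : ∃ c, 0 < c ∧ ∀ n, 1 ≤ n → n < R → c ≤ profile p q n := by
    have : ∀ N : ℕ, ∃ c, 0 < c ∧ ∀ n, 1 ≤ n → n < N → c ≤ profile p q n := by
      intro N
      induction N with
      | zero => exact ⟨1, one_pos, fun n _ h => absurd h (Nat.not_lt_zero n)⟩
      | succ N ih =>
        obtain ⟨c, hc0, hc⟩ := ih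
        rcases Nat.eq_zero_or_pos N with rfl | hN
        · exact ⟨1, one_pos, fun n h1 h2 => by omega⟩
        · refine ⟨min c (profile p q N), lt_min hc0 (profile_pos hp hq hpq hN), fun n h1 h2 => ?_⟩
          rcases Nat.lt_succ_iff_lt_or_eq.1 h2 with h | rfl
          · exact (min_le_left _ _).trans (hc n h1 h)
          · exact min_le_right _ _
    exact this R
  let F : ℕ → ℝ := fun n => 1 + 1 / (n + 1 : ℝ) - 2 * (if n = 0 then 1 else 0)
  have hthin0 : ∀ x n, thin x (fun n => if n = 0 then (1 : ℝ) else 0) n = (1 - x) ^ n := by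
    intro x n
    unfold thin
    rw [Finset.sum_eq_single 0]
    · simp [binWeight]
    · intro b _ hb; simp [hb]
    · simp
  have hF : ∀ n, R ≤ n → F n ≤ avg p q F n := by
    intro n hn
    have hn1 : 1 ≤ n := (le_max_left _ _).trans hn
    have h1 := hR₀ n ((le_max_right _ _).trans hn)
    have h2 := two_mul_le_one_sub_pow hp hq hpq hn1
    have e1 : 1 - p = q := by linarith
    have e2 : 1 - q = p := by linarith
    have h3 := thin_inv_succ p n
    have h4 := thin_inv_succ q n
    rw [e1] at h3; rw [e2] at h4
    have h5 : avg p q F n = 1 + (p * thin p (fun k => 1 / (k + 1 : ℝ)) n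
        + q * thin q (fun k => 1 / (k + 1 : ℝ)) n) - 2 * (p * q ^ n + q * p ^ n) := by
      simp only [F]
      rw [avg_sub, avg_add, avg_const hpq, avg_const_mul, avg, avg, hthin0, hthin0, e1, e2]
    have h6 : F n = 1 + 1 / (n + 1 : ℝ) := by simp [F]; omega
    rw [h5, h6, h3, h4]
    have hn0 : (0 : ℝ) < n + 1 := by positivity
    have h7 : 2 * (p * q ^ n + q * p ^ n) ≤ (1 - p ^ (n + 1) - q ^ (n + 1)) / (n + 1 : ℝ) := by
      rw [le_div_iff₀ hn0]; linarith
    have h8 : (1 - q ^ (n + 1)) / (n + 1 : ℝ) + (1 - p ^ (n + 1)) / (n + 1 : ℝ)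
        = 1 / (n + 1 : ℝ) + (1 - p ^ (n + 1) - q ^ (n + 1)) / (n + 1 : ℝ) := by
      rw [← add_div, ← add_div]; ring
    linarith
  have hF2 : ∀ n, 1 ≤ n → 1 ≤ F n ∧ F n ≤ 2 := by
    intro n hn
    have h6 : F n = 1 + 1 / (n + 1 : ℝ) := by simp [F]; omega
    rw [h6]
    have : (0 : ℝ) ≤ 1 / (n + 1 : ℝ) := by positivity
    have h3 : 1 / (n + 1 : ℝ) ≤ 1 := by
      rw [div_le_one (by positivity)]; linarith [(Nat.cast_nonneg n : (0 : ℝ) ≤ n)]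
    constructor <;> linarith
  have key := nonneg_of_avg_le_of_ge hp hq hpq (R := R) (F := fun n => profile p q n - c / 2 * F n)
    (le_max_left _ _) (fun n hn => by
      rcases Nat.eq_zero_or_pos n with rfl | hn1
      · simp [profile_zero, F]; norm_num
      · have := hc n hn1 hn
        have h2 := (hF2 n hn1).2
        nlinarith) (fun n hn => by
      rw [avg_sub, avg_const_mul]
      have h1 := mul_le_mul_of_nonneg_left (hF n hn) (half_pos hc0).le
      linarith [profile_eq hp hq hpq n, indOne_nonneg n])
  refine ⟨c / 2, half_pos hc0, fun n hn => ?_⟩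
  have h1 := key n
  have h2 := mul_le_mul_of_nonneg_left (hF2 n hn).1 (half_pos hc0).le
  linarith

end Profile

lemma integral_binomialMeasure {p : ℝ} (h0 : 0 ≤ p) (h1 : p ≤ 1) (n : ℕ) (g : ℕ → ℝ) :
    ∫ k, g k ∂binomialMeasure n p = thin p g n := by
  unfold binomialMeasure thin
  rw [integral_finsetSum_measure fun k _ =>
    (integrable_dirac (by simp)).smul_measure ENNReal.ofReal_ne_top]
  refine Finset.sum_congr rfl fun k _ => ?_
  rw [integral_smul_measure, integral_dirac, smul_eq_mul, ENNReal.toReal_ofReal]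
  · rfl
  · exact binWeight_nonneg h0 h1 n k

lemma measurable_trieStep (n : ℕ) : Measurable (trieStep n) := by
  refine measurable_from_prod_countable_right fun k => ?_
  unfold trieStep
  have h1 : Measurable fun y : (ℕ → ℕ × ℕ) × (ℕ → ℕ × ℕ) => y.1 k :=
    (measurable_pi_apply k).comp measurable_fst
  have h2 : Measurable fun y : (ℕ → ℕ × ℕ) × (ℕ → ℕ × ℕ) => y.2 (n - k) :=
    (measurable_pi_apply (n - k)).comp measurable_snd
  exact ((h1.fst.add h2.fst).add_const 1).prodMk ((h1.snd.add h2.snd).add_const n)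

lemma IsTriePairFamily.integral_recur {p : ℝ} {μ : ℕ → Measure (ℕ × ℕ)} (hμ : IsTriePairFamily p μ)
    (h0 : 0 ≤ p) (h1 : p ≤ 1) {n : ℕ} (hn : 2 ≤ n) {f : ℕ × ℕ → ℝ} (hf : Integrable f (μ n)) :
    ∫ x, f x ∂μ n
      = thin p (fun k => ∫ z, f (z.1 + z.2 + (1, n)) ∂((μ k).prod (μ (n - k)))) n := by
  obtain ⟨P, hP, hB, hα, hβ, hprod, hstep⟩ := hμ.recur n hn
  have hfst : Measurable fun ω : ℕ × ((ℕ → ℕ × ℕ) × (ℕ → ℕ × ℕ)) => ω.2.1 :=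
    measurable_fst.comp measurable_snd
  have hsnd : Measurable fun ω : ℕ × ((ℕ → ℕ × ℕ) × (ℕ → ℕ × ℕ)) => ω.2.2 :=
    measurable_snd.comp measurable_snd
  set α := P.map fun ω => ω.2.1 with hαdef
  set β := P.map fun ω => ω.2.2 with hβdef
  have : IsProbabilityMeasure (P.map Prod.fst) :=
    Measure.isProbabilityMeasure_map measurable_fst.aemeasurable
  have hαp : IsProbabilityMeasure α := Measure.isProbabilityMeasure_map hfst.aemeasurable
  have hβp : IsProbabilityMeasure β := Measure.isProbabilityMeasure_map hsnd.aemeasurable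
  have hmeas : Measurable f := Measurable.of_discrete
  rw [hstep] at hf ⊢
  rw [integral_map (measurable_trieStep n).aemeasurable hmeas.aestronglyMeasurable]
  rw [integrable_map_measure hmeas.aestronglyMeasurable (measurable_trieStep n).aemeasurable] at hf
  rw [hprod] at hf ⊢
  refine (integral_prod _ hf).trans ?_
  rw [hB, integral_binomialMeasure h0 h1]
  refine thin_congr fun k _ => ?_
  have hmap : ((μ k).prod (μ (n - k)))
      = (α.prod β).map (Prod.map (fun s => s k) fun s => s (n - k)) := by
    rw [← Measure.map_prod_map _ _ (measurable_pi_apply k) (measurable_pi_apply (n - k)),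
      Measure.map_map (measurable_pi_apply k) hfst,
      Measure.map_map (measurable_pi_apply (n - k)) hsnd, ← hα k, ← hβ (n - k)]
    rfl
  rw [hmap, integral_map ((measurable_pi_apply k).prodMap (measurable_pi_apply (n - k))).aemeasurable
    (Measurable.of_discrete (f := fun z : (ℕ × ℕ) × (ℕ × ℕ) =>
      f (z.1 + z.2 + (1, n)))).aestronglyMeasurable]
  rfl

/-- An additive functional of the pair (size, path length) dominated by the sum of both. -/
structure IsCoord (u : ℕ × ℕ → ℝ) : Prop where
  add : ∀ x y, u (x + y) = u x + u y
  abs_le : ∀ x, |u x| ≤ (x.1 : ℝ) + x.2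

lemma isCoord_fst : IsCoord fun x => (x.1 : ℝ) where
  add x y := by simp
  abs_le x := by simp

lemma isCoord_snd : IsCoord fun x => (x.2 : ℝ) where
  add x y := by simp
  abs_le x := by simp

/-- The mean of a functional of the trie pair. -/
noncomputable def mean (μ : ℕ → Measure (ℕ × ℕ)) (u : ℕ × ℕ → ℝ) (n : ℕ) : ℝ := ∫ x, u x ∂μ n

/-- The covariance of two functionals of the trie pair. -/
noncomputable def cov (μ : ℕ → Measure (ℕ × ℕ)) (u w : ℕ × ℕ → ℝ) (n : ℕ) : ℝ :=
  ∫ x, (u x - mean μ u n) * (w x - mean μ w n) ∂μ n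

/-- The conditional mean of a functional, given the size of the left subtree, centred. -/
noncomputable def toll (μ : ℕ → Measure (ℕ × ℕ)) (u : ℕ × ℕ → ℝ) (n k : ℕ) : ℝ :=
  mean μ u k + mean μ u (n - k) + u (1, n) - mean μ u n

section Recursions

variable {p : ℝ} {μ : ℕ → Measure (ℕ × ℕ)} (hμ : IsTriePairFamily p μ)
  {u w : ℕ × ℕ → ℝ} (hu : IsCoord u) (hw : IsCoord w)

include hμ hu

lemma integrable_coord (n : ℕ) : Integrable u (μ n) := by
  refine (hμ.moments n 1).mono' (Measurable.of_discrete (f := u)).aestronglyMeasurable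
    (Eventually.of_forall fun x => ?_)
  rw [pow_one]; exact hu.abs_le x

lemma integrable_coord_sub (n : ℕ) (a : ℝ) : Integrable (fun x => u x - a) (μ n) := by
  have := hμ.prob n
  exact (integrable_coord hμ hu n).sub (integrable_const a)

lemma integral_centred (n : ℕ) : ∫ x, (u x - mean μ u n) ∂μ n = 0 := by
  have := hμ.prob n
  rw [integral_sub (integrable_coord hμ hu n) (integrable_const _)]
  simp [mean]

include hw

lemma integrable_coord_mul (n : ℕ) : Integrable (fun x => u x * w x) (μ n) := by
  refine (hμ.moments n 2).mono'
    (Measurable.of_discrete (f := fun x => u x * w x)).aestronglyMeasurable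
    (Eventually.of_forall fun x => ?_)
  rw [Real.norm_eq_abs, abs_mul, sq]
  exact mul_le_mul (hu.abs_le x) (hw.abs_le x) (abs_nonneg _) (by positivity)

lemma integrable_coord_sub_mul (n : ℕ) (a b : ℝ) :
    Integrable (fun x => (u x - a) * (w x - b)) (μ n) := by
  have := hμ.prob n
  have h := (((integrable_coord_mul hμ hu hw n).sub ((integrable_coord hμ hu n).mul_const b)).sub
    ((integrable_coord hμ hw n).const_mul a)).add (integrable_const (a * b))
  refine h.congr (Eventually.of_forall fun x => ?_)
  simp only [Pi.add_apply, Pi.sub_apply]; ring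

omit hw in
lemma mean_init {n : ℕ} (hn : n ≤ 1) : mean μ u n = 0 := by
  have h0 : u (0, 0) = 0 := by
    have := hu.add (0, 0) (0, 0)
    simp only [Prod.mk_add_mk, add_zero] at this
    linarith
  have : μ n = Measure.dirac (0, 0) := by
    interval_cases n
    · exact hμ.init0
    · exact hμ.init1
  rw [mean, this, integral_dirac, h0]

omit hw in
lemma cov_init {n : ℕ} (hn : n ≤ 1) : cov μ u w n = 0 := by
  have h0 : u (0, 0) = 0 := by
    have := hu.add (0, 0) (0, 0)
    simp only [Prod.mk_add_mk, add_zero] at this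
    linarith
  have : μ n = Measure.dirac (0, 0) := by
    interval_cases n
    · exact hμ.init0
    · exact hμ.init1
  rw [cov, mean_init hμ hu hn, this, integral_dirac, h0]
  ring

omit hw in
lemma mean_recur (h0 : 0 ≤ p) (h1 : p ≤ 1) {n : ℕ} (hn : 2 ≤ n) :
    mean μ u n = thin p (fun k => mean μ u k + mean μ u (n - k) + u (1, n)) n := by
  rw [mean, hμ.integral_recur h0 h1 hn (integrable_coord hμ hu n)]
  refine thin_congr fun k _ => ?_
  have := hμ.prob k
  have := hμ.prob (n - k)
  have i1 := (integrable_coord hμ hu k).comp_fst (μ (n - k))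
  have i2 := (integrable_coord hμ hu (n - k)).comp_snd (μ k)
  simp only [hu.add]
  rw [integral_add (i1.fun_add i2) (integrable_const _), integral_add i1 i2, integral_fun_fst,
    integral_fun_snd]
  simp [mean]

omit hw in
lemma thin_toll (h0 : 0 ≤ p) (h1 : p ≤ 1) {n : ℕ} (hn : 2 ≤ n) : thin p (toll μ u n) n = 0 := by
  have h := mean_recur hμ hu h0 h1 hn
  have : toll μ u n = fun k => (mean μ u k + mean μ u (n - k) + u (1, n)) - mean μ u n := rfl
  rw [this, thin_sub, ← h, thin_const, sub_self]

lemma cov_recur (h0 : 0 ≤ p) (h1 : p ≤ 1) {n : ℕ} (hn : 2 ≤ n) :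
    cov μ u w n = thin p (cov μ u w) n + thin (1 - p) (cov μ u w) n
      + thin p (fun k => toll μ u n k * toll μ w n k) n := by
  rw [← thin_reflect (x := p) (y := 1 - p) (by ring), ← thin_add, ← thin_add, cov,
    hμ.integral_recur h0 h1 hn (integrable_coord_sub_mul hμ hu hw n _ _)]
  refine thin_congr fun k _ => ?_
  have := hμ.prob k
  have := hμ.prob (n - k)
  have iu1 := integrable_coord_sub hμ hu k (mean μ u k)
  have iw1 := integrable_coord_sub hμ hw k (mean μ w k)
  have iu2 := integrable_coord_sub hμ hu (n - k) (mean μ u (n - k))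
  have iw2 := integrable_coord_sub hμ hw (n - k) (mean μ w (n - k))
  have j1 := (integrable_coord_sub_mul hμ hu hw k (mean μ u k) (mean μ w k)).comp_fst (μ (n - k))
  have j2 := (integrable_coord_sub_mul hμ hu hw (n - k) (mean μ u (n - k))
    (mean μ w (n - k))).comp_snd (μ k)
  have j3 := iu1.mul_prod iw2
  have j4 := iw1.mul_prod iu2
  have j5 := (iu1.comp_fst (μ (n - k))).mul_const (toll μ w n k)
  have j6 := (iu2.comp_snd (μ k)).mul_const (toll μ w n k)
  have j7 := (iw1.comp_fst (μ (n - k))).mul_const (toll μ u n k)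
  have j8 := (iw2.comp_snd (μ k)).mul_const (toll μ u n k)
  have j9 : Integrable (fun _ : (ℕ × ℕ) × (ℕ × ℕ) => toll μ u n k * toll μ w n k)
    ((μ k).prod (μ (n - k))) := integrable_const _
  have e : ∀ z : (ℕ × ℕ) × (ℕ × ℕ), (u (z.1 + z.2 + (1, n)) - mean μ u n)
        * (w (z.1 + z.2 + (1, n)) - mean μ w n)
      = (((((((((u z.1 - mean μ u k) * (w z.1 - mean μ w k)
        + (u z.2 - mean μ u (n - k)) * (w z.2 - mean μ w (n - k)))
        + (u z.1 - mean μ u k) * (w z.2 - mean μ w (n - k)))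
        + (w z.1 - mean μ w k) * (u z.2 - mean μ u (n - k)))
        + (u z.1 - mean μ u k) * toll μ w n k)
        + (u z.2 - mean μ u (n - k)) * toll μ w n k)
        + (w z.1 - mean μ w k) * toll μ u n k)
        + (w z.2 - mean μ w (n - k)) * toll μ u n k)
        + toll μ u n k * toll μ w n k) := by
    intro z
    simp only [hu.add, hw.add, toll]; ring
  simp only [e]
  have k2 := j1.fun_add j2
  have k3 := k2.fun_add j3
  have k4 := k3.fun_add j4
  have k5 := k4.fun_add j5
  have k6 := k5.fun_add j6
  have k7 := k6.fun_add j7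
  rw [integral_add (k7.fun_add j8) j9, integral_add k7 j8, integral_add k6 j7, integral_add k5 j6,
    integral_add k4 j5, integral_add k3 j4, integral_add k2 j3, integral_add j1 j2]
  rw [integral_mul_const, integral_mul_const, integral_mul_const, integral_mul_const,
    integral_fun_fst (fun x => u x - mean μ u k), integral_fun_snd (fun x => u x - mean μ u (n - k)),
    integral_fun_fst (fun x => w x - mean μ w k), integral_fun_snd (fun x => w x - mean μ w (n - k)),
    integral_prod_mul (fun x => u x - mean μ u k) (fun x => w x - mean μ w (n - k)),
    integral_prod_mul (fun x => w x - mean μ w k) (fun x => u x - mean μ u (n - k)),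
    integral_fun_fst (fun x => (u x - mean μ u k) * (w x - mean μ w k)),
    integral_fun_snd (fun x => (u x - mean μ u (n - k)) * (w x - mean μ w (n - k))),
    integral_centred hμ hu, integral_centred hμ hw, integral_centred hμ hu, integral_centred hμ hw]
  simp [cov]

end Recursions

/-- The binomial covariance identity. -/
lemma thin_sub_mean_mul (x : ℝ) (f : ℕ → ℝ) (m : ℕ) :
    thin x (fun k => ((k : ℝ) - x * (m + 1)) * f k) (m + 1)
      = (m + 1) * (x * (1 - x)) * thin x (fdiff f) m := by
  have h1 := thin_natCast_mul x f m
  have h2 := thin_succ x f m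
  have h3 : thin x (fdiff f) m = thin x (fun k => f (k + 1)) m - thin x f m := thin_sub _ _ _ _
  have : (fun k : ℕ => ((k : ℝ) - x * (m + 1)) * f k)
      = fun k : ℕ => (k : ℝ) * f k - (x * (m + 1)) * f k := by
    funext k; ring
  rw [this, thin_sub, thin_const_mul, h1, h2, h3]; ring

lemma toll_fdiff (μ : ℕ → Measure (ℕ × ℕ)) (u : ℕ × ℕ → ℝ) {m k : ℕ} (hk : k ≤ m) :
    fdiff (toll μ u (m + 1)) k = fdiff (mean μ u) k - fdiff (mean μ u) (m - k) := by
  have e1 : m + 1 - (k + 1) = m - k := by omega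
  have e2 : m + 1 - k = m - k + 1 := by omega
  simp only [fdiff, toll, e1, e2]; ring

/-- The part of the toll which is not linear in the size of the left subtree. -/
noncomputable def tollRest (p q : ℝ) (μ : ℕ → Measure (ℕ × ℕ)) (u : ℕ × ℕ → ℝ) (m k : ℕ) : ℝ :=
  toll μ u (m + 1) k - disc p q (fdiff (mean μ u)) m * ((k : ℝ) - p * (m + 1))

section Covariance

variable {p q : ℝ} (hp : 0 < p) (hq : 0 < q) (hpq : p + q = 1)
  {μ : ℕ → Measure (ℕ × ℕ)} (hμ : IsTriePairFamily p μ)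
  {u w : ℕ × ℕ → ℝ} (hu : IsCoord u) (hw : IsCoord w)

include hpq in
lemma thin_fdiff_tollRest (m : ℕ) : thin p (fdiff (tollRest p q μ u m)) m = 0 := by
  have h : thin p (fdiff (tollRest p q μ u m)) m
      = thin p (fun k => fdiff (mean μ u) k - fdiff (mean μ u) (m - k)
        - disc p q (fdiff (mean μ u)) m) m := by
    refine thin_congr fun k hk => ?_
    rw [← toll_fdiff μ u hk]
    simp only [fdiff, tollRest]; push_cast; ring
  rw [h, thin_sub, thin_sub, thin_const, thin_reflect hpq, disc, sub_self]

include hp hq hpq hμ hu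

lemma thin_tollRest {m : ℕ} (hm : 1 ≤ m) : thin p (tollRest p q μ u m) (m + 1) = 0 := by
  have h1 := thin_toll hμ hu hp.le (by linarith) (show 2 ≤ m + 1 by omega)
  have h2 := thin_sub_mean_mul p (fun _ => 1) m
  have h3 : fdiff (fun _ => (1 : ℝ)) = fun _ => 0 := by funext k; simp [fdiff]
  simp only [mul_one, h3, thin_const, mul_zero] at h2
  have : tollRest p q μ u m = fun k => toll μ u (m + 1) k
    - disc p q (fdiff (mean μ u)) m * ((k : ℝ) - p * (m + 1)) := rfl
  rw [this, thin_sub, thin_const_mul, h2, h1]; ring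

lemma thin_sq_tollRest_le {C : ℝ}
    (hD : ∀ n, |fdiff (fdiff (mean μ u)) n| ≤ C * (1 / (n + 1 : ℝ))) {m : ℕ} (hm : 1 ≤ m) :
    thin p (fun k => tollRest p q μ u m k ^ 2) (m + 1)
      ≤ p * q * (2 * (2 * C ^ 2 / p) + 2 * (2 * C ^ 2 / q)) := by
  have hp1 : p ≤ 1 := by linarith
  have hq1 : q ≤ 1 := by linarith
  set D := fdiff (mean μ u) with hDdef
  have h1 := binVar_succ_le hp.le hp1 (tollRest p q μ u m) m
  have e1 : binVar p (tollRest p q μ u m) (m + 1)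
      = thin p (fun k => tollRest p q μ u m k ^ 2) (m + 1) := by
    rw [binVar, thin_tollRest hp hq hpq hμ hu hm]; ring
  rw [e1, show 1 - p = q by linarith] at h1
  have h2 : thin p (fun k => fdiff (tollRest p q μ u m) k ^ 2) m
      ≤ thin p (fun k => 2 * (D k - thin p D m) ^ 2 + 2 * (D (m - k) - thin q D m) ^ 2) m := by
    refine thin_mono hp.le hp1 fun k hk => ?_
    have : fdiff (tollRest p q μ u m) k = (D k - thin p D m) - (D (m - k) - thin q D m) := by
      have h3 := toll_fdiff μ u hk
      have h4 : fdiff (tollRest p q μ u m) k = fdiff (toll μ u (m + 1)) k - disc p q D m := by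
        simp only [fdiff, tollRest]; push_cast; ring
      rw [h4, h3, disc]; ring
    rw [this]
    nlinarith [sq_nonneg ((D k - thin p D m) + (D (m - k) - thin q D m))]
  have h5 : ∀ x, thin x (fun k => (D k - thin x D m) ^ 2) m = binVar x D m := by
    intro x
    have : (fun k => (D k - thin x D m) ^ 2)
        = fun k => (D k ^ 2 - (2 * thin x D m) * D k) + thin x D m ^ 2 := by
      funext k; ring
    rw [this, thin_add, thin_sub, thin_const_mul, thin_const, binVar]; ring
  rw [thin_add, thin_const_mul, thin_const_mul, h5,
    thin_reflect hpq (fun j => (D j - thin q D m) ^ 2), h5] at h2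
  have h6 := binVar_le_of_fdiff hD hp hp1 m
  have h7 := binVar_le_of_fdiff hD hq hq1 m
  have hm0 : (0 : ℝ) < m + 1 := by positivity
  have h8 : thin p (fun k => fdiff (tollRest p q μ u m) k ^ 2) m
      ≤ (2 * (2 * C ^ 2 / p) + 2 * (2 * C ^ 2 / q)) * (1 / (m + 1 : ℝ)) := by linarith
  calc _ ≤ (m + 1) * (p * q) * thin p (fun k => fdiff (tollRest p q μ u m) k ^ 2) m := h1
    _ ≤ (m + 1) * (p * q)
        * ((2 * (2 * C ^ 2 / p) + 2 * (2 * C ^ 2 / q)) * (1 / (m + 1 : ℝ))) := by gcongr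
    _ = _ := by field_simp

include hw

omit hp hq hμ hu hw in
lemma thin_toll_mul (m : ℕ) :
    thin p (fun k => toll μ u (m + 1) k * toll μ w (m + 1) k) (m + 1)
      = (m + 1) * (p * q * (disc p q (fdiff (mean μ u)) m * disc p q (fdiff (mean μ w)) m))
        + thin p (fun k => tollRest p q μ u m k * tollRest p q μ w m k) (m + 1) := by
  set a := disc p q (fdiff (mean μ u)) m with ha
  set b := disc p q (fdiff (mean μ w)) m with hb
  have e : (fun k => toll μ u (m + 1) k * toll μ w (m + 1) k)
      = fun k : ℕ => (((a * b) * (((k : ℝ) - p * (m + 1)) * ((k : ℝ) - p * (m + 1)))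
          + a * (((k : ℝ) - p * (m + 1)) * tollRest p q μ w m k))
          + b * (((k : ℝ) - p * (m + 1)) * tollRest p q μ u m k))
          + tollRest p q μ u m k * tollRest p q μ w m k := by
    funext k
    simp only [tollRest, ← ha, ← hb]; ring
  have h1 := thin_sub_mean_mul p (fun k : ℕ => (k : ℝ) - p * (m + 1)) m
  have h2 : fdiff (fun k : ℕ => (k : ℝ) - p * (m + 1)) = fun _ => 1 := by
    funext k; simp [fdiff]
  rw [h2, thin_const] at h1
  rw [e, thin_add, thin_add, thin_add, thin_const_mul, thin_const_mul, thin_const_mul, h1,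
    thin_sub_mean_mul, thin_sub_mean_mul, thin_fdiff_tollRest hpq, thin_fdiff_tollRest hpq,
    show 1 - p = q by linarith]
  ring

lemma cov_div_eq_green (m : ℕ) : cov μ u w (m + 1) / (m + 1 : ℝ)
    = green p q (fun m => thin p (fun k => toll μ u (m + 1) k * toll μ w (m + 1) k) (m + 1)
      / (m + 1 : ℝ)) m := by
  refine eq_green hp hq hpq (F := fun m : ℕ => cov μ u w (m + 1) / (m + 1 : ℝ)) ?_ ?_ m
  · simp [cov_init hμ hu le_rfl]
  · intro n hn
    have h := cov_recur hμ hu hw hp.le (by linarith) (show 2 ≤ n + 1 by omega)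
    have h1 := thin_div_succ p (cov μ u w) n
    have h2 := thin_div_succ q (cov μ u w) n
    rw [cov_init hμ hu zero_le_one, mul_zero, sub_zero] at h1 h2
    rw [avg, h1, h2, h, show 1 - p = q by linarith]
    ring

lemma abs_cov_div_sub_le {C C' : ℝ}
    (hD : ∀ n, |fdiff (fdiff (mean μ u)) n| ≤ C * (1 / (n + 1 : ℝ)))
    (hD' : ∀ n, |fdiff (fdiff (mean μ w)) n| ≤ C' * (1 / (n + 1 : ℝ))) :
    ∃ K, ∀ m : ℕ, |cov μ u w (m + 1) / (m + 1 : ℝ) - p * q * green p q (fun k =>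
      disc p q (fdiff (mean μ u)) k * disc p q (fdiff (mean μ w)) k) m| ≤ K := by
  set M := p * q * (2 * (2 * C ^ 2 / p) + 2 * (2 * C ^ 2 / q))
    + p * q * (2 * (2 * C' ^ 2 / p) + 2 * (2 * C' ^ 2 / q)) with hM
  have hM0 : 0 ≤ M := by positivity
  refine ⟨M * (1 / (2 * (p * q))), fun m => ?_⟩
  have e : cov μ u w (m + 1) / (m + 1 : ℝ) - p * q * green p q (fun k =>
      disc p q (fdiff (mean μ u)) k * disc p q (fdiff (mean μ w)) k) m
      = green p q (fun m => thin p (fun k => tollRest p q μ u m k * tollRest p q μ w m k) (m + 1)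
        / (m + 1 : ℝ)) m := by
    rw [cov_div_eq_green hp hq hpq hμ hu hw, ← green_const_mul hp hq hpq, sub_eq_iff_eq_add,
      ← green_add hp hq hpq]
    refine green_congr hp hq hpq (fun k _ => ?_) m
    rw [thin_toll_mul hpq]
    field_simp; ring
  rw [e]
  refine abs_green_le_of_le_inv_succ hp hq hpq hM0 (fun n hn => ?_) m
  have h1 := thin_sq_tollRest_le hp hq hpq hμ hu hD hn
  have h2 := thin_sq_tollRest_le hp hq hpq hμ hw hD' hn
  have h3 := abs_thin_le hp.le (by linarith) (n := n + 1)
    (f := fun k => tollRest p q μ u n k * tollRest p q μ w n k)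
    (g := fun k => tollRest p q μ u n k ^ 2 + tollRest p q μ w n k ^ 2) (fun k _ => by
      rw [abs_le]
      constructor <;> nlinarith [sq_nonneg (tollRest p q μ u n k + tollRest p q μ w n k),
        sq_nonneg (tollRest p q μ u n k - tollRest p q μ w n k),
        sq_nonneg (tollRest p q μ u n k), sq_nonneg (tollRest p q μ w n k)])
  rw [thin_add] at h3
  rw [abs_div, abs_of_pos (by positivity : (0 : ℝ) < n + 1), mul_one_div]
  gcongr
  linarith

omit hw in
/-- The increments of the mean of a functional with affine toll. -/
lemma fdiff_mean_eq_green {g : ℕ → ℝ} (hg1 : g 1 = u (1, 2))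
    (hg : ∀ n, 2 ≤ n → g n = u (1, n + 1) - u (1, n)) :
    fdiff (mean μ u) = green p q g := by
  have hrec : ∀ n, 2 ≤ n → mean μ u n = thin p (mean μ u) n + thin q (mean μ u) n + u (1, n) := by
    intro n hn
    rw [mean_recur hμ hu hp.le (by linarith) hn, thin_add, thin_add, thin_const, thin_reflect hpq]
  have h0 : mean μ u 0 = 0 := mean_init hμ hu zero_le_one
  have h1 : mean μ u 1 = 0 := mean_init hμ hu le_rfl
  funext n
  refine eq_green hp hq hpq (F := fdiff (mean μ u)) (by simp [fdiff, h0, h1]) (fun n hn => ?_) n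
  have a1 := fdiff_thin p (mean μ u) n
  have a2 := fdiff_thin q (mean μ u) n
  have a3 : avg p q (fdiff (mean μ u)) n
      = fdiff (thin p (mean μ u)) n + fdiff (thin q (mean μ u)) n := by
    rw [a1, a2, avg]
  have b := hrec (n + 1) (by omega)
  rw [a3]
  rcases hn.eq_or_lt with rfl | hn
  · have c : ∀ x, thin x (mean μ u) 1 = 0 := fun x => by
      simp [thin, Finset.sum_range_succ, h0, h1]
    simp only [fdiff, c, h1, hg1] at b ⊢
    linarith
  · have b' := hrec n hn
    rw [hg n hn]
    simp only [fdiff]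
    linarith

end Covariance

/-- The increments of the mean external path length, as a function of the number of strings. -/
noncomputable def pathProfile (p q : ℝ) (n : ℕ) : ℝ := green p q (fun _ => 1) n + profile p q n

section Asymptotics

variable {p q : ℝ} (hp : 0 < p) (hq : 0 < q) (hpq : p + q = 1)

include hp hq hpq

lemma pathProfile_eq_green : pathProfile p q = green p q fun n => 1 + indOne n :=
  funext fun n => (green_add hp hq hpq _ _ n).symm

lemma abs_fdiff_pathProfile_le :
    ∃ C, 0 ≤ C ∧ ∀ n, |fdiff (pathProfile p q) n| ≤ C * (1 / (n + 1 : ℝ)) := by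
  refine abs_fdiff_le hp hq hpq (e := fun n => if n = 0 then 0 else 1 + indOne n)
    (fun n => ?_) fun n hn => ?_
  · rw [pathProfile_eq_green hp hq hpq]
    rcases Nat.eq_zero_or_pos n with rfl | hn
    · simp [avg_zero hpq]
    · rw [if_neg hn.ne']
      exact green_eq hp hq hpq _ hn
  · simp [indOne, show n ≠ 0 by omega, show n ≠ 1 by omega]

lemma green_sq_disc_pathProfile_sub_le : ∃ C, 0 ≤ C ∧ ∀ n,
    green p q (fun k => (disc p q (pathProfile p q) k
      - Real.log (p / q) / (-(p * Real.log p) - q * Real.log q)) ^ 2) n ≤ C := by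
  set h := -(p * Real.log p) - q * Real.log q with hh
  have hpos : 0 < h := entropy_pos hp hq hpq
  obtain ⟨C1, hC1, b1⟩ := green_one_bounds hp hq hpq
  obtain ⟨C2, hC2, b2⟩ := harm_sub_avg_bounds hp hq hpq
  obtain ⟨C3, hC3, b3⟩ := disc_harm_bounds hp hq hpq
  rw [← hh] at b1 b2
  set Y : ℕ → ℝ := fun n => pathProfile p q n - (1 / h) * harm n with hY
  set K := C1 + 1 / (p * q) with hK
  have hK0 : 0 ≤ K := by positivity
  have hYK : ∀ n, |Y n| ≤ K := by
    intro n
    have e : Y n = (green p q (fun _ => 1) n - harm n / h) + profile p q n := by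
      simp only [hY, pathProfile]; ring
    rw [e]
    exact (abs_add_le _ _).trans (add_le_add (b1 n) (abs_profile_le hp hq hpq n))
  set M := 2 + C2 / h with hM
  have hM0 : 0 ≤ M := by positivity
  have he : ∀ n, 1 ≤ n → |Y n - avg p q Y n| ≤ M * (1 / (n + 1 : ℝ)) := by
    intro n hn
    have e : Y n - avg p q Y n
        = indOne n - ((harm n - avg p q harm n) - h) / h := by
      have e1 := green_eq hp hq hpq (fun n => 1 + indOne n) hn
      rw [← pathProfile_eq_green hp hq hpq] at e1
      rw [hY, avg_sub, avg_const_mul]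
      field_simp
      linear_combination h * e1
    rw [e]
    refine (abs_sub _ _).trans ?_
    rw [abs_div, abs_of_pos hpos, hM, add_mul]
    refine add_le_add (abs_indOne_le n) ?_
    rw [div_mul_eq_mul_div]
    exact div_le_div_of_nonneg_right (b2 n) hpos.le
  set G := (K ^ 2 + 2 * K * (M * (1 / (2 * (p * q))))) / (p * q) with hG
  have hGY : ∀ n, green p q (fun k => disc p q Y k ^ 2) n ≤ G := by
    intro n
    have h1 := green_sq_disc_le hp hq hpq hYK (e := fun n => Y n - avg p q Y n)
      (fun n _ => by ring) n
    have h2 := abs_green_le_of_le_inv_succ hp hq hpq hM0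
      (f := fun n => |Y n - avg p q Y n|) (fun n hn => by rw [abs_abs]; exact he n hn) n
    have h3 := mul_le_mul_of_nonneg_left ((le_abs_self _).trans h2)
      (by positivity : 0 ≤ 2 * K)
    rw [hG, le_div_iff₀ (by positivity)]
    linarith
  refine ⟨2 * ((C3 / h) ^ 2 * (1 / (2 * (p * q)))) + 2 * G, by positivity, fun n => ?_⟩
  have h1 : ∀ k, 1 ≤ k → (disc p q (pathProfile p q) k - Real.log (p / q) / h) ^ 2
      ≤ 2 * ((disc p q harm k - Real.log (p / q)) / h) ^ 2 + 2 * disc p q Y k ^ 2 := by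
    intro k _
    have e : disc p q (pathProfile p q) k - Real.log (p / q) / h
        = (disc p q harm k - Real.log (p / q)) / h + disc p q Y k := by
      rw [hY, disc_sub, disc_const_mul]; ring
    rw [e]
    nlinarith [sq_nonneg ((disc p q harm k - Real.log (p / q)) / h - disc p q Y k)]
  refine (green_mono hp hq hpq h1 n).trans ?_
  rw [green_add hp hq hpq, green_const_mul hp hq hpq, green_const_mul hp hq hpq]
  have h2 := abs_green_le_of_le_inv_succ hp hq hpq (C := (C3 / h) ^ 2) (by positivity)
    (f := fun k => ((disc p q harm k - Real.log (p / q)) / h) ^ 2) (fun k _ => by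
      have hk : (1 : ℝ) ≤ k + 1 := by linarith [Nat.cast_nonneg (α := ℝ) k]
      have hk1 : 1 / (k + 1 : ℝ) ≤ 1 := by rw [div_le_one (by positivity)]; exact hk
      have hk0 : 0 ≤ 1 / (k + 1 : ℝ) := by positivity
      rw [abs_of_nonneg (sq_nonneg _), ← sq_abs, abs_div, abs_of_pos hpos]
      calc (|disc p q harm k - Real.log (p / q)| / h) ^ 2
          ≤ (C3 * (1 / (k + 1 : ℝ)) / h) ^ 2 := by gcongr; exact b3 k
        _ = (C3 / h) ^ 2 * ((1 / (k + 1 : ℝ)) * (1 / (k + 1 : ℝ))) := by ring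
        _ ≤ (C3 / h) ^ 2 * (1 / (k + 1 : ℝ)) := by gcongr; nlinarith) n
  have h3 := (le_abs_self _).trans h2
  linarith [hGY n]

omit hp hq hpq in
lemma abs_harm_sub_log_le (n : ℕ) : |harm n - Real.log (n + 1)| ≤ 1 := by
  have h1 := log_add_one_le_harmonic n
  have h2 := harmonic_le_one_add_log n
  have h3 : Real.log n ≤ Real.log (n + 1) := by
    rcases Nat.eq_zero_or_pos n with rfl | hn
    · simp
    · exact Real.log_le_log (by positivity) (by linarith)
  push_cast at h1
  rw [harm, abs_le]
  constructor <;> linarith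

lemma tendsto_green_one_div_log :
    Tendsto (fun n : ℕ => green p q (fun _ => 1) n / Real.log (n + 1)) atTop
      (𝓝 (1 / (-(p * Real.log p) - q * Real.log q))) := by
  set h := -(p * Real.log p) - q * Real.log q with hh
  have hpos : 0 < h := entropy_pos hp hq hpq
  obtain ⟨C1, hC1, b1⟩ := green_one_bounds hp hq hpq
  rw [← hh] at b1
  have hlog : Tendsto (fun n : ℕ => Real.log (n + 1)) atTop atTop :=
    Real.tendsto_log_atTop.comp
      (tendsto_atTop_add_const_right _ _ tendsto_natCast_atTop_atTop)
  have h0 : Tendsto (fun n : ℕ => (C1 + 1 / h) / Real.log (n + 1)) atTop (𝓝 0) :=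
    tendsto_const_nhds.div_atTop hlog
  rw [← tendsto_sub_nhds_zero_iff]
  refine squeeze_zero_norm' ?_ h0
  filter_upwards [hlog.eventually_gt_atTop 0] with n hn
  have e : green p q (fun _ => 1) n / Real.log (n + 1) - 1 / h
      = ((green p q (fun _ => 1) n - harm n / h) + (harm n - Real.log (n + 1)) / h)
        / Real.log (n + 1) := by
    field_simp; ring
  rw [Real.norm_eq_abs, e, abs_div, abs_of_pos hn]
  refine div_le_div_of_nonneg_right ((abs_add_le _ _).trans (add_le_add (b1 n) ?_)) hn.le
  rw [abs_div, abs_of_pos hpos]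
  exact div_le_div_of_nonneg_right (abs_harm_sub_log_le n) hpos.le

lemma tendsto_green_one_atTop : Tendsto (green p q fun _ => 1) atTop atTop := by
  have hlog : Tendsto (fun n : ℕ => Real.log (n + 1)) atTop atTop :=
    Real.tendsto_log_atTop.comp
      (tendsto_atTop_add_const_right _ _ tendsto_natCast_atTop_atTop)
  have h := (tendsto_green_one_div_log hp hq hpq).pos_mul_atTop
    (by have := entropy_pos hp hq hpq; positivity) hlog
  refine h.congr' ?_
  filter_upwards [hlog.eventually_gt_atTop 0] with n hn
  field_simp

variable {μ : ℕ → Measure (ℕ × ℕ)} (hμ : IsTriePairFamily p μ)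

include hμ

lemma fdiff_mean_fst : fdiff (mean μ fun x => (x.1 : ℝ)) = profile p q :=
  fdiff_mean_eq_green hp hq hpq hμ isCoord_fst (by simp [indOne]) fun n hn => by
    simp [indOne, show n ≠ 1 by omega]

lemma fdiff_mean_snd : fdiff (mean μ fun x => (x.2 : ℝ)) = pathProfile p q := by
  rw [pathProfile_eq_green hp hq hpq]
  refine fdiff_mean_eq_green hp hq hpq hμ isCoord_snd (by simp [indOne]; norm_num) fun n hn => ?_
  simp [indOne, show n ≠ 1 by omega]

omit hp hq hpq hμ in
lemma varS_eq_cov (μ : ℕ → Measure (ℕ × ℕ)) (n : ℕ) : varS μ n = cov μ (fun x => (x.1 : ℝ)) (fun x => (x.1 : ℝ)) n := by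
  simp only [varS, cov, sq]; rfl

omit hp hq hpq hμ in
lemma varK_eq_cov (μ : ℕ → Measure (ℕ × ℕ)) (n : ℕ) : varK μ n = cov μ (fun x => (x.2 : ℝ)) (fun x => (x.2 : ℝ)) n := by
  simp only [varK, cov, sq]; rfl

lemma exists_pos_le_varS : ∃ c, 0 < c ∧ ∀ m : ℕ, 1 ≤ m → c ≤ varS μ (m + 1) / (m + 1 : ℝ) := by
  obtain ⟨c, hc, hcl⟩ := exists_pos_le_profile hp hq hpq
  refine ⟨q ^ 2 / 2 * c, by positivity, fun m hm => ?_⟩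
  rw [varS_eq_cov, cov_div_eq_green hp hq hpq hμ isCoord_fst isCoord_fst]
  have h1 : ∀ k : ℕ, 1 ≤ k → q ^ 2 / 2 * indOne k
      ≤ thin p (fun j => toll μ (fun x => (x.1 : ℝ)) (k + 1) j
        * toll μ (fun x => (x.1 : ℝ)) (k + 1) j) (k + 1) / (k + 1 : ℝ) := by
    intro k _
    have hnn : ∀ n, 0 ≤ thin p (fun j => toll μ (fun x => (x.1 : ℝ)) n j
        * toll μ (fun x => (x.1 : ℝ)) n j) n := fun n =>
      thin_nonneg hp.le (by linarith) fun j _ => mul_self_nonneg _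
    by_cases hk : k = 1
    · subst hk
      have t0 : toll μ (fun x => (x.1 : ℝ)) 2 0 = 1 := by
        simp [toll, mean_init hμ isCoord_fst zero_le_one]
      have t : q ^ 2 ≤ thin p (fun j => toll μ (fun x => (x.1 : ℝ)) 2 j
          * toll μ (fun x => (x.1 : ℝ)) 2 j) 2 := by
        rw [thin]
        refine le_trans (le_of_eq ?_) (Finset.single_le_sum (f := fun j => binWeight p 2 j
          * (toll μ (fun x => (x.1 : ℝ)) 2 j * toll μ (fun x => (x.1 : ℝ)) 2 j))
          (fun j _ => mul_nonneg (binWeight_nonneg hp.le (by linarith) _ _)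
            (mul_self_nonneg _)) (Finset.mem_range.2 (show 0 < 2 + 1 by norm_num)))
        simp only [t0, binWeight]
        rw [show 1 - p = q by linarith]
        simp
      simp only [indOne, if_true, mul_one]
      norm_num
      linarith
    · rw [indOne, if_neg hk, mul_zero]
      exact div_nonneg (hnn _) (by positivity)
  refine le_trans ?_ (green_mono hp hq hpq h1 m)
  rw [green_const_mul hp hq hpq]
  exact mul_le_mul_of_nonneg_left (hcl m hm) (by positivity)

lemma tendsto_varK_div_green_one :
    Tendsto (fun m : ℕ => varK μ (m + 1) / (m + 1 : ℝ) / green p q (fun _ => 1) m) atTop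
      (𝓝 (p * q * (Real.log (p / q) / (-(p * Real.log p) - q * Real.log q)) ^ 2)) := by
  set c := Real.log (p / q) / (-(p * Real.log p) - q * Real.log q) with hc
  set L := green p q (fun _ => 1) with hL
  obtain ⟨C, hC, hD⟩ := abs_fdiff_pathProfile_le hp hq hpq
  obtain ⟨G, hG, hζ⟩ := green_sq_disc_pathProfile_sub_le hp hq hpq
  rw [← hc] at hζ
  obtain ⟨K, hK⟩ := abs_cov_div_sub_le hp hq hpq hμ isCoord_snd isCoord_snd
    (C := C) (C' := C) (by rwa [fdiff_mean_snd hp hq hpq hμ]) (by rwa [fdiff_mean_snd hp hq hpq hμ])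
  rw [fdiff_mean_snd hp hq hpq hμ] at hK
  set ζ : ℕ → ℝ := fun k => disc p q (pathProfile p q) k - c with hζd
  have hLtop := tendsto_green_one_atTop hp hq hpq
  rw [← hL] at hLtop
  have hsq : Tendsto (fun m => √(L m)) atTop atTop := Real.tendsto_sqrt_atTop.comp hLtop
  have hz : Tendsto (fun m => (p * q * G + K) / L m + p * q * (2 * |c| * √G) / √(L m)) atTop
      (𝓝 0) := by
    simpa using (tendsto_const_nhds (x := p * q * G + K)).div_atTop hLtop |>.add
      ((tendsto_const_nhds (x := p * q * (2 * |c| * √G))).div_atTop hsq)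
  rw [← tendsto_sub_nhds_zero_iff]
  refine squeeze_zero_norm' ?_ hz
  filter_upwards [hLtop.eventually_gt_atTop 0] with m hm
  have h1 := hK m
  rw [← varK_eq_cov] at h1
  have e : (fun k => disc p q (pathProfile p q) k * disc p q (pathProfile p q) k)
      = fun k => (c ^ 2 * 1 + 2 * c * (ζ k * 1)) + ζ k ^ 2 := by
    funext k; simp only [hζd]; ring
  rw [e, green_add hp hq hpq, green_add hp hq hpq, green_const_mul hp hq hpq,
    green_const_mul hp hq hpq (2 * c), ← hL] at h1
  have h2 := sq_green_mul_le hp hq hpq ζ (fun _ => 1) m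
  simp only [one_pow] at h2
  rw [← hL] at h2
  set g := green p q (fun k => ζ k * 1) m with hg
  have h3 : 0 ≤ green p q (fun k => ζ k ^ 2) m :=
    green_nonneg hp hq hpq (fun _ _ => sq_nonneg _) m
  have h4 : |g| ≤ √G * √(L m) := by
    rw [← Real.sqrt_mul hG]
    refine Real.abs_le_sqrt (h2.trans ?_)
    exact mul_le_mul_of_nonneg_right (hζ m) hm.le
  have hs : 0 < √(L m) := Real.sqrt_pos.2 hm
  have e2 : varK μ (m + 1) / (m + 1 : ℝ) / L m - p * q * c ^ 2
      = (varK μ (m + 1) / (m + 1 : ℝ) - p * q * c ^ 2 * L m) / L m := by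
    field_simp
  rw [Real.norm_eq_abs, e2, abs_div, abs_of_pos hm]
  have h5 : |varK μ (m + 1) / (m + 1 : ℝ) - p * q * c ^ 2 * L m|
      ≤ (p * q * G + K) + p * q * (2 * |c| * (√G * √(L m))) := by
    have e3 : varK μ (m + 1) / (m + 1 : ℝ) - p * q * c ^ 2 * L m
        = ((varK μ (m + 1) / (m + 1 : ℝ) - p * q * (c ^ 2 * L m + 2 * c * g
          + green p q (fun k => ζ k ^ 2) m)) + p * q * green p q (fun k => ζ k ^ 2) m)
          + p * q * (2 * c * g) := by ring
    have hpq0 : 0 < p * q := by positivity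
    rw [e3]
    refine (abs_add_le _ _).trans (add_le_add ((abs_add_le _ _).trans ?_) ?_)
    · rw [abs_mul, abs_of_pos hpq0, abs_of_nonneg h3]
      have := mul_le_mul_of_nonneg_left (hζ m) hpq0.le
      linarith
    · rw [abs_mul, abs_of_pos hpq0, abs_mul, abs_mul, abs_two]
      gcongr
  refine (div_le_div_of_nonneg_right h5 hm.le).trans (le_of_eq ?_)
  rw [add_div]
  congr 1
  have := Real.mul_self_sqrt hm.le
  rw [div_eq_div_iff hm.ne' hs.ne']
  linear_combination p * q * (2 * |c| * √G) * this

lemma tendsto_covSK_div :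
    Tendsto (fun m : ℕ => covSK μ (m + 1) / (m + 1 : ℝ) / √(green p q (fun _ => 1) m)) atTop
      (𝓝 0) := by
  set c := Real.log (p / q) / (-(p * Real.log p) - q * Real.log q) with hc
  set L := green p q (fun _ => 1) with hL
  obtain ⟨C, hC, hD⟩ := abs_fdiff_pathProfile_le hp hq hpq
  obtain ⟨C', hC', hD'⟩ := abs_fdiff_profile_le hp hq hpq
  obtain ⟨G, hG, hζ⟩ := green_sq_disc_pathProfile_sub_le hp hq hpq
  obtain ⟨G', hδ⟩ := green_sq_disc_profile_le hp hq hpq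
  rw [← hc] at hζ
  obtain ⟨K, hK⟩ := abs_cov_div_sub_le hp hq hpq hμ isCoord_fst isCoord_snd
    (C := C') (C' := C) (by rwa [fdiff_mean_fst hp hq hpq hμ])
    (by rwa [fdiff_mean_snd hp hq hpq hμ])
  rw [fdiff_mean_snd hp hq hpq hμ, fdiff_mean_fst hp hq hpq hμ] at hK
  set ζ : ℕ → ℝ := fun k => disc p q (pathProfile p q) k - c with hζd
  set δ : ℕ → ℝ := disc p q (profile p q) with hδd
  have hLtop := tendsto_green_one_atTop hp hq hpq
  rw [← hL] at hLtop
  have hsq : Tendsto (fun m => √(L m)) atTop atTop := Real.tendsto_sqrt_atTop.comp hLtop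
  have hpq0 : 0 < p * q := by positivity
  rw [Metric.tendsto_atTop]
  intro ε hε
  set η := ε / 2 / (p * q * |c| + 1) with hη
  have hη0 : 0 < η := by positivity
  obtain ⟨M, hM⟩ := abs_green_disc_profile_le hp hq hpq hη0
  rw [← hδd, ← hL] at hM
  set N := p * q * (|c| * M) + p * q * (G' + G) + K with hN
  have hev := (hsq.eventually_gt_atTop (max 0 (2 * N / ε)))
  obtain ⟨m0, hm0⟩ := eventually_atTop.1 hev
  refine ⟨m0, fun m hm => ?_⟩
  have hmm := hm0 m hm
  have hs : 0 < √(L m) := (le_max_left _ _).trans_lt hmm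
  have hsN : 2 * N / ε < √(L m) := (le_max_right _ _).trans_lt hmm
  rw [div_lt_iff₀ hε] at hsN
  have h1 := hK m
  have e : (fun k => δ k * disc p q (pathProfile p q) k)
      = fun k => c * δ k + δ k * ζ k := by
    funext k; simp only [hζd]; ring
  rw [e, green_add hp hq hpq, green_const_mul hp hq hpq] at h1
  have h2 : |green p q (fun k => δ k * ζ k) m| ≤ G' + G := by
    have := abs_green_le hp hq hpq (f := fun k => δ k * ζ k) (g := fun k => δ k ^ 2 + ζ k ^ 2)
      (fun k _ => by
        rw [abs_le]
        constructor <;> nlinarith [sq_nonneg (δ k + ζ k), sq_nonneg (δ k - ζ k),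
          sq_nonneg (δ k), sq_nonneg (ζ k)]) m
    rw [green_add hp hq hpq] at this
    linarith [hζ m, hδ m]
  have h3 : |covSK μ (m + 1) / (m + 1 : ℝ)| ≤ p * q * (|c| * (η * √(L m) + M))
      + p * q * (G' + G) + K := by
    have e3 : covSK μ (m + 1) / (m + 1 : ℝ)
        = (p * q * (c * green p q δ m) + p * q * green p q (fun k => δ k * ζ k) m)
          + (covSK μ (m + 1) / (m + 1 : ℝ)
            - p * q * (c * green p q δ m + green p q (fun k => δ k * ζ k) m)) := by ring
    rw [e3]
    refine (abs_add_le _ _).trans (add_le_add ((abs_add_le _ _).trans (add_le_add ?_ ?_)) h1)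
    · rw [abs_mul, abs_of_pos hpq0, abs_mul]
      gcongr
      exact hM m
    · rw [abs_mul, abs_of_pos hpq0]
      gcongr
  rw [Real.dist_eq, sub_zero, abs_div, abs_of_pos hs, div_lt_iff₀ hs]
  have h4 : p * q * |c| * η < ε / 2 := by
    rw [hη, mul_div_assoc', div_lt_iff₀ (by positivity)]
    nlinarith
  have h5 := mul_lt_mul_of_pos_right h4 hs
  have e5 : p * q * (|c| * (η * √(L m) + M)) + p * q * (G' + G) + K
      = p * q * |c| * η * √(L m) + N := by rw [hN]; ring
  linarith

end Asymptotics

section SquareRoots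

lemma sqrt_entries_bounds {x y z s t d v w c b κ : ℝ} (hx : 0 < x) (hz : 0 < z) (hs : 0 < s)
    (ht : 0 < t) (hd0 : 0 < d) (hd : d = x * z - y * y) (r00 : x * x + y * y = v)
    (r01 : x * y + y * z = c) (r11 : y * y + z * z = w) (s00 : s * s = v) (s11 : t * t = b)
    (hκ : κ = √(c ^ 2 / (v * w) / (1 - c ^ 2 / (v * w)))) :
    (0 ≤ z * s / d ∧ 1 ≤ (z * s / d) ^ 2 ∧ (z * s / d) ^ 2 ≤ 1 + 2 * κ + 2 * κ ^ 2) ∧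
    (y * t / d) ^ 2 ≤ κ ^ 2 * (b / w) ∧ (y * s / d) ^ 2 ≤ κ ^ 2 ∧
    (0 ≤ x * t / d ∧ b / w ≤ (x * t / d) ^ 2
      ∧ (x * t / d) ^ 2 ≤ b / w * (1 + 2 * κ + 2 * κ ^ 2)) := by
  have hw : 0 < w := by nlinarith [mul_pos hz hz, mul_self_nonneg y]
  have hv : 0 < v := by nlinarith [mul_pos hx hx, mul_self_nonneg y]
  have hvw : v * w - c ^ 2 = d ^ 2 := by rw [← r00, ← r11, ← r01, hd]; ring
  have hκ2 : κ ^ 2 * d ^ 2 = c ^ 2 := by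
    have e : c ^ 2 / (v * w) / (1 - c ^ 2 / (v * w)) = c ^ 2 / d ^ 2 := by
      rw [← hvw]
      have : v * w - c ^ 2 ≠ 0 := by rw [hvw]; positivity
      field_simp
    rw [hκ, Real.sq_sqrt (by rw [e]; positivity), e]
    field_simp
  have hκ0 : 0 ≤ κ := by rw [hκ]; positivity
  have hxy : 0 < x * z := by positivity
  have hc2 : c ^ 2 = y ^ 2 * (x + z) ^ 2 := by rw [← r01]; ring
  have hy2 : y ^ 2 ≤ (x + z) ^ 2 := by nlinarith
  have hy4 : y ^ 2 ≤ κ * d := by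
    refine le_of_sq_le_sq ?_ (by positivity)
    rw [mul_pow, hκ2, hc2, sq (y ^ 2)]
    gcongr
  have hzy : z ^ 2 * y ^ 2 ≤ κ ^ 2 * d ^ 2 := by
    rw [hκ2, hc2, mul_comm]
    gcongr
    linarith
  have hxy' : x ^ 2 * y ^ 2 ≤ κ ^ 2 * d ^ 2 := by
    rw [hκ2, hc2, mul_comm]
    gcongr
    linarith
  have hyw : y ^ 2 * w ≤ κ ^ 2 * d ^ 2 := by
    rw [hκ2, hc2, ← r11]
    gcongr
    nlinarith
  have hyv : y ^ 2 * v ≤ κ ^ 2 * d ^ 2 := by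
    rw [hκ2, hc2, ← r00]
    gcongr
    nlinarith
  have hy44 : (y ^ 2) ^ 2 ≤ κ ^ 2 * d ^ 2 := by
    rw [← mul_pow]; gcongr
  have hxz : x * z = d + y ^ 2 := by rw [hd]; ring
  have hzv : z ^ 2 * v = d ^ 2 + 2 * y ^ 2 * d + (y ^ 2) ^ 2 + z ^ 2 * y ^ 2 := by
    rw [← r00]; linear_combination (x * z + d + y ^ 2) * hxz
  have hxw : x ^ 2 * w = d ^ 2 + 2 * y ^ 2 * d + (y ^ 2) ^ 2 + x ^ 2 * y ^ 2 := by
    rw [← r11]; linear_combination (x * z + d + y ^ 2) * hxz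
  have hyd : y ^ 2 * d ≤ κ * d ^ 2 := by
    linarith [mul_le_mul_of_nonneg_right hy4 hd0.le]
  have hyd0 : 0 ≤ y ^ 2 * d := by positivity
  have hd2 : 0 < d ^ 2 := by positivity
  have hb : 0 < b := by rw [← s11]; positivity
  have hs2 : s ^ 2 = v := by rw [← s00]; ring
  have ht2 : t ^ 2 = b := by rw [← s11]; ring
  simp only [mul_pow, hs2, ht2, div_pow]
  refine ⟨⟨by positivity, ?_, ?_⟩, ?_, ?_, by positivity, ?_, ?_⟩
  · rw [le_div_iff₀ hd2, hzv]
    linarith [sq_nonneg (y ^ 2), mul_nonneg (sq_nonneg z) (sq_nonneg y)]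
  · rw [div_le_iff₀ hd2, hzv]
    linarith
  · rw [div_le_iff₀ hd2, mul_div_assoc', div_mul_eq_mul_div, le_div_iff₀ hw]
    linarith [mul_le_mul_of_nonneg_left hyw hb.le]
  · rw [div_le_iff₀ hd2]
    exact hyv
  · rw [div_le_div_iff₀ hw hd2]
    have : d ^ 2 ≤ x ^ 2 * w := by
      rw [hxw]; linarith [sq_nonneg (y ^ 2), mul_nonneg (sq_nonneg x) (sq_nonneg y)]
    linarith [mul_le_mul_of_nonneg_left this hb.le]
  · rw [div_le_iff₀ hd2, div_mul_eq_mul_div, div_mul_eq_mul_div, le_div_iff₀ hw]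
    have : x ^ 2 * w ≤ (1 + 2 * κ + 2 * κ ^ 2) * d ^ 2 := by rw [hxw]; linarith
    linarith [mul_le_mul_of_nonneg_left this hb.le]

/-- Entrywise bounds for the quotient of two positive definite square roots. -/
lemma inv_mul_sqrt_bounds {R S : Matrix (Fin 2) (Fin 2) ℝ} {v w c b κ : ℝ}
    (hR : R.PosDef) (hRR : R * R = !![v, c; c, w]) (hS : S.PosDef) (hSS : S * S = !![v, 0; 0, b])
    (hκ : κ = √(c ^ 2 / (v * w) / (1 - c ^ 2 / (v * w)))) :
    (0 ≤ (R⁻¹ * S) 0 0 ∧ 1 ≤ (R⁻¹ * S) 0 0 ^ 2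
      ∧ (R⁻¹ * S) 0 0 ^ 2 ≤ 1 + 2 * κ + 2 * κ ^ 2) ∧
    (R⁻¹ * S) 0 1 ^ 2 ≤ κ ^ 2 * (b / w) ∧ (R⁻¹ * S) 1 0 ^ 2 ≤ κ ^ 2 ∧
    (0 ≤ (R⁻¹ * S) 1 1 ∧ b / w ≤ (R⁻¹ * S) 1 1 ^ 2
      ∧ (R⁻¹ * S) 1 1 ^ 2 ≤ b / w * (1 + 2 * κ + 2 * κ ^ 2)) := by
  have hRd := hR.det_pos
  have hx : 0 < R 0 0 := hR.diag_pos
  have hz : 0 < R 1 1 := hR.diag_pos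
  have hs : 0 < S 0 0 := hS.diag_pos
  have ht : 0 < S 1 1 := hS.diag_pos
  have hRs : R 1 0 = R 0 1 := by simpa using hR.1.apply 0 1
  have hSs : S 1 0 = S 0 1 := by simpa using hS.1.apply 0 1
  have r00 := congrFun (congrFun hRR 0) 0
  have r01 := congrFun (congrFun hRR 0) 1
  have r11 := congrFun (congrFun hRR 1) 1
  have s00 := congrFun (congrFun hSS 0) 0
  have s01 := congrFun (congrFun hSS 0) 1
  have s11 := congrFun (congrFun hSS 1) 1
  simp only [Matrix.mul_apply, Fin.sum_univ_two, Matrix.of_apply, Matrix.cons_val', Matrix.cons_val_zero,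
    Matrix.cons_val_one, Matrix.cons_val_fin_one, hRs, hSs] at r00 r01 r11 s00 s01 s11
  rw [Matrix.det_fin_two, hRs] at hRd
  have e00 : (R⁻¹ * S) 0 0
      = (R 0 0 * R 1 1 - R 0 1 * R 0 1)⁻¹ * (R 1 1 * S 0 0 - R 0 1 * S 1 0) := by
    rw [Matrix.inv_def, Matrix.adjugate_fin_two, Matrix.det_fin_two, hRs]
    simp [Matrix.mul_apply, Fin.sum_univ_two]; ring
  have e01 : (R⁻¹ * S) 0 1
      = (R 0 0 * R 1 1 - R 0 1 * R 0 1)⁻¹ * (R 1 1 * S 0 1 - R 0 1 * S 1 1) := by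
    rw [Matrix.inv_def, Matrix.adjugate_fin_two, Matrix.det_fin_two, hRs]
    simp [Matrix.mul_apply, Fin.sum_univ_two]; ring
  have e10 : (R⁻¹ * S) 1 0
      = (R 0 0 * R 1 1 - R 0 1 * R 0 1)⁻¹ * (R 0 0 * S 1 0 - R 0 1 * S 0 0) := by
    rw [Matrix.inv_def, Matrix.adjugate_fin_two, Matrix.det_fin_two, hRs]
    simp [Matrix.mul_apply, Fin.sum_univ_two]; ring
  have e11 : (R⁻¹ * S) 1 1
      = (R 0 0 * R 1 1 - R 0 1 * R 0 1)⁻¹ * (R 0 0 * S 1 1 - R 0 1 * S 0 1) := by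
    rw [Matrix.inv_def, Matrix.adjugate_fin_two, Matrix.det_fin_two, hRs]
    simp [Matrix.mul_apply, Fin.sum_univ_two]; ring
  rw [e00, e01, e10, e11]
  have hS0 : S 0 1 = 0 := by
    have : S 0 1 * (S 0 0 + S 1 1) = 0 := by linarith
    exact (mul_eq_zero.1 this).resolve_right (by positivity)
  rw [hSs, hS0]
  rw [hS0] at s00 s11
  have h := sqrt_entries_bounds (b := b) hx hz hs ht hRd rfl r00 r01 r11
    (s00.symm.trans (by ring)).symm (s11.symm.trans (by ring)).symm hκ
  simp only [mul_zero, sub_zero, zero_sub, inv_mul_eq_div, neg_div, neg_sq]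
  exact h

lemma tendsto_inv_mul_sqrt {R S : ℕ → Matrix (Fin 2) (Fin 2) ℝ} {v w c b : ℕ → ℝ}
    (hR : ∀ᶠ n in atTop, (R n).PosDef ∧ R n * R n = !![v n, c n; c n, w n])
    (hS : ∀ᶠ n in atTop, (S n).PosDef ∧ S n * S n = !![v n, 0; 0, b n])
    (hc : Tendsto (fun n => c n ^ 2 / (v n * w n)) atTop (𝓝 0))
    (hb : Tendsto (fun n => b n / w n) atTop (𝓝 1)) :
    Tendsto (fun n => (R n)⁻¹ * S n) atTop (𝓝 1) := by
  set κ : ℕ → ℝ := fun n => √(c n ^ 2 / (v n * w n) / (1 - c n ^ 2 / (v n * w n))) with hκ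
  have hκ0 : Tendsto κ atTop (𝓝 0) := by
    have := (hc.div (hc.const_sub 1) (by norm_num)).sqrt
    simpa using this
  have hκ2 : Tendsto (fun n => κ n ^ 2) atTop (𝓝 0) := by simpa using hκ0.pow 2
  have hu : Tendsto (fun n => 1 + 2 * κ n + 2 * κ n ^ 2) atTop (𝓝 1) := by
    simpa using ((hκ0.const_mul 2).const_add 1).add (hκ2.const_mul 2)
  have hbd := hR.and hS |>.mono fun n h =>
    inv_mul_sqrt_bounds h.1.1 h.1.2 h.2.1 h.2.2 (κ := κ n) rfl
  have h00 : Tendsto (fun n => ((R n)⁻¹ * S n) 0 0) atTop (𝓝 1) := by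
    have : Tendsto (fun n => ((R n)⁻¹ * S n) 0 0 ^ 2) atTop (𝓝 1) :=
      tendsto_of_tendsto_of_tendsto_of_le_of_le' tendsto_const_nhds hu
        (hbd.mono fun n h => h.1.2.1) (hbd.mono fun n h => h.1.2.2)
    have h := this.sqrt
    rw [Real.sqrt_one] at h
    exact h.congr' (hbd.mono fun n h => Real.sqrt_sq h.1.1)
  have h11 : Tendsto (fun n => ((R n)⁻¹ * S n) 1 1) atTop (𝓝 1) := by
    have : Tendsto (fun n => ((R n)⁻¹ * S n) 1 1 ^ 2) atTop (𝓝 1) :=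
      tendsto_of_tendsto_of_tendsto_of_le_of_le' hb (by simpa using hb.mul hu)
        (hbd.mono fun n h => h.2.2.2.2.1) (hbd.mono fun n h => h.2.2.2.2.2)
    have h := this.sqrt
    rw [Real.sqrt_one] at h
    exact h.congr' (hbd.mono fun n h => Real.sqrt_sq h.2.2.2.1)
  have h01 : Tendsto (fun n => ((R n)⁻¹ * S n) 0 1) atTop (𝓝 0) := by
    have h := ((hκ2.mul hb).sqrt)
    rw [zero_mul, Real.sqrt_zero] at h
    exact squeeze_zero_norm' (hbd.mono fun n h => Real.abs_le_sqrt h.2.1) h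
  have h10 : Tendsto (fun n => ((R n)⁻¹ * S n) 1 0) atTop (𝓝 0) := by
    have h := hκ2.sqrt
    rw [Real.sqrt_zero] at h
    exact squeeze_zero_norm' (hbd.mono fun n h => Real.abs_le_sqrt h.2.2.1) h
  refine tendsto_pi_nhds.2 fun i => tendsto_pi_nhds.2 fun j => ?_
  fin_cases i <;> fin_cases j
  · simpa using h00
  · simpa using h01
  · simpa using h10
  · simpa using h11

end SquareRoots

/-- for `p ≠ 1/2`, with `Σ̂_n` the covariance matrix of `(S_n, K_n)` and
`Σ̃_n = diag(Var S_n, λ n log n)`, one has `Σ̂_n^{-1/2} Σ̃_n^{1/2} → I₂`. -/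
theorem stmt6 (p : ℝ) (hp0 : 0 < p) (hp1 : p < 1) (hp : p ≠ 1 / 2) (q : ℝ) (hq : q = 1 - p)
    (h : ℝ) (hh : h = -(p * Real.log p) - q * Real.log q)
    (lam : ℝ) (hlam : lam = p * q * (Real.log (p / q)) ^ 2 / h ^ 3)
    (μ : ℕ → Measure (ℕ × ℕ)) (hμ : IsTriePairFamily p μ)
    (R Rt : ℕ → Matrix (Fin 2) (Fin 2) ℝ)
    (hR : ∀ᶠ n in atTop, (R n).PosDef ∧
      R n * R n = !![varS μ n, covSK μ n; covSK μ n, varK μ n])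
    (hRt : ∀ᶠ n in atTop, (Rt n).PosDef ∧
      Rt n * Rt n = !![varS μ n, 0; 0, lam * n * Real.log n]) :
    Tendsto (fun n : ℕ => (R n)⁻¹ * Rt n) atTop (𝓝 (1 : Matrix (Fin 2) (Fin 2) ℝ)) := by
  have hq0 : 0 < q := by linarith
  have hpq : p + q = 1 := by linarith
  have hh0 : 0 < h := hh ▸ entropy_pos hp0 hq0 hpq
  have hlog : Real.log (p / q) ≠ 0 := by
    refine Real.log_ne_zero_of_pos_of_ne_one (by positivity) fun h1 => hp ?_
    rw [div_eq_one_iff_eq hq0.ne'] at h1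
    linarith
  set L := green p q (fun _ => 1) with hL
  set σ := p * q * (Real.log (p / q) / h) ^ 2 with hσ
  have hσ0 : 0 < σ := by positivity
  have hK := tendsto_varK_div_green_one hp0 hq0 hpq hμ
  rw [← hh, ← hL, ← hσ] at hK
  have hSK := tendsto_covSK_div hp0 hq0 hpq hμ
  rw [← hL] at hSK
  have hlogL := tendsto_green_one_div_log hp0 hq0 hpq
  rw [← hh, ← hL] at hlogL
  have hLtop := tendsto_green_one_atTop hp0 hq0 hpq
  rw [← hL] at hLtop
  obtain ⟨c, hc, hcS⟩ := exists_pos_le_varS hp0 hq0 hpq hμ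
  refine tendsto_inv_mul_sqrt hR hRt ?_ ?_
  · rw [← tendsto_add_atTop_iff_nat 1]
    have h1 : Tendsto (fun m : ℕ => (covSK μ (m + 1) / (m + 1 : ℝ) / √(L m)) ^ 2
        / (c * (varK μ (m + 1) / (m + 1 : ℝ) / L m))) atTop (𝓝 0) := by
      have := (hSK.pow 2).div (hK.const_mul c) (by positivity)
      rw [zero_pow two_ne_zero, zero_div] at this
      exact this
    refine squeeze_zero_norm' ?_ h1
    filter_upwards [hLtop.eventually_gt_atTop 0, hK.eventually_const_lt hσ0,
      eventually_ge_atTop 1] with m hm hKm hm1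
    have hS := hcS m hm1
    have hm0 : (0 : ℝ) < m + 1 := by positivity
    rw [div_pow, Real.sq_sqrt hm.le]
    have e : covSK μ (m + 1) ^ 2 / (varS μ (m + 1) * varK μ (m + 1))
        = (covSK μ (m + 1) / (m + 1 : ℝ)) ^ 2 / L m
          / (varS μ (m + 1) / (m + 1 : ℝ) * (varK μ (m + 1) / (m + 1 : ℝ) / L m)) := by
      field_simp
    rw [e, Real.norm_eq_abs, abs_of_nonneg (by
      have := hc.trans_le hS
      positivity)]
    gcongr
  · rw [← tendsto_add_atTop_iff_nat 1]
    have h1 := (tendsto_const_nhds (x := lam)).div (hlogL.mul hK) (by positivity)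
    have e : lam / (1 / h * σ) = 1 := by
      rw [hlam, hσ]; field_simp
    rw [e] at h1
    refine h1.congr' ?_
    filter_upwards [hLtop.eventually_gt_atTop 0, hK.eventually_const_lt hσ0,
      eventually_ge_atTop 1] with m hm hKm hm1
    have hm0 : (0 : ℝ) < m + 1 := by positivity
    have hl : 0 < Real.log (m + 1) := Real.log_pos (by
      have : (1 : ℝ) ≤ m := by exact_mod_cast hm1
      linarith)
    have hv : varK μ (m + 1) ≠ 0 := by
      intro h0
      simp [h0] at hKm
    simp only [Pi.div_apply]
    push_cast
    field_simp
end

section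
/- Let p = 1/2 and let (S_n, K_n)_{n≥0} be a random trie pair family with parameter p = 1/2. Then there exist a constant d > 0 and N ∈ ℕ such that for all n ≥ N, Var(S_n)·Var(K_n) − Cov(S_n, K_n)² ≥ d n²; in particular, the covariance matrix of (S_n, K_n) is positive definite for all sufficiently large n. -/
open MeasureTheory ProbabilityTheory Filter Topology

namespace IsTriePairFamily

variable {p : ℝ} {μ : ℕ → Measure (ℕ × ℕ)}

lemma memLp_fst (hμ : IsTriePairFamily p μ) (n : ℕ) :
    MemLp (fun x : ℕ × ℕ => (x.1 : ℝ)) 2 (μ n) := by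
  rw [memLp_two_iff_integrable_sq (by fun_prop)]
  refine (hμ.moments n 2).mono' (by fun_prop) (ae_of_all _ fun x => ?_)
  rw [Real.norm_of_nonneg (by positivity)]
  gcongr
  simp

lemma memLp_snd (hμ : IsTriePairFamily p μ) (n : ℕ) :
    MemLp (fun x : ℕ × ℕ => (x.2 : ℝ)) 2 (μ n) := by
  rw [memLp_two_iff_integrable_sq (by fun_prop)]
  refine (hμ.moments n 2).mono' (by fun_prop) (ae_of_all _ fun x => ?_)
  rw [Real.norm_of_nonneg (by positivity)]
  gcongr
  simp

lemma memLp_linear (hμ : IsTriePairFamily p μ) (a b : ℝ) (n : ℕ) :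
    MemLp (fun x : ℕ × ℕ => a * (x.1 : ℝ) + b * (x.2 : ℝ)) 2 (μ n) :=
  ((hμ.memLp_fst n).const_mul a).add ((hμ.memLp_snd n).const_mul b)

/-- The law of the pair for `n` strings as a mixture over the size of the left subtree. -/
lemma measure_eq_sum (hμ : IsTriePairFamily p μ) {n : ℕ} (hn : 2 ≤ n) :
    μ n = ∑ k ∈ Finset.range (n + 1),
      ENNReal.ofReal ((n.choose k : ℝ) * p ^ k * (1 - p) ^ (n - k)) •
        ((μ k).prod (μ (n - k))).map
          (fun z : (ℕ × ℕ) × (ℕ × ℕ) => (z.1.1 + z.2.1 + 1, z.1.2 + z.2.2 + n)) := by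
  obtain ⟨P, hP, hB, hL, hR, hprod, hn'⟩ := hμ.recur n hn
  have hT : Measurable (trieStep n) := by
    refine measurable_from_prod_countable_right fun k => ?_
    change Measurable fun f : (ℕ → ℕ × ℕ) × (ℕ → ℕ × ℕ) =>
      ((f.1 k).1 + (f.2 (n - k)).1 + 1, (f.1 k).2 + (f.2 (n - k)).2 + n)
    fun_prop
  have : IsProbabilityMeasure (P.map fun ω => ω.2.1) :=
    Measure.isProbabilityMeasure_map (by fun_prop)
  have : IsProbabilityMeasure (P.map fun ω => ω.2.2) :=
    Measure.isProbabilityMeasure_map (by fun_prop)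
  ext s hs
  have hTs : MeasurableSet (trieStep n ⁻¹' s) := hT hs
  rw [hn', Measure.map_apply hT hs, hprod, Measure.prod_apply hTs, hB, binomialMeasure,
    lintegral_finsetSum_measure, Measure.finsetSum_apply]
  refine Finset.sum_congr rfl fun k _ => ?_
  rw [lintegral_smul_measure, lintegral_dirac, Measure.smul_apply]
  congr 1
  have hk : μ k = (P.map fun ω => ω.2.1).map (fun f => f k) := by
    rw [Measure.map_map (by fun_prop) (by fun_prop), ← hL k]
    rfl
  have hnk : μ (n - k) = (P.map fun ω => ω.2.2).map (fun f => f (n - k)) := by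
    rw [Measure.map_map (by fun_prop) (by fun_prop), ← hR (n - k)]
    rfl
  rw [hk, hnk, Measure.map_prod_map (P.map fun ω => ω.2.1) (P.map fun ω => ω.2.2)
      (measurable_pi_apply k) (measurable_pi_apply (n - k)),
    Measure.map_map (by fun_prop) (by fun_prop), Measure.map_apply (by fun_prop) hs]
  rfl

lemma integral_eq_sum (hμ : IsTriePairFamily (1 / 2) μ) {n : ℕ} (hn : 2 ≤ n)
    {h : ℕ × ℕ → ℝ} (hh : Integrable h (μ n)) :
    ∫ x, h x ∂μ n = ∑ k ∈ Finset.range (n + 1), ((n.choose k : ℝ) / 2 ^ n) *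
      ∫ z : (ℕ × ℕ) × (ℕ × ℕ), h (z.1.1 + z.2.1 + 1, z.1.2 + z.2.2 + n)
        ∂(μ k).prod (μ (n - k)) := by
  have hsum := hμ.measure_eq_sum hn
  rw [hsum, integrable_finsetSum_measure] at hh
  rw [hsum, integral_finsetSum_measure hh]
  refine Finset.sum_congr rfl fun k hk => ?_
  have hkn : k ≤ n := Nat.lt_succ_iff.mp (Finset.mem_range.mp hk)
  have hw : (n.choose k : ℝ) * (1 / 2) ^ k * (1 - 1 / 2) ^ (n - k) = n.choose k / 2 ^ n := by
    rw [show (1 - 1 / 2 : ℝ) = 1 / 2 by norm_num, mul_assoc, ← pow_add,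
      Nat.add_sub_cancel' hkn, one_div, inv_pow, div_eq_mul_inv]
  rw [hw, integral_smul_measure, ENNReal.toReal_ofReal (by positivity), smul_eq_mul,
    integral_map (by fun_prop) (by fun_prop)]

end IsTriePairFamily

/-- The mean of `a S_n + b K_n`. -/
noncomputable def linMean (μ : ℕ → Measure (ℕ × ℕ)) (a b : ℝ) (n : ℕ) : ℝ :=
  ∫ x, (a * (x.1 : ℝ) + b * (x.2 : ℝ)) ∂μ n

/-- The variance of `a S_n + b K_n`. -/
noncomputable def linVar (μ : ℕ → Measure (ℕ × ℕ)) (a b : ℝ) (n : ℕ) : ℝ :=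
  ∫ x, (a * (x.1 : ℝ) + b * (x.2 : ℝ) - linMean μ a b n) ^ 2 ∂μ n

lemma linVar_nonneg (μ : ℕ → Measure (ℕ × ℕ)) (a b : ℝ) (n : ℕ) : 0 ≤ linVar μ a b n :=
  integral_nonneg fun _ => sq_nonneg _

lemma integral_prod_add_sq {α β : Type*} [MeasurableSpace α] [MeasurableSpace β]
    {ν : Measure α} {ρ : Measure β} [IsProbabilityMeasure ν] [IsProbabilityMeasure ρ]
    {u : α → ℝ} {v : β → ℝ} (hu : MemLp u 2 ν) (hv : MemLp v 2 ρ)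
    (hu0 : ∫ x, u x ∂ν = 0) (hv0 : ∫ y, v y ∂ρ = 0) (c : ℝ) :
    ∫ z, (u z.1 + v z.2 + c) ^ 2 ∂ν.prod ρ = ∫ x, u x ^ 2 ∂ν + ∫ y, v y ^ 2 ∂ρ + c ^ 2 := by
  have hu1 := hu.integrable one_le_two
  have hv1 := hv.integrable one_le_two
  have h1 : Integrable (fun z : α × β => u z.1 ^ 2) (ν.prod ρ) := hu.integrable_sq.comp_fst ρ
  have h2 : Integrable (fun z : α × β => v z.2 ^ 2) (ν.prod ρ) := hv.integrable_sq.comp_snd ν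
  have h3 : Integrable (fun z : α × β => 2 * (u z.1 * v z.2)) (ν.prod ρ) :=
    (hu1.mul_prod hv1).const_mul 2
  have h4 : Integrable (fun z : α × β => 2 * c * u z.1) (ν.prod ρ) :=
    (hu1.comp_fst ρ).const_mul _
  have h5 : Integrable (fun z : α × β => 2 * c * v z.2) (ν.prod ρ) :=
    (hv1.comp_snd ν).const_mul _
  have hexp : ∀ z : α × β, (u z.1 + v z.2 + c) ^ 2 =
      u z.1 ^ 2 + v z.2 ^ 2 + 2 * (u z.1 * v z.2) + 2 * c * u z.1 + 2 * c * v z.2 + c ^ 2 :=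
    fun z => by ring
  simp_rw [hexp]
  rw [integral_add (by fun_prop) (by fun_prop), integral_add (by fun_prop) h5,
    integral_add (by fun_prop) h4, integral_add (by fun_prop) h3, integral_add h1 h2,
    integral_const_mul, integral_const_mul, integral_const_mul, integral_prod_mul,
    integral_fun_fst (fun x => u x ^ 2), integral_fun_snd (fun y => v y ^ 2),
    integral_fun_fst u, integral_fun_snd v, hu0, hv0]
  simp

namespace IsTriePairFamily

variable {μ : ℕ → Measure (ℕ × ℕ)}

lemma linMean_eq_sum (hμ : IsTriePairFamily (1 / 2) μ) (a b : ℝ) {n : ℕ} (hn : 2 ≤ n) :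
    linMean μ a b n = ∑ k ∈ Finset.range (n + 1), ((n.choose k : ℝ) / 2 ^ n) *
      (linMean μ a b k + linMean μ a b (n - k) + (a + b * n)) := by
  have := hμ.prob
  rw [linMean, hμ.integral_eq_sum hn ((hμ.memLp_linear a b n).integrable one_le_two)]
  refine Finset.sum_congr rfl fun k _ => ?_
  congr 1
  have h1 := ((hμ.memLp_linear a b k).integrable one_le_two).comp_fst (μ (n - k))
  have h2 := ((hμ.memLp_linear a b (n - k)).integrable one_le_two).comp_snd (μ k)
  have hexp : ∀ z : (ℕ × ℕ) × (ℕ × ℕ),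
      a * ((z.1.1 + z.2.1 + 1 : ℕ) : ℝ) + b * ((z.1.2 + z.2.2 + n : ℕ) : ℝ) =
      (a * (z.1.1 : ℝ) + b * (z.1.2 : ℝ)) + (a * (z.2.1 : ℝ) + b * (z.2.2 : ℝ)) + (a + b * n) :=
    fun z => by push_cast; ring
  simp_rw [hexp]
  have h12 : Integrable (fun z : (ℕ × ℕ) × (ℕ × ℕ) => (a * (z.1.1 : ℝ) + b * (z.1.2 : ℝ)) +
      (a * (z.2.1 : ℝ) + b * (z.2.2 : ℝ))) ((μ k).prod (μ (n - k))) := h1.add h2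
  rw [integral_add h12 (integrable_const _), integral_add h1 h2,
    integral_fun_fst (fun x : ℕ × ℕ => a * (x.1 : ℝ) + b * (x.2 : ℝ)),
    integral_fun_snd (fun x : ℕ × ℕ => a * (x.1 : ℝ) + b * (x.2 : ℝ))]
  simp [linMean]

lemma linVar_eq_sum (hμ : IsTriePairFamily (1 / 2) μ) (a b : ℝ) {n : ℕ} (hn : 2 ≤ n) :
    linVar μ a b n = ∑ k ∈ Finset.range (n + 1), ((n.choose k : ℝ) / 2 ^ n) *
      (linVar μ a b k + linVar μ a b (n - k) +
        (linMean μ a b k + linMean μ a b (n - k) + (a + b * n) - linMean μ a b n) ^ 2) := by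
  have := hμ.prob
  have hc : ∀ j, MemLp (fun x : ℕ × ℕ => a * (x.1 : ℝ) + b * (x.2 : ℝ) - linMean μ a b j) 2 (μ j) :=
    fun j => (hμ.memLp_linear a b j).sub (memLp_const _)
  have hc0 : ∀ j, ∫ x, (a * (x.1 : ℝ) + b * (x.2 : ℝ) - linMean μ a b j) ∂μ j = 0 := fun j => by
    rw [integral_sub ((hμ.memLp_linear a b j).integrable one_le_two) (integrable_const _)]
    simp [linMean]
  rw [linVar, hμ.integral_eq_sum hn (hc n).integrable_sq]
  refine Finset.sum_congr rfl fun k _ => ?_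
  congr 1
  rw [linVar, linVar, ← integral_prod_add_sq (hc k) (hc (n - k)) (hc0 k) (hc0 (n - k))]
  refine integral_congr_ae (ae_of_all _ fun z => ?_)
  push_cast
  ring

lemma two_mul_sum_linVar_le (hμ : IsTriePairFamily (1 / 2) μ) (a b : ℝ) {n : ℕ} (hn : 2 ≤ n) :
    2 * ∑ k ∈ Finset.range (n + 1), (n.choose k : ℝ) * linVar μ a b k ≤
      2 ^ n * linVar μ a b n := by
  have hrefl : ∑ k ∈ Finset.range (n + 1), (n.choose k : ℝ) * linVar μ a b (n - k) =
      ∑ k ∈ Finset.range (n + 1), (n.choose k : ℝ) * linVar μ a b k := by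
    rw [← Finset.sum_range_reflect]
    refine Finset.sum_congr rfl fun k hk => ?_
    have hkn : k ≤ n := Nat.lt_succ_iff.mp (Finset.mem_range.mp hk)
    rw [Nat.add_sub_cancel, Nat.choose_symm hkn, Nat.sub_sub_self hkn]
  rw [hμ.linVar_eq_sum a b hn]
  calc 2 * ∑ k ∈ Finset.range (n + 1), (n.choose k : ℝ) * linVar μ a b k
      = ∑ k ∈ Finset.range (n + 1),
          ((n.choose k : ℝ) * linVar μ a b k + (n.choose k : ℝ) * linVar μ a b (n - k)) := by
        rw [Finset.sum_add_distrib, hrefl, two_mul]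
    _ ≤ _ := by
        rw [Finset.mul_sum]
        refine Finset.sum_le_sum fun k _ => ?_
        rw [← mul_assoc, mul_div_cancel₀ _ (by positivity), ← mul_add]
        exact mul_le_mul_of_nonneg_left (le_add_of_nonneg_right (sq_nonneg _)) (by positivity)

lemma linVar_three (hμ : IsTriePairFamily (1 / 2) μ) (a b : ℝ) :
    linVar μ a b 3 = 2 * (a + 2 * b) ^ 2 + 4 / 9 * (a + 3 * b) ^ 2 := by
  have m0 : linMean μ a b 0 = 0 := by simp [linMean, hμ.init0]
  have m1 : linMean μ a b 1 = 0 := by simp [linMean, hμ.init1]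
  have v0 : linVar μ a b 0 = 0 := by simp [linVar, m0, hμ.init0]
  have v1 : linVar μ a b 1 = 0 := by simp [linVar, m1, hμ.init1]
  have m2 := hμ.linMean_eq_sum a b le_rfl
  have v2 := hμ.linVar_eq_sum a b le_rfl
  have m3 := hμ.linMean_eq_sum a b (show 2 ≤ 3 by norm_num)
  have v3 := hμ.linVar_eq_sum a b (show 2 ≤ 3 by norm_num)
  norm_num [Finset.sum_range_succ, Nat.choose, m0, m1, v0, v1] at m2 v2 m3 v3
  have e2 : linMean μ a b 2 = 2 * (a + 2 * b) := by linarith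
  rw [e2] at m3 v2 v3
  have e3 : linMean μ a b 3 = 2 * (a + 2 * b) + 4 / 3 * (a + 3 * b) := by linarith
  rw [e3] at v3
  have w2 : linVar μ a b 2 = 2 * (a + 2 * b) ^ 2 := by linarith
  rw [w2] at v3
  linarith

lemma linVar_three_le (hμ : IsTriePairFamily (1 / 2) μ) (a b : ℝ) {n : ℕ} (hn : 3 ≤ n) :
    2 * (n.choose 3 : ℝ) * linVar μ a b 3 ≤ 2 ^ n * linVar μ a b n := by
  refine le_trans ?_ (hμ.two_mul_sum_linVar_le a b (by omega))
  rw [mul_assoc]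
  gcongr
  exact Finset.single_le_sum (f := fun k => (n.choose k : ℝ) * linVar μ a b k)
    (fun k _ => mul_nonneg (by positivity) (linVar_nonneg μ a b k))
    (Finset.mem_range.mpr (by omega))

end IsTriePairFamily

lemma sum_range_choose_mul_add_one (n : ℕ) :
    2 * ∑ k ∈ Finset.range (n + 1), (n.choose k : ℝ) * (k + 1) = 2 ^ n * (n + 2) := by
  have h1 : ∑ k ∈ Finset.range (n + 1), (n.choose k : ℝ) = 2 ^ n := by
    exact_mod_cast Nat.sum_range_choose n
  have hrefl : ∑ k ∈ Finset.range (n + 1), (n.choose k : ℝ) * (k + 1) =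
      ∑ k ∈ Finset.range (n + 1), (n.choose k : ℝ) * (n - k + 1) := by
    rw [← Finset.sum_range_reflect]
    refine Finset.sum_congr rfl fun k hk => ?_
    have hkn : k ≤ n := Nat.lt_succ_iff.mp (Finset.mem_range.mp hk)
    rw [Nat.add_sub_cancel, Nat.choose_symm hkn, Nat.cast_sub hkn]
  rw [two_mul]
  nth_rewrite 2 [hrefl]
  rw [← Finset.sum_add_distrib, ← h1, Finset.sum_mul]
  exact Finset.sum_congr rfl fun k _ => by ring

lemma two_add_le_two_pow {n : ℕ} (hn : 8 ≤ n) : 2 + n + 3 * n ^ 2 ≤ 2 ^ n := by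
  induction n, hn using Nat.le_induction with
  | base => norm_num
  | succ m hm ih => rw [pow_succ 2 m]; nlinarith

namespace IsTriePairFamily

variable {μ : ℕ → Measure (ℕ × ℕ)}

/-- The variance of every linear combination grows linearly. -/
lemma linear_le_linVar (hμ : IsTriePairFamily (1 / 2) μ) (a b : ℝ) {n : ℕ} (hn : 3 ≤ n) :
    linVar μ a b 3 / 16 * (n + 1) ≤ linVar μ a b n := by
  have hQ := linVar_nonneg μ a b 3
  set c := linVar μ a b 3 / 16 with hc
  have hc0 : 0 ≤ c := by positivity
  induction n using Nat.strong_induction_on with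
  | _ n ih =>
  rcases lt_or_ge n 8 with h8 | h8
  · have h := hμ.linVar_three_le a b hn
    interval_cases n <;> norm_num [Nat.choose] at h ⊢ <;> linarith
  have hrec := hμ.two_mul_sum_linVar_le a b (show 2 ≤ n by omega)
  have hsum := sum_range_choose_mul_add_one n
  rw [Finset.sum_range_succ, Nat.choose_self] at hrec hsum
  have hlow : c * ∑ k ∈ Finset.range n, (n.choose k : ℝ) * (k + 1) -
      c * ∑ k ∈ Finset.range 3, (n.choose k : ℝ) * (k + 1) ≤
      ∑ k ∈ Finset.range n, (n.choose k : ℝ) * linVar μ a b k := by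
    rw [← Finset.sum_range_add_sum_Ico (fun k => (n.choose k : ℝ) * (k + 1)) hn,
      ← Finset.sum_range_add_sum_Ico (fun k => (n.choose k : ℝ) * linVar μ a b k) hn,
      mul_add, add_sub_cancel_left, Finset.mul_sum]
    refine le_add_of_nonneg_of_le (Finset.sum_nonneg fun k _ =>
      mul_nonneg (by positivity) (linVar_nonneg μ a b k)) (Finset.sum_le_sum fun k hk => ?_)
    obtain ⟨h3, hkn⟩ := Finset.mem_Ico.mp hk
    rw [mul_left_comm]
    gcongr
    exact ih k hkn h3
  have hsmall : 2 * ∑ k ∈ Finset.range 3, (n.choose k : ℝ) * (k + 1) = 2 + n + 3 * (n : ℝ) ^ 2 := by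
    simp only [Finset.sum_range_succ, Finset.sum_range_zero, Nat.choose_zero_right,
      Nat.choose_one_right, Nat.cast_choose_two]
    push_cast
    ring
  have hpow : (2 + n + 3 * (n : ℝ) ^ 2) ≤ 2 ^ n := by exact_mod_cast two_add_le_two_pow h8
  have hpow2 : (2 : ℝ) < 2 ^ n := by
    have : (0 : ℝ) < n := by positivity
    nlinarith
  refine le_of_mul_le_mul_left ?_ (sub_pos.mpr hpow2)
  have hmul := mul_le_mul_of_nonneg_left hpow hc0
  rw [← hsmall] at hmul
  have hsum' := congrArg (c * ·) hsum
  push_cast at hrec hsum'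
  linarith

lemma linVar_eq (hμ : IsTriePairFamily (1 / 2) μ) (a b : ℝ) (n : ℕ) :
    linVar μ a b n = a ^ 2 * varS μ n + 2 * a * b * covSK μ n + b ^ 2 * varK μ n := by
  have := hμ.prob n
  have hS := hμ.memLp_fst n
  have hK := hμ.memLp_snd n
  have hm : linMean μ a b n = a * eS μ n + b * eK μ n := by
    rw [linMean, integral_add ((hS.integrable one_le_two).const_mul a)
      ((hK.integrable one_le_two).const_mul b), integral_const_mul, integral_const_mul, eS, eK]
  have hS' : MemLp (fun x : ℕ × ℕ => (x.1 : ℝ) - eS μ n) 2 (μ n) := hS.sub (memLp_const _)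
  have hK' : MemLp (fun x : ℕ × ℕ => (x.2 : ℝ) - eK μ n) 2 (μ n) := hK.sub (memLp_const _)
  have h1 := hS'.integrable_sq.const_mul (a ^ 2)
  have h2 := (hS'.integrable_mul hK').const_mul (2 * a * b)
  have h3 := hK'.integrable_sq.const_mul (b ^ 2)
  simp only [Pi.mul_apply] at h2
  have h12 : Integrable (fun x : ℕ × ℕ => a ^ 2 * ((x.1 : ℝ) - eS μ n) ^ 2 +
      2 * a * b * (((x.1 : ℝ) - eS μ n) * ((x.2 : ℝ) - eK μ n))) (μ n) := h1.add h2
  rw [varS, covSK, varK, ← integral_const_mul, ← integral_const_mul, ← integral_const_mul,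
    ← integral_add h1 h2, ← integral_add h12 h3, linVar, hm]
  exact integral_congr_ae (ae_of_all _ fun x => by ring)

lemma linear_le_quadratic (hμ : IsTriePairFamily (1 / 2) μ) (a b : ℝ) {n : ℕ} (hn : 3 ≤ n) :
    n / 16 * (2 * (a + 2 * b) ^ 2 + 4 / 9 * (a + 3 * b) ^ 2) ≤
      a ^ 2 * varS μ n + 2 * a * b * covSK μ n + b ^ 2 * varK μ n := by
  have h := hμ.linear_le_linVar a b hn
  have h0 := linVar_nonneg μ a b 3
  rw [← hμ.linVar_eq, ← hμ.linVar_three]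
  linarith

end IsTriePairFamily

lemma sq_le_det_of_quadratic_le {t x y z : ℝ} (ht : 0 ≤ t)
    (h : ∀ a b : ℝ, t * (2 * (a + 2 * b) ^ 2 + 4 / 9 * (a + 3 * b) ^ 2) ≤
      a ^ 2 * x + 2 * a * b * y + b ^ 2 * z) :
    8 / 9 * t ^ 2 ≤ x * z - y ^ 2 := by
  have hd := discrim_le_zero (a := x - 22 / 9 * t) (b := 2 * (y - 16 / 3 * t))
    (c := z - 12 * t) fun s => by linarith [h s 1]
  rw [discrim] at hd
  have h1 := mul_nonneg ht (sub_nonneg.mpr (h 2 (-1)))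
  have h2 := mul_nonneg ht (sub_nonneg.mpr (h 3 (-1)))
  linarith

/-- for `p = 1/2`, the determinant of the covariance matrix of `(S_n, K_n)`
is at least `d n²` eventually; in particular the covariance matrix is eventually positive
definite. -/
theorem stmt7 (μ : ℕ → Measure (ℕ × ℕ)) (hμ : IsTriePairFamily (1 / 2) μ) :
    (∃ d : ℝ, 0 < d ∧ ∃ N : ℕ, ∀ n ≥ N,
      d * (n : ℝ) ^ 2 ≤ varS μ n * varK μ n - covSK μ n ^ 2) ∧
    (∃ N : ℕ, ∀ n ≥ N,
      (!![varS μ n, covSK μ n; covSK μ n, varK μ n] : Matrix (Fin 2) (Fin 2) ℝ).PosDef) := by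
  refine ⟨⟨1 / 288, by norm_num, 3, fun n hn => ?_⟩, 3, fun n hn => ?_⟩
  · have h := sq_le_det_of_quadratic_le (by positivity : (0 : ℝ) ≤ n / 16)
      fun a b => hμ.linear_le_quadratic a b hn
    linarith
  · refine Matrix.PosDef.of_dotProduct_mulVec_pos ?_ fun x hx => ?_
    · ext i j
      fin_cases i <;> fin_cases j <;> simp
    have h := hμ.linear_le_quadratic (x 0) (x 1) hn
    have hpos : 0 < 2 * (x 0 + 2 * x 1) ^ 2 + 4 / 9 * (x 0 + 3 * x 1) ^ 2 := by
      by_contra! hle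
      have e1 : x 0 + 2 * x 1 = 0 := by nlinarith [sq_nonneg (x 0 + 2 * x 1), sq_nonneg (x 0 + 3 * x 1)]
      have e2 : x 0 + 3 * x 1 = 0 := by nlinarith [sq_nonneg (x 0 + 2 * x 1), sq_nonneg (x 0 + 3 * x 1)]
      refine hx (funext fun i => ?_)
      fin_cases i <;> simp <;> linarith
    have hn0 : (0 : ℝ) < n / 16 := by positivity
    have hlt := lt_of_lt_of_le (mul_pos hn0 hpos) h
    simp only [dotProduct, Matrix.mulVec, Fin.sum_univ_two, Pi.star_apply, star_trivial,
      Matrix.of_apply, Matrix.cons_val_zero, Matrix.cons_val_one]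
    linarith
end
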